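/- (Lawson–Osserman) Let n > m ≥ 1 be integers and let η be a C² map defined on an open neighborhood of the unit sphere S^n ⊂ ℝ^{n+1} with values in ℝ^{m+1} such that ‖η(x)‖ = 1 for all x ∈ S^n, i.e. η restricts to a C² map η|_{S^n} : S^n → S^m. Suppose η|_{S^n} is not null-homotopic as a map from S^n to the unit sphere S^m ⊂ ℝ^{m+1}. Then there exists R_η > 0 such that for every R ≥ R_η there is no solution of the Dirichlet problem for the minimal surface system on the open unit ball Ω = D^{n+1} ⊂ ℝ^{n+1} with boundary data R·η|_{S^n}. -/

import Mathlib

open MeasureTheory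

/-- The induced metric `g_{ij} = δ_{ij} + Σ_α ∂_i F^α ∂_j F^α` of the graph of `F`
(using the a.e.-defined total `fderiv`). -/
noncomputable def mssMetric {n m : ℕ}
    (F : EuclideanSpace ℝ (Fin (n+1)) → EuclideanSpace ℝ (Fin (m+1)))
    (x : EuclideanSpace ℝ (Fin (n+1))) : Matrix (Fin (n+1)) (Fin (n+1)) ℝ :=
  fun i j => (if i = j then (1:ℝ) else 0) +
    ∑ α : Fin (m+1),
      fderiv ℝ F x (EuclideanSpace.single i 1) α * fderiv ℝ F x (EuclideanSpace.single j 1) α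

/-- `F` is a solution of the Dirichlet problem for the minimal surface system on `Ω`
with boundary data `f`: continuous on `closure Ω`, Lipschitz on `Ω`, equal to `f` on `∂Ω`,
and weakly satisfying the minimal surface system. -/
def IsMSSolution (n m : ℕ) (Ω : Set (EuclideanSpace ℝ (Fin (n+1))))
    (f F : EuclideanSpace ℝ (Fin (n+1)) → EuclideanSpace ℝ (Fin (m+1))) : Prop :=
  ContinuousOn F (closure Ω) ∧
  (∃ K : NNReal, LipschitzOnWith K F Ω) ∧
  (∀ x ∈ frontier Ω, F x = f x) ∧
  (∀ φ : EuclideanSpace ℝ (Fin (n+1)) → ℝ, ContDiff ℝ (⊤ : ℕ∞) φ → HasCompactSupport φ →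
     tsupport φ ⊆ Ω →
     (∀ j : Fin (n+1),
        ∫ x in Ω, (∑ i : Fin (n+1),
          Real.sqrt (mssMetric F x).det * (mssMetric F x)⁻¹ i j *
            fderiv ℝ φ x (EuclideanSpace.single i 1)) = 0) ∧
     (∀ α : Fin (m+1),
        ∫ x in Ω, (∑ i : Fin (n+1), ∑ j : Fin (n+1),
          Real.sqrt (mssMetric F x).det * (mssMetric F x)⁻¹ i j *
            fderiv ℝ F x (EuclideanSpace.single j 1) α *
            fderiv ℝ φ x (EuclideanSpace.single i 1)) = 0))

set_option linter.unusedSectionVars false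

section GraphAlgebra

open Matrix

variable {ι κ : Type*} [Fintype ι] [DecidableEq ι] [Fintype κ] [DecidableEq κ]

/-- The metric `1 + Dᵀ D` induced on the graph of a linear map `D`. -/
def graphMetric (D : Matrix κ ι ℝ) : Matrix ι ι ℝ := 1 + Dᵀ * D

/-- The matrix of `x ↦ (x, D x)`. -/
def graphFrame (D : Matrix κ ι ℝ) : Matrix (ι ⊕ κ) ι ℝ := fromRows 1 D

/-- The orthogonal projection of `ℝ^(ι ⊕ κ)` onto the graph of `D`. -/
noncomputable def graphProj (D : Matrix κ ι ℝ) : Matrix (ι ⊕ κ) (ι ⊕ κ) ℝ :=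
  graphFrame D * (graphMetric D)⁻¹ * (graphFrame D)ᵀ

/-- The area density of the graph of `D`. -/
noncomputable def graphDensity (D : Matrix κ ι ℝ) : ℝ := √(graphMetric D).det

lemma graphFrame_transpose_mul_self (D : Matrix κ ι ℝ) :
    (graphFrame D)ᵀ * graphFrame D = graphMetric D := by
  simp [graphFrame, graphMetric, transpose_fromRows, fromCols_mul_fromRows]

lemma graphMetric_posDef (D : Matrix κ ι ℝ) : (graphMetric D).PosDef :=
  PosDef.one.add_posSemidef (by simpa using posSemidef_conjTranspose_mul_self D)

lemma graphMetric_det_pos (D : Matrix κ ι ℝ) : 0 < (graphMetric D).det :=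
  (graphMetric_posDef D).det_pos

lemma graphDensity_pos (D : Matrix κ ι ℝ) : 0 < graphDensity D :=
  Real.sqrt_pos.2 (graphMetric_det_pos D)

lemma graphMetric_isUnit_det (D : Matrix κ ι ℝ) : IsUnit (graphMetric D).det :=
  (graphMetric_det_pos D).ne'.isUnit

lemma graphMetric_transpose (D : Matrix κ ι ℝ) : (graphMetric D)ᵀ = graphMetric D := by
  simp [graphMetric]

lemma graphMetric_inv_transpose (D : Matrix κ ι ℝ) :
    ((graphMetric D)⁻¹)ᵀ = (graphMetric D)⁻¹ := by
  rw [transpose_nonsing_inv, graphMetric_transpose]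

lemma graphProj_transpose (D : Matrix κ ι ℝ) : (graphProj D)ᵀ = graphProj D := by
  simp [graphProj, graphMetric_inv_transpose, Matrix.mul_assoc]

lemma graphProj_mul_graphFrame (D : Matrix κ ι ℝ) :
    graphProj D * graphFrame D = graphFrame D := by
  rw [graphProj, Matrix.mul_assoc, graphFrame_transpose_mul_self, Matrix.mul_assoc,
    nonsing_inv_mul _ (graphMetric_isUnit_det D), Matrix.mul_one]

lemma graphProj_mul_self (D : Matrix κ ι ℝ) : graphProj D * graphProj D = graphProj D := by
  conv_lhs => rw [graphProj.eq_def D, ← Matrix.mul_assoc, ← Matrix.mul_assoc, ← graphProj.eq_def D,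
    graphProj_mul_graphFrame]
  rfl

lemma graphProj_trace (D : Matrix κ ι ℝ) : (graphProj D).trace = Fintype.card ι := by
  rw [graphProj, trace_mul_comm, ← Matrix.mul_assoc, graphFrame_transpose_mul_self,
    mul_nonsing_inv _ (graphMetric_isUnit_det D), trace_one]

section Idempotent

variable {ν : Type*} [Fintype ν] [DecidableEq ν] {T : Matrix ν ν ℝ}

lemma dotProduct_mulVec_eq_self_of_idempotent (hs : Tᵀ = T) (hT : T * T = T) (v : ν → ℝ) :
    v ⬝ᵥ T *ᵥ v = (T *ᵥ v) ⬝ᵥ (T *ᵥ v) := by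
  conv_lhs => rw [← hT, ← mulVec_mulVec, dotProduct_mulVec, ← mulVec_transpose, hs]

lemma dotProduct_mulVec_nonneg_of_idempotent (hs : Tᵀ = T) (hT : T * T = T) (v : ν → ℝ) :
    0 ≤ v ⬝ᵥ T *ᵥ v := by
  rw [dotProduct_mulVec_eq_self_of_idempotent hs hT]
  exact Finset.sum_nonneg fun _ _ => mul_self_nonneg _

lemma dotProduct_mulVec_le_of_idempotent (hs : Tᵀ = T) (hT : T * T = T) (v : ν → ℝ) :
    v ⬝ᵥ T *ᵥ v ≤ v ⬝ᵥ v := by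
  have h := dotProduct_mulVec_nonneg_of_idempotent (T := 1 - T) (by simp [hs])
    (by simp [Matrix.mul_sub, Matrix.sub_mul, hT]) v
  rw [sub_mulVec, dotProduct_sub, one_mulVec] at h
  linarith

lemma abs_apply_le_one_of_idempotent (hs : Tᵀ = T) (hT : T * T = T) (a b : ν) :
    |T a b| ≤ 1 := by
  have h1 : T b b = ∑ c, T c b ^ 2 := by
    conv_lhs => rw [← hT, Matrix.mul_apply]
    refine Finset.sum_congr rfl fun c _ => ?_
    rw [sq, ← congrFun (congrFun hs b) c, transpose_apply]
  have h2 : T a b ^ 2 ≤ T b b := by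
    rw [h1]
    exact Finset.single_le_sum (f := fun c => T c b ^ 2) (fun _ _ => sq_nonneg _)
      (Finset.mem_univ a)
  have h3 : T b b ^ 2 ≤ T b b := by
    conv_rhs => rw [h1]
    exact Finset.single_le_sum (f := fun c => T c b ^ 2) (fun _ _ => sq_nonneg _)
      (Finset.mem_univ b)
  rw [abs_le_one_iff_mul_self_le_one]
  nlinarith

/-- For orthogonal projections `Q`, `T`, the defect of `range Q ⊆ range T`, measured by a trace,
is a sum of squares. -/
lemma trace_mul_one_sub_of_idempotent {Q : Matrix ν ν ℝ} (hs : Tᵀ = T) (hT : T * T = T)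
    (hQs : Qᵀ = Q) (hQ : Q * Q = Q) :
    (Q * (1 - T)).trace = ∑ a, ∑ b, ((1 - T) * Q) a b ^ 2 := by
  have h1 : (Q * (1 - T)).trace = (((1 - T) * Q)ᵀ * ((1 - T) * Q)).trace := by
    have h2 : (1 - T) * (1 - T) = 1 - T := by simp [Matrix.mul_sub, Matrix.sub_mul, hT]
    rw [transpose_mul, transpose_sub, hs, hQs, transpose_one, Matrix.mul_assoc,
      ← Matrix.mul_assoc (1 - T), h2, trace_mul_comm Q ((1 - T) * Q), Matrix.mul_assoc, hQ,
      trace_mul_comm]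
  rw [h1, Matrix.trace, Finset.sum_comm]
  simp only [diag_apply, Matrix.mul_apply (M := ((1 - T) * Q)ᵀ), transpose_apply, sq]

end Idempotent

lemma graphProj_apply_inl_inl (D : Matrix κ ι ℝ) (i j : ι) :
    graphProj D (Sum.inl i) (Sum.inl j) = (graphMetric D)⁻¹ i j := by
  simp only [graphProj, graphFrame, transpose_fromRows, fromRows_mul, mul_fromCols]
  simp

/-- If the codomain is smaller than the domain, the horizontal trace is at least one. -/
lemma one_le_trace_graphMetric_inv (hcard : Fintype.card κ < Fintype.card ι) (D : Matrix κ ι ℝ) :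
    1 ≤ ((graphMetric D)⁻¹).trace := by
  have h1 := graphProj_trace D
  rw [Matrix.trace, Fintype.sum_sum_type] at h1
  have h2 : ∑ a : κ, (graphProj D).diag (Sum.inr a) ≤ ∑ _a : κ, (1 : ℝ) := by
    refine Finset.sum_le_sum fun a _ => ?_
    exact (le_abs_self _).trans
      (abs_apply_le_one_of_idempotent (graphProj_transpose D) (graphProj_mul_self D) _ _)
  have h3 : ∑ i, (graphProj D).diag (Sum.inl i) = ((graphMetric D)⁻¹).trace := by
    simp [Matrix.trace, graphProj_apply_inl_inl]
  have h4 : (Fintype.card κ : ℝ) + 1 ≤ Fintype.card ι := by exact_mod_cast hcard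
  simp only [Finset.sum_const, Finset.card_univ, nsmul_eq_mul, mul_one] at h2
  linarith

/-- The conormal component of the area density is controlled by the tangential derivative. -/
lemma graphDensity_mul_quadratic_le {D D₀ : Matrix κ ι ℝ} {u : ι → ℝ} (hu : u ⬝ᵥ u = 1)
    (hD : D * (1 - vecMulVec u u) = D₀) :
    graphDensity D * (u ⬝ᵥ (graphMetric D)⁻¹ *ᵥ u) ≤ √(1 + D₀ * D₀ᵀ).det := by
  set g := graphMetric D with hg
  set v := g⁻¹ *ᵥ u with hv
  have hgv : g *ᵥ v = u := by
    rw [hv, mulVec_mulVec, mul_nonsing_inv _ (graphMetric_isUnit_det D), one_mulVec]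
  set P : Matrix ι ι ℝ := 1 - vecMulVec u u with hP
  have hPt : Pᵀ = P := by simp [hP, transpose_vecMulVec]
  have hPP : P * P = P := by
    simp [hP, Matrix.mul_sub, Matrix.sub_mul, vecMulVec_mul_vecMulVec, hu]
  have hdet1 : (P + vecMulVec v u).det = u ⬝ᵥ v := by
    have : P + vecMulVec v u
        = 1 + replicateCol Unit (v - u) * replicateRow Unit u := by
      rw [← vecMulVec_eq, sub_vecMulVec, hP]; abel
    rw [this, det_one_add_replicateCol_mul_replicateRow, dotProduct_sub, hu]; ring
  have hdet2 : (g * (P + vecMulVec v u)).det = (1 + D₀ * D₀ᵀ).det := by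
    have h1 : g * (P + vecMulVec v u) = 1 + Dᵀ * D₀ := by
      rw [Matrix.mul_add, mul_vecMulVec, hgv, hg, graphMetric, Matrix.add_mul, Matrix.one_mul,
        Matrix.mul_assoc, hD, hP]
      abel
    have h2 : D₀ * Dᵀ = D₀ * D₀ᵀ := by
      rw [← hD, transpose_mul, hPt, Matrix.mul_assoc, Matrix.mul_assoc, ← Matrix.mul_assoc P, hPP]
    rw [h1, det_one_add_mul_comm, h2]
  have hq : g.det * (u ⬝ᵥ v) = (1 + D₀ * D₀ᵀ).det := by
    rw [← hdet2, det_mul, hdet1]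
  have hq0 : 0 ≤ u ⬝ᵥ v := by
    have := (graphMetric_posDef D).inv.posSemidef.dotProduct_mulVec_nonneg u
    simpa using this
  have hq1 : u ⬝ᵥ v ≤ 1 := by
    have := dotProduct_mulVec_le_of_idempotent (graphProj_transpose D) (graphProj_mul_self D)
      (Sum.elim u 0)
    have h2 : Sum.elim u (0 : κ → ℝ) ⬝ᵥ graphProj D *ᵥ Sum.elim u 0 = u ⬝ᵥ v := by
      simp [dotProduct, mulVec, graphProj_apply_inl_inl, hv, hg]
    rw [h2] at this
    simpa [dotProduct, hu] using this.trans_eq (by simpa [dotProduct] using hu)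
  refine Real.le_sqrt_of_sq_le ?_
  rw [mul_pow, graphDensity, Real.sq_sqrt (graphMetric_det_pos D).le, ← hq, ← hg]
  have := graphMetric_det_pos D
  rw [sq, ← mul_assoc]
  exact mul_le_of_le_one_right (mul_nonneg this.le hq0) hq1

/-- A determinant of a degenerate perturbation of the identity grows with one power less. -/
lemma det_one_add_smul_le_of_mulVec_eq_zero {m : ℕ} (hcard : Fintype.card κ = m + 1)
    {S : Matrix κ κ ℝ} {z : κ → ℝ} (hz : z ⬝ᵥ z = 1) (hS : S *ᵥ z = 0) {s : ℝ}
    (hs : ∀ a b, |S a b| ≤ s) {R : ℝ} (hR : 1 ≤ R) :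
    (1 + R ^ 2 • S).det ≤ ((m + 1).factorial * (s + 2) ^ (m + 1)) * R ^ (2 * m) := by
  have hR0 : R ^ 2 ≠ 0 := by positivity
  set A : Matrix κ κ ℝ := (R ^ 2)⁻¹ • 1 + S + (1 - (R ^ 2)⁻¹) • vecMulVec z z with hA
  set B : Matrix κ κ ℝ := 1 + ((R ^ 2)⁻¹ - 1) • vecMulVec z z with hB
  have hzz : vecMulVec z z * vecMulVec z z = vecMulVec z z := by
    simp [vecMulVec_mul_vecMulVec, hz]
  have hSz : S * vecMulVec z z = 0 := by rw [mul_vecMulVec, hS, zero_vecMulVec]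
  have hAB : 1 + R ^ 2 • S = R ^ 2 • (A * B) := by
    simp only [hA, hB, Matrix.mul_add, Matrix.add_mul, Matrix.mul_one, Matrix.smul_mul,
      Matrix.mul_smul, Matrix.one_mul, hzz, hSz, smul_add, smul_smul, add_zero]
    rw [mul_inv_cancel₀ hR0, one_smul]
    ext a b
    simp only [Matrix.add_apply, Matrix.smul_apply, smul_eq_mul]
    field_simp
    ring
  have hBdet : B.det = (R ^ 2)⁻¹ := by
    have : B = 1 + replicateCol Unit (((R ^ 2)⁻¹ - 1) • z) * replicateRow Unit z := by
      rw [hB, ← vecMulVec_eq, smul_vecMulVec]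
    rw [this, det_one_add_replicateCol_mul_replicateRow, dotProduct_smul, hz]
    simp
  have hz1 : ∀ a, |z a| ≤ 1 := fun a => by
    rw [abs_le_one_iff_mul_self_le_one, ← hz]
    exact Finset.single_le_sum (f := fun i => z i * z i) (fun _ _ => mul_self_nonneg _)
      (Finset.mem_univ a)
  have hr0 : 0 ≤ (R ^ 2)⁻¹ := by positivity
  have hr1 : (R ^ 2)⁻¹ ≤ 1 := inv_le_one_of_one_le₀ (by nlinarith)
  have hAe : ∀ a b, |A a b| ≤ s + 2 := fun a b => by
    have h1 : |(1 : Matrix κ κ ℝ) a b| ≤ 1 := by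
      rw [Matrix.one_apply]; split_ifs <;> simp
    have h2 : |z a * z b| ≤ 1 := by
      rw [abs_mul]; exact mul_le_one₀ (hz1 a) (abs_nonneg _) (hz1 b)
    have h3 := hs a b
    simp only [hA, Matrix.add_apply, Matrix.smul_apply, smul_eq_mul, vecMulVec_apply]
    rw [abs_le] at *
    constructor <;> nlinarith
  have hAdet := Matrix.det_le (A := A) (abv := AbsoluteValue.abs) (x := s + 2) hAe
  rw [AbsoluteValue.abs_apply, hcard, nsmul_eq_mul] at hAdet
  rw [hAB, det_smul, det_mul, hBdet, hcard]
  have : (R ^ 2) ^ (m + 1) * (A.det * (R ^ 2)⁻¹) = A.det * R ^ (2 * m) := by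
    rw [pow_succ, pow_mul]; field_simp
  rw [this]
  exact mul_le_mul_of_nonneg_right ((le_abs_self _).trans hAdet) (by positivity)

end GraphAlgebra

section Mollify

open Filter Topology Metric ContinuousLinearMap

open scoped Convolution Pointwise NNReal

variable {E : Type*} [NormedAddCommGroup E] [NormedSpace ℝ E] [FiniteDimensional ℝ E]
  [MeasurableSpace E] [BorelSpace E] {μ : Measure E} [μ.IsAddHaarMeasure]

/-- Directional derivatives of a mollification of a Lipschitz function. -/
lemma hasLineDerivAt_bump_convolution {φ : E → ℝ} {K : ℝ≥0} (hφ : LipschitzWith K φ)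
    (ρ : ContDiffBump (0 : E)) (x v : E) :
    HasLineDerivAt ℝ (ρ.normed μ ⋆[lsmul ℝ ℝ, μ] φ)
      ((ρ.normed μ ⋆[lsmul ℝ ℝ, μ] fun y => lineDeriv ℝ φ y v) x) x v := by
  have hint : Integrable (ρ.normed μ) μ := ρ.integrable_normed
  have hcont : Continuous (ρ.normed μ) := ρ.continuous_normed
  unfold HasLineDerivAt
  simp only [convolution, lsmul_apply, smul_eq_mul]
  have hmain := hasDerivAt_integral_of_dominated_loc_of_lip (μ := μ) (𝕜 := ℝ)
    (F := fun (s : ℝ) t => ρ.normed μ t * φ (x + s • v - t))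
    (F' := fun t => ρ.normed μ t * lineDeriv ℝ φ (x - t) v) (x₀ := 0) (s := Set.univ)
    (bound := fun t => ρ.normed μ t * (K * ‖v‖)) univ_mem
    (Eventually.of_forall fun s => by
      have := hφ.continuous
      exact (by fun_prop :
        Continuous fun t => ρ.normed μ t * φ (x + s • v - t)).aestronglyMeasurable)
    (by
      have hc := hφ.continuous
      refine Continuous.integrable_of_hasCompactSupport (by fun_prop) ?_
      exact (ρ.hasCompactSupport_normed (μ := μ)).mul_right)
    (by
      have hm : Measurable fun y => lineDeriv ℝ φ y v := measurable_lineDeriv hφ.continuous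
      exact (hcont.measurable.mul
        (hm.comp (measurable_const.sub measurable_id))).aestronglyMeasurable)
    (Eventually.of_forall fun t => by
      refine LipschitzOnWith.of_dist_le_mul fun a _ b _ => ?_
      have h0 : 0 ≤ ρ.normed μ t := ρ.nonneg_normed t
      rw [Real.dist_eq, ← mul_sub, abs_mul, abs_of_nonneg h0]
      have h1 := hφ.dist_le_mul (x + a • v - t) (x + b • v - t)
      rw [Real.dist_eq, dist_eq_norm] at h1
      have h2 : x + a • v - t - (x + b • v - t) = (a - b) • v := by rw [sub_smul]; abel
      rw [h2, norm_smul, Real.norm_eq_abs] at h1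
      have h3 : 0 ≤ ρ.normed μ t * (K * ‖v‖) := by positivity
      rw [Real.coe_nnabs, abs_of_nonneg h3, Real.dist_eq]
      calc _ ≤ ρ.normed μ t * (K * (|a - b| * ‖v‖)) := mul_le_mul_of_nonneg_left h1 h0
        _ = _ := by ring)
    (hint.mul_const _)
    (by
      have h1 : ∀ᵐ y ∂μ, LineDifferentiableAt ℝ φ y v := hφ.ae_lineDifferentiableAt v
      have h2 : ∀ᵐ t ∂μ, LineDifferentiableAt ℝ φ (x - t) v := by
        have := (Measure.measurePreserving_sub_left μ x).quasiMeasurePreserving.ae h1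
        exact this
      filter_upwards [h2] with t ht
      have h3 := ht.hasLineDerivAt
      unfold HasLineDerivAt at h3
      have h4 : (fun s : ℝ => φ (x + s • v - t)) = fun s : ℝ => φ (x - t + s • v) := by
        ext s; congr 1; abel
      have := h3.const_mul (ρ.normed μ t)
      simpa only [h4, add_sub_right_comm] using this)
  exact hmain.2

/-- Weak identities extend from smooth to Lipschitz compactly supported test functions. -/
lemma integral_eq_zero_of_lipschitz_of_hasCompactSupport {J : Type*} [Fintype J]
    {Ω : Set E} (hΩ : IsOpen Ω) (hΩb : μ Ω ≠ ⊤) (b : J → E → ℝ) (v : J → E)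
    (hbm : ∀ j, Measurable (b j)) {M : ℝ} (hbM : ∀ j x, |b j x| ≤ M)
    (h : ∀ φ : E → ℝ, ContDiff ℝ (⊤ : ℕ∞) φ → HasCompactSupport φ → tsupport φ ⊆ Ω →
      ∫ x in Ω, ∑ j, b j x * fderiv ℝ φ x (v j) ∂μ = 0)
    {φ : E → ℝ} {K : ℝ≥0} (hφ : LipschitzWith K φ) (hc : HasCompactSupport φ)
    (hs : tsupport φ ⊆ Ω) :
    ∫ x in Ω, ∑ j, b j x * fderiv ℝ φ x (v j) ∂μ = 0 := by
  obtain ⟨δ, hδ, hδΩ⟩ := hc.isCompact.exists_cthickening_subset_open hΩ hs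
  let ρ : ℕ → ContDiffBump (0 : E) := fun n =>
    ⟨δ / 2 / (n + 1), δ / (n + 1), by positivity, by
      apply div_lt_div_of_pos_right _ (by positivity); linarith⟩
  have hρ0 : Tendsto (fun n => (ρ n).rOut) atTop (𝓝 0) := by
    have := (tendsto_one_div_add_atTop_nhds_zero_nat (𝕜 := ℝ)).const_mul δ
    simpa [ρ, div_eq_mul_inv] using this
  have hρδ : ∀ n, (ρ n).rOut ≤ δ := fun n => by
    show δ / ((n : ℝ) + 1) ≤ δ
    apply div_le_self hδ.le
    have : (0 : ℝ) ≤ n := n.cast_nonneg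
    linarith
  let ψ : ℕ → E → ℝ := fun n => (ρ n).normed μ ⋆[lsmul ℝ ℝ, μ] φ
  have hψs : ∀ n, ContDiff ℝ (⊤ : ℕ∞) (ψ n) := fun n =>
    HasCompactSupport.contDiff_convolution_left _ (ρ n).hasCompactSupport_normed
      (ρ n).contDiff_normed hφ.continuous.locallyIntegrable
  have hψc : ∀ n, HasCompactSupport (ψ n) := fun n =>
    HasCompactSupport.convolution _ (ρ n).hasCompactSupport_normed hc
  have hψt : ∀ n, tsupport (ψ n) ⊆ Ω := fun n => by
    refine Set.Subset.trans (closure_minimal ?_ isClosed_cthickening) hδΩ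
    refine (support_convolution_subset _).trans ?_
    rw [(ρ n).support_normed_eq]
    rintro _ ⟨a, ha, c, hc', rfl⟩
    rw [mem_ball_zero_iff] at ha
    refine mem_cthickening_of_dist_le _ c _ _ (subset_tsupport _ hc') ?_
    simp only [dist_eq_norm, add_sub_cancel_right]
    exact ha.le.trans (hρδ n)
  have hline : ∀ n x w, fderiv ℝ (ψ n) x w
      = ((ρ n).normed μ ⋆[lsmul ℝ ℝ, μ] fun y => lineDeriv ℝ φ y w) x := fun n x w => by
    have hd : DifferentiableAt ℝ (ψ n) x := (hψs n).differentiable (by simp) x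
    rw [← hd.lineDeriv_eq_fderiv]
    exact (hasLineDerivAt_bump_convolution hφ (ρ n) x w).lineDeriv
  have hbd : ∀ n x w, |fderiv ℝ (ψ n) x w| ≤ K * ‖w‖ := fun n x w => by
    rw [hline, convolution]
    have h1 : ‖∫ t, (lsmul ℝ ℝ ((ρ n).normed μ t)) (lineDeriv ℝ φ (x - t) w) ∂μ‖
        ≤ ∫ t, (ρ n).normed μ t * (K * ‖w‖) ∂μ := by
      refine norm_integral_le_of_norm_le ((ρ n).integrable_normed.mul_const _)
        (Eventually.of_forall fun t => ?_)
      rw [lsmul_apply, smul_eq_mul, norm_mul, Real.norm_of_nonneg ((ρ n).nonneg_normed t)]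
      exact mul_le_mul_of_nonneg_left (norm_lineDeriv_le_of_lipschitz ℝ hφ)
        ((ρ n).nonneg_normed t)
    rwa [integral_mul_const, (ρ n).integral_normed, one_mul] at h1
  have hconv : ∀ᵐ x ∂μ, ∀ j, Tendsto (fun n => fderiv ℝ (ψ n) x (v j)) atTop
      (𝓝 (fderiv ℝ φ x (v j))) := by
    rw [ae_all_iff]
    intro j
    have hli : LocallyIntegrable (fun y => lineDeriv ℝ φ y (v j)) μ := by
      refine (locallyIntegrable_const (K * ‖v j‖)).mono
        (measurable_lineDeriv hφ.continuous).aestronglyMeasurable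
        (Eventually.of_forall fun x => ?_)
      refine (norm_lineDeriv_le_of_lipschitz ℝ hφ).trans (le_abs_self _)
    filter_upwards [ContDiffBump.ae_convolution_tendsto_right_of_locallyIntegrable (K := 2) hρ0
      (Eventually.of_forall fun n => by
        show δ / ((n : ℝ) + 1) ≤ 2 * (δ / 2 / ((n : ℝ) + 1))
        apply le_of_eq; field_simp) hli, hφ.ae_differentiableAt (μ := μ)] with x hx hdx
    simp_rw [hline]
    rw [← hdx.lineDeriv_eq_fderiv]
    exact hx
  have hlim : Tendsto (fun n => ∫ x in Ω, ∑ j, b j x * fderiv ℝ (ψ n) x (v j) ∂μ) atTop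
      (𝓝 (∫ x in Ω, ∑ j, b j x * fderiv ℝ φ x (v j) ∂μ)) := by
    refine tendsto_integral_of_dominated_convergence (fun _ => ∑ j, M * (K * ‖v j‖)) ?_ ?_ ?_ ?_
    · intro n
      refine (Finset.measurable_sum _ fun j _ => (hbm j).mul ?_).aestronglyMeasurable
      exact measurable_fderiv_apply_const ℝ (ψ n) (v j)
    · rw [integrable_const_iff]; right
      exact ⟨by simpa [lt_top_iff_ne_top] using hΩb⟩
    · intro n
      refine Eventually.of_forall fun x => (norm_sum_le _ _).trans (Finset.sum_le_sum fun j _ => ?_)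
      rw [norm_mul]
      exact mul_le_mul (hbM j x) (hbd n x _) (norm_nonneg _) ((abs_nonneg _).trans (hbM j x))
    · refine ae_restrict_of_ae (hconv.mono fun x hx => ?_)
      exact tendsto_finsetSum _ fun j _ => (hx j).const_mul _
  have hz : (fun n => ∫ x in Ω, ∑ j, b j x * fderiv ℝ (ψ n) x (v j) ∂μ) = fun _ => 0 :=
    funext fun n => h _ (hψs n) (hψc n) (hψt n)
  rw [hz] at hlim
  exact tendsto_nhds_unique hlim tendsto_const_nhds |>.symm ▸ rfl

end Mollify

section BoundaryTest

open Filter Topology Metric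

open scoped NNReal

variable {E : Type*} [NormedAddCommGroup E] [NormedSpace ℝ E] [FiniteDimensional ℝ E]
  [MeasurableSpace E] [BorelSpace E] {μ : Measure E} [μ.IsAddHaarMeasure]

lemma abs_le_mul_one_sub_norm_of_eqOn_sphere [Nontrivial E] {φ : E → ℝ} {K : ℝ≥0}
    (hφ : LipschitzWith K φ) (h0 : ∀ x ∈ sphere (0 : E) 1, φ x = 0) {x : E} (hx : ‖x‖ ≤ 1) :
    |φ x| ≤ K * (1 - ‖x‖) := by
  obtain ⟨y, hy, hxy⟩ : ∃ y : E, ‖y‖ = 1 ∧ ‖x - y‖ = 1 - ‖x‖ := by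
    rcases eq_or_ne x 0 with rfl | hne
    · obtain ⟨y, hy⟩ := exists_norm_eq E (zero_le_one' ℝ)
      exact ⟨y, hy, by simp [hy]⟩
    · have hn : ‖x‖ ≠ 0 := norm_ne_zero_iff.2 hne
      refine ⟨‖x‖⁻¹ • x, by simp [norm_smul, hn], ?_⟩
      have : x - ‖x‖⁻¹ • x = (1 - ‖x‖⁻¹) • x := by rw [sub_smul, one_smul]
      rw [this, norm_smul, Real.norm_eq_abs, abs_sub_comm, abs_of_nonneg]
      · field_simp
      · rw [sub_nonneg]
        exact (one_le_inv₀ (norm_pos_iff.2 hne)).2 hx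
  have := hφ.dist_le_mul x y
  rwa [h0 y (by simpa using hy), Real.dist_eq, sub_zero, dist_eq_norm, hxy] at this

lemma LipschitzWith.indicator_closedBall_of_eqOn_sphere [Nontrivial E] {φ : E → ℝ} {K : ℝ≥0}
    (hφ : LipschitzWith K φ) (h0 : ∀ x ∈ sphere (0 : E) 1, φ x = 0) :
    LipschitzWith K ((closedBall (0 : E) 1).indicator φ) := by
  have key : ∀ x y : E, ‖x‖ ≤ 1 → ¬ ‖y‖ ≤ 1 → |φ x| ≤ K * ‖x - y‖ := fun x y hx hy => by
    refine (abs_le_mul_one_sub_norm_of_eqOn_sphere hφ h0 hx).trans ?_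
    refine mul_le_mul_of_nonneg_left ?_ K.2
    have := norm_sub_norm_le y x
    rw [norm_sub_rev] at this
    linarith
  refine LipschitzWith.of_dist_le_mul fun x y => ?_
  simp only [Set.indicator, mem_closedBall_zero_iff]
  split_ifs with hx hy hy
  · exact hφ.dist_le_mul x y
  · rw [Real.dist_eq, sub_zero, dist_eq_norm]
    exact key x y hx hy
  · rw [Real.dist_eq, zero_sub, abs_neg, dist_comm, dist_eq_norm]
    exact key y x hy hx
  · simp only [dist_self]; positivity

/-- Weak identities extend to nonnegative Lipschitz test functions vanishing outside the ball. -/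
lemma integral_eq_zero_of_lipschitz_of_nonneg {J : Type*} [Fintype J]
    (b : J → E → ℝ) (v : J → E)
    (hbm : ∀ j, Measurable (b j)) {M : ℝ} (hbM : ∀ j x, |b j x| ≤ M)
    (h : ∀ φ : E → ℝ, ContDiff ℝ (⊤ : ℕ∞) φ → HasCompactSupport φ → tsupport φ ⊆ ball 0 1 →
      ∫ x in ball 0 1, ∑ j, b j x * fderiv ℝ φ x (v j) ∂μ = 0)
    {φ : E → ℝ} {K : ℝ≥0} (hφ : LipschitzWith K φ) (hn : ∀ x, 0 ≤ φ x)
    (hz : ∀ x, x ∉ ball (0 : E) 1 → φ x = 0) :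
    ∫ x in ball 0 1, ∑ j, b j x * fderiv ℝ φ x (v j) ∂μ = 0 := by
  let ψ : ℕ → E → ℝ := fun n x => max (φ x - 1 / ((n : ℝ) + 1)) 0
  have hψL : ∀ n, LipschitzWith K (ψ n) := fun n =>
    (LipschitzWith.of_dist_le_mul fun x y => by
      simpa using hφ.dist_le_mul x y : LipschitzWith K fun x => φ x - 1 / ((n : ℝ) + 1)).max_const 0
  have hsub : ∀ n, tsupport (ψ n) ⊆ {x | 1 / ((n : ℝ) + 1) ≤ φ x} := fun n => by
    refine closure_minimal (fun x hx => ?_) (isClosed_le continuous_const hφ.continuous)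
    rw [Function.mem_support] at hx
    by_contra hlt
    simp only [Set.mem_ofPred_eq, not_le] at hlt
    exact hx (max_eq_right (by linarith))
  have hsub' : ∀ n, tsupport (ψ n) ⊆ ball 0 1 := fun n => (hsub n).trans fun x hx => by
    by_contra hx'
    have : 0 < 1 / ((n : ℝ) + 1) := by positivity
    rw [Set.mem_ofPred_eq, hz x hx'] at hx
    linarith
  have hψc : ∀ n, HasCompactSupport (ψ n) := fun n =>
    (isCompact_closedBall (0 : E) 1).of_isClosed_subset (isClosed_tsupport _)
      ((hsub' n).trans ball_subset_closedBall)
  have hpt : ∀ x, ∀ᶠ n in atTop, fderiv ℝ (ψ n) x = fderiv ℝ φ x := fun x => by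
    rcases (hn x).eq_or_lt with h0 | hpos
    · have hmin : IsLocalMin φ x := Eventually.of_forall fun y => h0 ▸ hn y
      refine Eventually.of_forall fun n => ?_
      rw [hmin.fderiv_eq_zero]
      have hp : 0 < 1 / ((n : ℝ) + 1) := by positivity
      have : ψ n =ᶠ[𝓝 x] fun _ => 0 := by
        have := (hφ.continuous.tendsto x).eventually_lt_const (h0 ▸ hp)
        filter_upwards [this] with y hy
        exact max_eq_right (by linarith)
      rw [this.fderiv_eq, fderiv_const_apply]
    · have ht := (tendsto_one_div_add_atTop_nhds_zero_nat (𝕜 := ℝ)).eventually_lt_const hpos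
      filter_upwards [ht] with n hn'
      have : ψ n =ᶠ[𝓝 x] fun y => φ y - 1 / ((n : ℝ) + 1) := by
        filter_upwards [(hφ.continuous.tendsto x).eventually_const_lt hn'] with y hy
        exact max_eq_left (by linarith)
      rw [this.fderiv_eq, fderiv_sub_const]
  have hlim : Tendsto (fun n => ∫ x in ball 0 1, ∑ j, b j x * fderiv ℝ (ψ n) x (v j) ∂μ) atTop
      (𝓝 (∫ x in ball 0 1, ∑ j, b j x * fderiv ℝ φ x (v j) ∂μ)) := by
    refine tendsto_integral_of_dominated_convergence (fun _ => ∑ j, M * (K * ‖v j‖)) ?_ ?_ ?_ ?_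
    · intro n
      refine (Finset.measurable_sum _ fun j _ => (hbm j).mul ?_).aestronglyMeasurable
      exact measurable_fderiv_apply_const ℝ (ψ n) (v j)
    · rw [integrable_const_iff]; right
      exact ⟨by simpa using measure_ball_lt_top⟩
    · intro n
      refine Eventually.of_forall fun x => (norm_sum_le _ _).trans (Finset.sum_le_sum fun j _ => ?_)
      rw [norm_mul]
      refine mul_le_mul (hbM j x) ?_ (norm_nonneg _) ((abs_nonneg _).trans (hbM j x))
      exact (ContinuousLinearMap.le_opNorm _ _).trans
        (mul_le_mul_of_nonneg_right (norm_fderiv_le_of_lipschitz ℝ (hψL n)) (norm_nonneg _))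
    · refine Eventually.of_forall fun x => tendsto_const_nhds.congr' ?_
      filter_upwards [hpt x] with n hn'
      rw [hn']
  have hz' : (fun n => ∫ x in ball 0 1, ∑ j, b j x * fderiv ℝ (ψ n) x (v j) ∂μ) = fun _ => 0 :=
    funext fun n => integral_eq_zero_of_lipschitz_of_hasCompactSupport isOpen_ball
      measure_ball_lt_top.ne b v hbm hbM h (hψL n) (hψc n) (hsub' n)
  rw [hz'] at hlim
  exact tendsto_nhds_unique hlim tendsto_const_nhds

/-- Weak identities extend to Lipschitz test functions vanishing on the unit sphere. -/
lemma integral_eq_zero_of_lipschitz_of_eqOn_sphere [Nontrivial E] {J : Type*} [Fintype J]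
    (b : J → E → ℝ) (v : J → E)
    (hbm : ∀ j, Measurable (b j)) {M : ℝ} (hbM : ∀ j x, |b j x| ≤ M)
    (h : ∀ φ : E → ℝ, ContDiff ℝ (⊤ : ℕ∞) φ → HasCompactSupport φ → tsupport φ ⊆ ball 0 1 →
      ∫ x in ball 0 1, ∑ j, b j x * fderiv ℝ φ x (v j) ∂μ = 0)
    {φ : E → ℝ} {K : ℝ≥0} (hφ : LipschitzWith K φ) (h0 : ∀ x ∈ sphere (0 : E) 1, φ x = 0) :
    ∫ x in ball 0 1, ∑ j, b j x * fderiv ℝ φ x (v j) ∂μ = 0 := by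
  set ψ : E → ℝ := (closedBall (0 : E) 1).indicator φ with hψ
  have hψL : LipschitzWith K ψ := hφ.indicator_closedBall_of_eqOn_sphere h0
  have hψz : ∀ x, x ∉ ball (0 : E) 1 → ψ x = 0 := fun x hx => by
    by_cases h1 : x ∈ closedBall (0 : E) 1
    · rw [hψ, Set.indicator_of_mem h1]
      refine h0 x ?_
      rw [← closedBall_sdiff_ball]
      exact ⟨h1, hx⟩
    · rw [hψ, Set.indicator_of_notMem h1]
  have hψn : LipschitzWith K fun x => -ψ x := LipschitzWith.of_dist_le_mul fun x y => by
    simpa using hψL.dist_le_mul x y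
  have hpL : LipschitzWith K fun x => max (ψ x) 0 := hψL.max_const 0
  have hqL : LipschitzWith K fun x => max (-ψ x) 0 := hψn.max_const 0
  have hp := integral_eq_zero_of_lipschitz_of_nonneg b v hbm hbM h hpL
    (fun x => le_max_right _ _) (fun x hx => by simp [hψz x hx])
  have hq := integral_eq_zero_of_lipschitz_of_nonneg b v hbm hbM h hqL
    (fun x => le_max_right _ _) (fun x hx => by simp [hψz x hx])
  have hi : ∀ {χ : E → ℝ}, LipschitzWith K χ →
      IntegrableOn (fun x => ∑ j, b j x * fderiv ℝ χ x (v j)) (ball 0 1) μ := fun {χ} hχ => by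
    refine Measure.integrableOn_of_bounded (M := ∑ j, M * (K * ‖v j‖)) measure_ball_lt_top.ne ?_ ?_
    · refine (Finset.measurable_sum _ fun j _ => (hbm j).mul ?_).aestronglyMeasurable
      exact measurable_fderiv_apply_const ℝ χ (v j)
    · refine Eventually.of_forall fun x => (norm_sum_le _ _).trans (Finset.sum_le_sum fun j _ => ?_)
      rw [norm_mul]
      refine mul_le_mul (hbM j x) ?_ (norm_nonneg _) ((abs_nonneg _).trans (hbM j x))
      exact (ContinuousLinearMap.le_opNorm _ _).trans
        (mul_le_mul_of_nonneg_right (norm_fderiv_le_of_lipschitz ℝ hχ) (norm_nonneg _))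
  have hsub := integral_sub (hi hpL) (hi hqL)
  rw [hp, hq, sub_zero] at hsub
  rw [← hsub]
  refine setIntegral_congr_ae measurableSet_ball ?_
  filter_upwards [hpL.ae_differentiableAt (μ := μ), hqL.ae_differentiableAt (μ := μ)]
    with x hpx hqx hx
  have h1 : φ =ᶠ[𝓝 x] fun y => max (ψ y) 0 - max (-ψ y) 0 := by
    filter_upwards [isOpen_ball.mem_nhds hx] with y hy
    rw [hψ, Set.indicator_of_mem (ball_subset_closedBall hy)]
    rcases le_total (φ y) 0 with hy0 | hy0
    · rw [max_eq_right hy0, max_eq_left (by linarith)]; ring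
    · rw [max_eq_left hy0, max_eq_right (by linarith)]; ring
  rw [← Finset.sum_sub_distrib, h1.fderiv_eq, fderiv_fun_sub hpx hqx]
  refine Finset.sum_congr rfl fun j _ => ?_
  rw [_root_.sub_apply, mul_sub]

end BoundaryTest

section Jacobian

open Matrix Metric

open scoped NNReal

variable {ι κ : Type*} [Fintype ι] [DecidableEq ι] [Fintype κ] [DecidableEq κ]

/-- The matrix of partial derivatives of `F`. -/
noncomputable def jacobian (F : EuclideanSpace ℝ ι → EuclideanSpace ℝ κ)
    (x : EuclideanSpace ℝ ι) : Matrix κ ι ℝ :=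
  of fun a i => fderiv ℝ F x (EuclideanSpace.single i 1) a

variable {F : EuclideanSpace ℝ ι → EuclideanSpace ℝ κ} {K : ℝ≥0}

lemma jacobian_apply (x : EuclideanSpace ℝ ι) (a : κ) (i : ι) :
    jacobian F x a i = fderiv ℝ F x (EuclideanSpace.single i 1) a := rfl

lemma fderiv_apply_eq_jacobian_mulVec (x v : EuclideanSpace ℝ ι) (a : κ) :
    fderiv ℝ F x v a = (jacobian F x *ᵥ v) a := by
  have hv : v = ∑ i, v i • EuclideanSpace.single i (1 : ℝ) := by
    ext j
    simp [Pi.single_apply]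
  conv_lhs => rw [hv]
  simp [mulVec, dotProduct, jacobian_apply, mul_comm]

lemma abs_jacobian_le (hF : LipschitzWith K F) (x : EuclideanSpace ℝ ι) (a : κ) (i : ι) :
    |jacobian F x a i| ≤ K := by
  rw [jacobian_apply, ← Real.norm_eq_abs]
  refine (PiLp.norm_apply_le _ a).trans ((ContinuousLinearMap.le_opNorm _ _).trans ?_)
  simpa using norm_fderiv_le_of_lipschitz ℝ hF

lemma measurable_comp_jacobian (F : EuclideanSpace ℝ ι → EuclideanSpace ℝ κ)
    {f : Matrix κ ι ℝ → ℝ} (hf : Continuous f) : Measurable fun x => f (jacobian F x) := by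
  have h1 : Measurable fun (x : EuclideanSpace ℝ ι) (a : κ) (i : ι) => jacobian F x a i := by
    refine measurable_pi_iff.2 fun a => measurable_pi_iff.2 fun i => ?_
    exact (EuclideanSpace.proj (𝕜 := ℝ) a).continuous.measurable.comp
      (measurable_fderiv_apply_const ℝ F (EuclideanSpace.single i 1))
  have h2 : Continuous fun D : κ → ι → ℝ => f (of D) := hf
  exact h2.measurable.comp h1

lemma isCompact_setOf_abs_apply_le (L : ℝ) : IsCompact {D : Matrix κ ι ℝ | ∀ a i, |D a i| ≤ L} := by
  have h : IsCompact {D : κ → ι → ℝ | ∀ a i, |D a i| ≤ L} := by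
    have : {D : κ → ι → ℝ | ∀ a i, |D a i| ≤ L} =
        Set.pi Set.univ fun _ : κ => Set.pi Set.univ fun _ : ι => Set.Icc (-L) L := by
      ext D
      simp only [Set.mem_univ_pi, Set.mem_Icc, ← abs_le, Set.mem_ofPred_eq]
    rw [this]
    exact isCompact_univ_pi fun _ => isCompact_univ_pi fun _ => isCompact_Icc
  exact h

lemma exists_abs_comp_jacobian_le (hF : LipschitzWith K F) {f : Matrix κ ι ℝ → ℝ}
    (hf : Continuous f) : ∃ M, ∀ x, |f (jacobian F x)| ≤ M := by
  obtain ⟨M, hM⟩ := (isCompact_setOf_abs_apply_le (κ := κ) (ι := ι) K).exists_bound_of_continuousOn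
    hf.continuousOn
  exact ⟨M, fun x => hM _ fun a i => abs_jacobian_le hF x a i⟩

lemma continuous_graphMetric : Continuous (graphMetric : Matrix κ ι ℝ → Matrix ι ι ℝ) := by
  unfold graphMetric
  fun_prop

lemma continuous_graphFrame : Continuous (graphFrame : Matrix κ ι ℝ → Matrix (ι ⊕ κ) ι ℝ) := by
  refine continuous_matrix fun a i => ?_
  rcases a with a | a
  · exact continuous_const
  · exact continuous_id.matrix_elem a i

lemma continuous_graphMetric_inv :
    Continuous fun D : Matrix κ ι ℝ => (graphMetric D)⁻¹ := by
  simp only [Matrix.inv_def, Ring.inverse_eq_inv']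
  exact (continuous_graphMetric.matrix_det.inv₀ fun D => (graphMetric_det_pos D).ne').smul
    continuous_graphMetric.matrix_adjugate

lemma continuous_graphDensity : Continuous (graphDensity : Matrix κ ι ℝ → ℝ) :=
  continuous_graphMetric.matrix_det.sqrt

lemma continuous_graphProj :
    Continuous (graphProj : Matrix κ ι ℝ → Matrix (ι ⊕ κ) (ι ⊕ κ) ℝ) :=
  (continuous_graphFrame.matrix_mul continuous_graphMetric_inv).matrix_mul
    continuous_graphFrame.matrix_transpose

/-- The graph of `F` over the unit ball is stationary for the area, in the weak form of the
minimal surface system. -/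
def IsStationaryGraph (F : EuclideanSpace ℝ ι → EuclideanSpace ℝ κ) : Prop :=
  ∀ φ : EuclideanSpace ℝ ι → ℝ, ContDiff ℝ (⊤ : ℕ∞) φ → HasCompactSupport φ →
    tsupport φ ⊆ ball 0 1 → ∀ a : ι ⊕ κ,
      ∫ x in ball 0 1, ∑ i, (graphDensity (jacobian F x) *
        (graphFrame (jacobian F x) * (graphMetric (jacobian F x))⁻¹) a i) *
          fderiv ℝ φ x (EuclideanSpace.single i 1) = 0

lemma IsStationaryGraph.integral_trace_eq_zero [Nonempty ι] (hS : IsStationaryGraph F)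
    (hF : LipschitzWith K F) {ψ : EuclideanSpace ℝ ι → ι ⊕ κ → ℝ} {C : ℝ≥0}
    (hψ : LipschitzOnWith C ψ (closedBall 0 1)) (h0 : ∀ x ∈ sphere 0 1, ψ x = 0)
    {B : EuclideanSpace ℝ ι → Matrix (ι ⊕ κ) ι ℝ}
    (hB : ∀ x ∈ ball 0 1, DifferentiableAt ℝ F x → ∀ a i,
      fderiv ℝ (fun y => ψ y a) x (EuclideanSpace.single i 1) = B x a i) :
    IntegrableOn (fun x => graphDensity (jacobian F x) *
      ((graphMetric (jacobian F x))⁻¹ * (graphFrame (jacobian F x))ᵀ * B x).trace) (ball 0 1) ∧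
    ∫ x in ball 0 1, graphDensity (jacobian F x) *
      ((graphMetric (jacobian F x))⁻¹ * (graphFrame (jacobian F x))ᵀ * B x).trace = 0 := by
  set b : ι ⊕ κ → ι → EuclideanSpace ℝ ι → ℝ := fun a i x => graphDensity (jacobian F x) *
    (graphFrame (jacobian F x) * (graphMetric (jacobian F x))⁻¹) a i with hb
  have hbc : ∀ a i, Continuous fun D : Matrix κ ι ℝ => graphDensity D *
      (graphFrame D * (graphMetric D)⁻¹) a i := fun a i =>
    continuous_graphDensity.mul
      ((continuous_graphFrame.matrix_mul continuous_graphMetric_inv).matrix_elem a i)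
  have hbm : ∀ a i, Measurable (b a i) := fun a i => measurable_comp_jacobian F (hbc a i)
  choose M hM using fun a i => exists_abs_comp_jacobian_le hF (hbc a i)
  have hcomp : ∀ a, LipschitzOnWith C (fun x => ψ x a) (closedBall 0 1) := fun a => by
    have := (LipschitzWith.eval (α := fun _ : ι ⊕ κ => ℝ) a).comp_lipschitzOnWith hψ
    rwa [one_mul] at this
  choose χ hχ hχe using fun a => (hcomp a).extend_real
  have hz : ∀ a, ∫ x in ball 0 1, ∑ i, b a i x *
      fderiv ℝ (χ a) x (EuclideanSpace.single i 1) = 0 := fun a => by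
    refine integral_eq_zero_of_lipschitz_of_eqOn_sphere (M := ∑ i, |M a i|) (b a)
      (fun i => EuclideanSpace.single i 1) (hbm a) (fun i x => ?_)
      (fun φ h1 h2 h3 => hS φ h1 h2 h3 a) (hχ a) fun x hx => ?_
    · exact (hM a i x).trans ((le_abs_self _).trans
        (Finset.single_le_sum (f := fun i => |M a i|) (fun _ _ => abs_nonneg _)
          (Finset.mem_univ i)))
    · rw [← hχe a (sphere_subset_closedBall hx)]
      exact congrFun (h0 x hx) a
  have hi : ∀ a, IntegrableOn (fun x => ∑ i, b a i x *
      fderiv ℝ (χ a) x (EuclideanSpace.single i 1)) (ball 0 1) := fun a => by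
    refine Measure.integrableOn_of_bounded (M := ∑ i, M a i * C) measure_ball_lt_top.ne ?_ ?_
    · refine (Finset.measurable_sum _ fun i _ => (hbm a i).mul ?_).aestronglyMeasurable
      exact measurable_fderiv_apply_const ℝ (χ a) _
    · refine Filter.Eventually.of_forall fun x => (norm_sum_le _ _).trans
        (Finset.sum_le_sum fun i _ => ?_)
      rw [norm_mul]
      refine mul_le_mul (hM a i x) ?_ (norm_nonneg _) ((abs_nonneg _).trans (hM a i x))
      refine (ContinuousLinearMap.le_opNorm _ _).trans ?_
      simpa using norm_fderiv_le_of_lipschitz ℝ (hχ a)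
  have hsum := integral_finsetSum (μ := volume.restrict (ball (0 : EuclideanSpace ℝ ι) 1))
    Finset.univ (fun a _ => hi a)
  simp only [hz, Finset.sum_const_zero] at hsum
  suffices hae : (fun x => ∑ a, ∑ i, b a i x * fderiv ℝ (χ a) x (EuclideanSpace.single i 1))
      =ᵐ[volume.restrict (ball 0 1)] fun x => graphDensity (jacobian F x) *
        ((graphMetric (jacobian F x))⁻¹ * (graphFrame (jacobian F x))ᵀ * B x).trace from
    ⟨(integrable_finsetSum _ fun a _ => hi a).congr hae, (integral_congr_ae hae).symm.trans hsum⟩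
  refine (ae_restrict_iff' measurableSet_ball).2 ?_
  filter_upwards [hF.ae_differentiableAt] with x hx hxb
  symm
  have hfd : ∀ a, fderiv ℝ (χ a) x = fderiv ℝ (fun y => ψ y a) x := fun a => by
    refine Filter.EventuallyEq.fderiv_eq ?_
    filter_upwards [isOpen_ball.mem_nhds hxb] with y hy
    exact (hχe a (ball_subset_closedBall hy)).symm
  simp only [hfd, hB x hxb hx]
  rw [trace_mul_comm, Matrix.trace, Finset.mul_sum]
  refine Finset.sum_congr rfl fun a _ => ?_
  rw [diag_apply, Matrix.mul_apply, Finset.mul_sum]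
  refine Finset.sum_congr rfl fun i _ => ?_
  rw [hb, ← graphMetric_inv_transpose, ← transpose_mul, transpose_apply]
  ring

lemma exists_lipschitzOnWith_comp_graph {G : Type*} [NormedAddCommGroup G] [NormedSpace ℝ G]
    {Φ : EuclideanSpace ℝ ι × EuclideanSpace ℝ κ → G} (hΦ : ContDiff ℝ 1 Φ)
    (hF : LipschitzWith K F) :
    ∃ C, LipschitzOnWith C (fun x => Φ (x, F x)) (closedBall 0 1) := by
  obtain ⟨C, hC⟩ := (hΦ.contDiffOn (s := closedBall (0 : EuclideanSpace ℝ ι) 1 ×ˢ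
    closedBall (F 0) K)).exists_lipschitzOnWith one_ne_zero
    ((convex_closedBall _ _).prod (convex_closedBall _ _))
    ((isCompact_closedBall _ _).prod (isCompact_closedBall _ _))
  refine ⟨_, hC.comp (f := fun x => (x, F x)) (LipschitzWith.id.prodMk hF).lipschitzOnWith ?_⟩
  intro x hx
  refine ⟨hx, ?_⟩
  rw [mem_closedBall] at hx ⊢
  exact (hF.dist_le_mul x 0).trans (mul_le_of_le_one_right K.2 hx)

end Jacobian

section LocalArea

open Matrix Metric Filter Topology

open scoped NNReal MatrixOrder

variable {ι κ : Type*} [Fintype ι] [DecidableEq ι] [Fintype κ] [DecidableEq κ]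
  {F : EuclideanSpace ℝ ι → EuclideanSpace ℝ κ} {K : ℝ≥0}

/-- The ellipsoid on which the tangent plane to a graph has height at most `ε` has the volume
of a ball of radius `ε`, divided by the area density. -/
lemma exists_ellipsoid (D : Matrix κ ι ℝ) (x : EuclideanSpace ℝ ι) {ε : ℝ} (hε : 0 ≤ ε) :
    ∃ E : Set (EuclideanSpace ℝ ι), MeasurableSet E ∧
      (∀ y ∈ E, ‖y - x‖ ^ 2 + ‖Matrix.toEuclideanLin D (y - x)‖ ^ 2 ≤ ε ^ 2) ∧
      graphDensity D * volume.real E =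
        ε ^ Fintype.card ι * volume.real (closedBall (0 : EuclideanSpace ℝ ι) 1) := by
  obtain ⟨S, hS⟩ := CStarAlgebra.nonneg_iff_eq_star_mul_self.mp
    (graphMetric_posDef D).posSemidef.nonneg
  set f := Matrix.toEuclideanLin S with hf
  have hfn : ∀ v : EuclideanSpace ℝ ι,
      ‖f v‖ ^ 2 = ‖v‖ ^ 2 + ‖Matrix.toEuclideanLin D v‖ ^ 2 := fun v => by
    have h1 : ∀ w : ι → ℝ, ∑ i, w i ^ 2 = w ⬝ᵥ w := fun w => by simp [dotProduct, sq]
    have h2 : ∀ w : κ → ℝ, ∑ i, w i ^ 2 = w ⬝ᵥ w := fun w => by simp [dotProduct, sq]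
    rw [EuclideanSpace.real_norm_sq_eq, EuclideanSpace.real_norm_sq_eq,
      EuclideanSpace.real_norm_sq_eq, h1, h1, h2]
    have h3 : (f v).ofLp = S *ᵥ v.ofLp := rfl
    have h4 : (Matrix.toEuclideanLin D v).ofLp = D *ᵥ v.ofLp := rfl
    have h5 : (S *ᵥ v.ofLp) ⬝ᵥ (S *ᵥ v.ofLp) = v.ofLp ⬝ᵥ (Sᵀ * S) *ᵥ v.ofLp := by
      rw [← mulVec_mulVec, dotProduct_mulVec v.ofLp, vecMul_transpose]
    have h7 : (D *ᵥ v.ofLp) ⬝ᵥ (D *ᵥ v.ofLp) = v.ofLp ⬝ᵥ (Dᵀ * D) *ᵥ v.ofLp := by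
      rw [← mulVec_mulVec, dotProduct_mulVec v.ofLp, vecMul_transpose]
    rw [h3, h4, h5, h7, ← dotProduct_add]
    congr 1
    have h6 : Sᵀ * S = graphMetric D := by
      rw [hS, star_eq_conjTranspose, conjTranspose_eq_transpose_of_trivial]
    rw [h6, graphMetric, add_mulVec, one_mulVec]
  have hdet : LinearMap.det f = S.det := LinearMap.det_toLpLin 2 S
  have hdet2 : graphDensity D = |S.det| := by
    rw [graphDensity, hS, det_mul, star_eq_conjTranspose, conjTranspose_eq_transpose_of_trivial,
      det_transpose, Real.sqrt_mul_self_eq_abs]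
  have hne : LinearMap.det f ≠ 0 := by
    rw [hdet, ← abs_ne_zero, ← hdet2]
    exact (graphDensity_pos D).ne'
  refine ⟨(fun y => y - x) ⁻¹' (f ⁻¹' closedBall 0 ε), ?_, fun y hy => ?_, ?_⟩
  · exact ((isClosed_closedBall.preimage f.continuous_of_finiteDimensional).preimage
      (continuous_id.sub continuous_const)).measurableSet
  · rw [← hfn]
    have : ‖f (y - x)‖ ≤ ε := by simpa using hy
    gcongr
  · simp only [sub_eq_add_neg]
    rw [measureReal_def, measure_preimage_add_right, Measure.addHaar_preimage_linearMap _ hne,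
      ENNReal.toReal_mul, ← measureReal_def, Measure.addHaar_real_closedBall' _ _ hε,
      ENNReal.toReal_ofReal (abs_nonneg _), hdet, abs_inv, ← hdet2, finrank_euclideanSpace,
      mul_inv_cancel_left₀ (graphDensity_pos D).ne']

/-- Almost everywhere, the area of the graph in a small ambient ball is at least a fixed fraction
of the area of a flat disc. -/
lemma ae_eventually_exists_le_integral_graphDensity [Nonempty ι] (hF : LipschitzWith K F) :
    ∀ᵐ x, ∀ᶠ ε in 𝓝[>] (0 : ℝ), ∃ E ⊆ closedBall x ε, MeasurableSet E ∧
      (∀ y ∈ E, ‖y - x‖ ^ 2 + ‖F y - F x‖ ^ 2 ≤ 4 * ε ^ 2) ∧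
      ε ^ Fintype.card ι * volume.real (closedBall (0 : EuclideanSpace ℝ ι) 1) / 2 ≤
        ∫ y in E, graphDensity (jacobian F y) := by
  have hm : Measurable fun x => graphDensity (jacobian F x) :=
    measurable_comp_jacobian F continuous_graphDensity
  obtain ⟨M, hM⟩ := exists_abs_comp_jacobian_le hF continuous_graphDensity
  have hio : ∀ s : Set (EuclideanSpace ℝ ι), volume s ≠ ⊤ →
      IntegrableOn (fun x => graphDensity (jacobian F x)) s := fun s hs =>
    Measure.integrableOn_of_bounded (M := M) hs hm.aestronglyMeasurable
      (Eventually.of_forall hM)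
  have hloc : LocallyIntegrable (fun x => graphDensity (jacobian F x))
      (volume : Measure (EuclideanSpace ℝ ι)) := fun x =>
    ⟨closedBall x 1, closedBall_mem_nhds x one_pos, hio _ measure_closedBall_lt_top.ne⟩
  filter_upwards [hF.ae_differentiableAt,
    IsUnifLocDoublingMeasure.ae_tendsto_average_norm_sub (μ := volume) hloc 1] with x hx hav
  have hav' := hav (fun _ : ℝ => x) id tendsto_id (by
    filter_upwards [self_mem_nhdsWithin] with ε hε
    have hε' : (0 : ℝ) < ε := hε
    simpa using hε'.le)
  have hd := (hasFDerivAt_iff_isLittleO.1 hx.hasFDerivAt).bound (show (0 : ℝ) < 1 / 4 by norm_num)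
  obtain ⟨r, hr, hrd⟩ := Metric.eventually_nhds_iff.1 hd
  filter_upwards [hav'.eventually_le_const (show (0 : ℝ) < 1 / 2 by norm_num),
    self_mem_nhdsWithin, nhdsWithin_le_nhds (Iio_mem_nhds hr)] with ε hε1 hε2 hε3
  have hε : 0 < ε := hε2
  have hεr : ε < r := hε3
  obtain ⟨E, hEm, hE, hEv⟩ := exists_ellipsoid (jacobian F x) x hε.le
  have hsub : E ⊆ closedBall x ε := fun y hy => by
    rw [mem_closedBall, dist_eq_norm]
    refine abs_le_of_sq_le_sq' ?_ hε.le |>.2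
    exact (le_add_of_nonneg_right (sq_nonneg _)).trans (hE y hy)
  refine ⟨E, hsub, hEm, fun y hy => ?_, ?_⟩
  · have h1 := hE y hy
    have h2 : ‖y - x‖ ≤ ε := by simpa [dist_eq_norm] using hsub hy
    have h3 : ‖F y - F x - fderiv ℝ F x (y - x)‖ ≤ 1 / 4 * ‖y - x‖ :=
      hrd (by rw [dist_eq_norm]; exact h2.trans_lt hεr)
    have h4 : fderiv ℝ F x (y - x) = Matrix.toEuclideanLin (jacobian F x) (y - x) := by
      ext a
      rw [fderiv_apply_eq_jacobian_mulVec]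
      rfl
    rw [h4] at h3
    have h5 : ‖F y - F x‖ ≤ 1 / 4 * ε + ‖Matrix.toEuclideanLin (jacobian F x) (y - x)‖ := by
      have := norm_add_le (F y - F x - Matrix.toEuclideanLin (jacobian F x) (y - x))
        (Matrix.toEuclideanLin (jacobian F x) (y - x))
      rw [sub_add_cancel] at this
      linarith
    have h6 : ‖Matrix.toEuclideanLin (jacobian F x) (y - x)‖ ≤ ε := by
      refine abs_le_of_sq_le_sq' ?_ hε.le |>.2
      exact (le_add_of_nonneg_left (sq_nonneg _)).trans h1
    nlinarith [norm_nonneg (F y - F x), norm_nonneg (y - x),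
      norm_nonneg (Matrix.toEuclideanLin (jacobian F x) (y - x))]
  · set ω := volume.real (closedBall (0 : EuclideanSpace ℝ ι) 1)
    have hvol : volume.real (closedBall x ε) = ε ^ Fintype.card ι * ω := by
      rw [Measure.addHaar_real_closedBall' _ _ hε.le, finrank_euclideanSpace]
    have hω : 0 < ω := by
      refine ENNReal.toReal_pos (measure_closedBall_pos _ _ one_pos).ne'
        measure_closedBall_lt_top.ne
    have hfin : volume (closedBall x ε) ≠ ⊤ := measure_closedBall_lt_top.ne
    have hEfin : volume E ≠ ⊤ := ((measure_mono hsub).trans_lt measure_closedBall_lt_top).ne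
    simp only [id] at hε1
    rw [setAverage_eq, smul_eq_mul, hvol] at hε1
    have hint : IntegrableOn
        (fun y => ‖graphDensity (jacobian F y) - graphDensity (jacobian F x)‖)
        (closedBall x ε) := by
      exact ((hio _ hfin).sub (integrableOn_const hfin)).norm
    have h1 : ∫ y in E, ‖graphDensity (jacobian F y) - graphDensity (jacobian F x)‖ ≤
        ε ^ Fintype.card ι * ω / 2 := by
      refine (setIntegral_mono_set hint (Eventually.of_forall fun y => norm_nonneg _)
        hsub.eventuallyLE).trans ?_
      have hp : 0 < ε ^ Fintype.card ι * ω := by positivity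
      have := mul_le_mul_of_nonneg_left hε1 hp.le
      rw [mul_inv_cancel_left₀ hp.ne'] at this
      linarith
    have hcE : IntegrableOn (fun _ => graphDensity (jacobian F x)) E := integrableOn_const hEfin
    have h2 : ∫ y in E, (graphDensity (jacobian F x) -
        ‖graphDensity (jacobian F y) - graphDensity (jacobian F x)‖) ≤
        ∫ y in E, graphDensity (jacobian F y) := by
      refine integral_mono (hcE.sub (hint.mono_set hsub)) (hio _ hEfin)
        fun y => ?_
      have := neg_abs_le (graphDensity (jacobian F y) - graphDensity (jacobian F x))
      simp only [Real.norm_eq_abs]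
      linarith
    rw [integral_sub hcE (hint.mono_set hsub), setIntegral_const,
      smul_eq_mul, mul_comm, hEv] at h2
    linarith

end LocalArea

section RadialProfile

lemma exists_radial_cutoff : ∃ χ : ℝ → ℝ, ContDiff ℝ 1 χ ∧ (∀ t, 0 ≤ χ t) ∧
    (∀ t ≤ 1 / 4, χ t = 1) ∧ (∀ t ≥ 1, χ t = 0) ∧ (∀ t < 1 / 4, deriv χ t = 0) ∧
    ∃ C, 0 ≤ C ∧ ∀ t ≥ 0, |t * deriv χ t| ≤ C := by
  set χ : ℝ → ℝ := fun t => Real.smoothTransition (4 / 3 * (1 - t)) with hχ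
  have hs : ContDiff ℝ 1 χ :=
    Real.smoothTransition.contDiff.comp (contDiff_const.mul (contDiff_const.sub contDiff_id))
  have h1 : ∀ t ≤ 1 / 4, χ t = 1 := fun t ht =>
    Real.smoothTransition.one_of_one_le (by linarith)
  have h0 : ∀ t ≥ 1, χ t = 0 := fun t ht =>
    Real.smoothTransition.zero_of_nonpos (by linarith)
  have hd1 : ∀ t < 1 / 4, deriv χ t = 0 := fun t ht => by
    have : χ =ᶠ[nhds t] fun _ => 1 := by
      filter_upwards [Iio_mem_nhds ht] with s hs using h1 s (le_of_lt hs)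
    rw [this.deriv_eq, deriv_const]
  have hd0 : ∀ t > 1, deriv χ t = 0 := fun t ht => by
    have : χ =ᶠ[nhds t] fun _ => 0 := by
      filter_upwards [Ioi_mem_nhds ht] with s hs using h0 s (le_of_lt hs)
    rw [this.deriv_eq, deriv_const]
  obtain ⟨C, hC⟩ := (isCompact_Icc (a := (0 : ℝ)) (b := 1)).exists_bound_of_continuousOn
    (continuous_id.mul (hs.continuous_deriv le_rfl)).continuousOn
  have hC0 : 0 ≤ C := (norm_nonneg _).trans (hC 0 (by simp))
  refine ⟨χ, hs, fun t => Real.smoothTransition.nonneg _, h1, h0, hd1, C, hC0, fun t ht => ?_⟩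
  rcases le_or_gt t 1 with h | h
  · exact hC t ⟨ht, h⟩
  · simpa [hd0 t h] using hC0

/-- The radial weights used in the monotonicity formula. -/
lemma exists_radial_profile (N : ℕ) : ∃ C > (0 : ℝ), ∀ h > (0 : ℝ), ∀ ε > (0 : ℝ),
    ∃ f w : ℝ → ℝ, (∀ s ≥ 0, ContDiffAt ℝ 1 f s) ∧ (∀ s ≥ h ^ 2, f s = 0) ∧ (∀ s ≥ 0, 0 ≤ w s) ∧
      (16 * ε ^ 2 ≤ h ^ 2 → ∀ s ≥ 0, s ≤ 4 * ε ^ 2 → N ≤ C * ε ^ N * w s) ∧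
      ∀ s ≥ 0, ∀ τ ≥ 0, τ ≤ s → w s - C / h ^ N ≤ N * f s + 2 * deriv f s * τ := by
  obtain ⟨χ, hχ, hχ0, hχ1, hχz, hχd, B, hB0, hB⟩ := exists_radial_cutoff
  refine ⟨2 * B * 2 ^ N + 3 ^ (N + 2), by positivity, fun h hh ε hε => ?_⟩
  set ρ : ℝ → ℝ := fun s => √(s + ε ^ 2) with hρ
  have hρ0 : ∀ s ≥ 0, 0 < ρ s := fun s hs => Real.sqrt_pos.2 (by positivity)
  have hρ2 : ∀ s ≥ 0, ρ s ^ 2 = s + ε ^ 2 := fun s hs => Real.sq_sqrt (by positivity)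
  refine ⟨fun s => (ρ s)⁻¹ ^ N * χ (s / h ^ 2),
    fun s => N * ε ^ 2 * (ρ s)⁻¹ ^ (N + 2) * χ (s / h ^ 2), fun s hs => ?_, fun s hs => ?_,
    fun s hs => ?_, fun hεh s hs hsε => ?_, fun s hs τ hτ hτs => ?_⟩
  · refine ContDiffAt.mul (ContDiffAt.pow (ContDiffAt.inv ?_ (hρ0 s hs).ne') N) ?_
    · exact ContDiffAt.sqrt (contDiffAt_id.add contDiffAt_const) (by simp; positivity)
    · exact hχ.contDiffAt.comp s (contDiffAt_id.div_const _)
  · simp only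
    rw [hχz _ ((one_le_div (by positivity)).2 hs), mul_zero]
  · have := hρ0 s hs
    have := hχ0 (s / h ^ 2)
    positivity
  · simp only
    have h1 : χ (s / h ^ 2) = 1 := hχ1 _ (by
      rw [div_le_div_iff₀ (by positivity) (by norm_num)]; linarith)
    have h2 : ρ s ≤ 3 * ε := Real.sqrt_le_iff.2 ⟨by positivity, by nlinarith⟩
    have h3 : (3 * ε)⁻¹ ^ (N + 2) ≤ (ρ s)⁻¹ ^ (N + 2) := by
      have := hρ0 s hs
      gcongr
    have h4 : (1 : ℝ) = 3 ^ (N + 2) * ε ^ N * (ε ^ 2 * (3 * ε)⁻¹ ^ (N + 2)) := by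
      rw [inv_pow, mul_pow, pow_add ε]
      field_simp
    rw [h1]
    calc (N : ℝ) = N * (3 ^ (N + 2) * ε ^ N * (ε ^ 2 * (3 * ε)⁻¹ ^ (N + 2))) := by
          rw [← h4, mul_one]
      _ ≤ N * ((2 * B * 2 ^ N + 3 ^ (N + 2)) * ε ^ N * (ε ^ 2 * (ρ s)⁻¹ ^ (N + 2))) := by
        have : (3 : ℝ) ^ (N + 2) ≤ 2 * B * 2 ^ N + 3 ^ (N + 2) :=
          le_add_of_nonneg_left (by positivity)
        gcongr
      _ = _ := by ring
  · have hr := hρ0 s hs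
    have hρd : HasDerivAt ρ (1 / (2 * ρ s)) s := by
      have := ((hasDerivAt_id s).add_const (ε ^ 2)).sqrt (by simp; positivity)
      simpa using this
    have hd : HasDerivAt (fun s => (ρ s)⁻¹ ^ N * χ (s / h ^ 2))
        (-(N / 2) * (ρ s)⁻¹ ^ (N + 2) * χ (s / h ^ 2) +
          (ρ s)⁻¹ ^ N * (deriv χ (s / h ^ 2) / h ^ 2)) s := by
      have h1 := (hρd.fun_inv hr.ne').fun_pow N
      have h2 : HasDerivAt (fun s => χ (s / h ^ 2)) (deriv χ (s / h ^ 2) / h ^ 2) s := by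
        have := ((hχ.differentiable one_ne_zero) (s / h ^ 2)).hasDerivAt.comp s
          ((hasDerivAt_id s).div_const (h ^ 2))
        simpa [Function.comp_def, div_eq_mul_inv] using this
      refine (h1.fun_mul h2).congr_deriv ?_
      rcases N with _ | N
      · simp
      · have h3 : -(1 / (2 * ρ s)) / ρ s ^ 2 = -(1 / 2) * (ρ s)⁻¹ ^ 3 := by field_simp
        rw [h3]
        push_cast
        ring
    rw [hd.deriv]
    have hw : (ρ s)⁻¹ ^ N = (ρ s)⁻¹ ^ (N + 2) * (s + ε ^ 2) := by
      rw [← hρ2 s hs, pow_add]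
      field_simp
    have hE : |2 * ((ρ s)⁻¹ ^ N * (deriv χ (s / h ^ 2) / h ^ 2)) * τ| ≤
        (2 * B * 2 ^ N) / h ^ N := by
      rcases lt_or_ge (s / h ^ 2) (1 / 4) with hlt | hge
      · rw [hχd _ hlt]
        simp
        positivity
      · have hs4 : h / 2 ≤ ρ s := by
          refine Real.le_sqrt_of_sq_le ?_
          rw [div_le_div_iff₀ (by norm_num) (by positivity)] at hge
          nlinarith [sq_nonneg ε]
        have h1 : (ρ s)⁻¹ ^ N ≤ (h / 2)⁻¹ ^ N := by gcongr
        have h2 := hB (s / h ^ 2) (by positivity)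
        have h3 : |2 * ((ρ s)⁻¹ ^ N * (deriv χ (s / h ^ 2) / h ^ 2)) * τ| ≤
            2 * (ρ s)⁻¹ ^ N * |s / h ^ 2 * deriv χ (s / h ^ 2)| := by
          have : 2 * ((ρ s)⁻¹ ^ N * (deriv χ (s / h ^ 2) / h ^ 2)) * τ =
            2 * (ρ s)⁻¹ ^ N * (τ / h ^ 2 * deriv χ (s / h ^ 2)) := by ring
          rw [this, abs_mul, abs_mul (τ / h ^ 2), abs_mul (s / h ^ 2), abs_of_nonneg
            (show 0 ≤ 2 * (ρ s)⁻¹ ^ N by positivity), abs_of_nonneg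
            (show 0 ≤ τ / h ^ 2 by positivity), abs_of_nonneg (show 0 ≤ s / h ^ 2 by positivity)]
          gcongr
        refine h3.trans ?_
        calc 2 * (ρ s)⁻¹ ^ N * |s / h ^ 2 * deriv χ (s / h ^ 2)| ≤ 2 * (h / 2)⁻¹ ^ N * B := by
              gcongr
          _ = _ := by rw [inv_div, div_pow]; ring
    have hX : 0 ≤ N * (ρ s)⁻¹ ^ (N + 2) * χ (s / h ^ 2) := by
      have := hχ0 (s / h ^ 2)
      positivity
    have hC : (2 * B * 2 ^ N + 3 ^ (N + 2)) / h ^ N ≥ 2 * B * 2 ^ N / h ^ N := by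
      gcongr
      exact le_add_of_nonneg_right (by positivity)
    beta_reduce
    rw [hw]
    rw [hw] at hE
    have := neg_le_of_abs_le hE
    nlinarith [mul_nonneg hX (sub_nonneg.2 hτs)]

end RadialProfile

section Monotonicity

open Matrix Metric Filter Topology

open scoped NNReal

variable {ι κ : Type*} [Fintype ι] [DecidableEq ι] [Fintype κ] [DecidableEq κ]
  {F : EuclideanSpace ℝ ι → EuclideanSpace ℝ κ} {K : ℝ≥0}

/-- The pair `(x, y)` as a vector of `ℝ^(ι ⊕ κ)`. -/
def pairVec (x : EuclideanSpace ℝ ι) (y : EuclideanSpace ℝ κ) : ι ⊕ κ → ℝ := Sum.elim x y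

lemma pairVec_dotProduct_self (x : EuclideanSpace ℝ ι) (y : EuclideanSpace ℝ κ) :
    pairVec x y ⬝ᵥ pairVec x y = ‖x‖ ^ 2 + ‖y‖ ^ 2 := by
  rw [EuclideanSpace.real_norm_sq_eq, EuclideanSpace.real_norm_sq_eq]
  simp [pairVec, dotProduct, sq]

lemma contDiff_pairVec (k : WithTop ℕ∞) : ContDiff ℝ k
    fun p : EuclideanSpace ℝ ι × EuclideanSpace ℝ κ => pairVec p.1 p.2 := by
  refine contDiff_pi.2 fun a => ?_
  rcases a with a | a
  · exact (EuclideanSpace.proj (𝕜 := ℝ) a).contDiff.comp contDiff_fst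
  · exact (EuclideanSpace.proj (𝕜 := ℝ) a).contDiff.comp contDiff_snd

lemma differentiableAt_pairVec {x : EuclideanSpace ℝ ι} (hx : DifferentiableAt ℝ F x) (a : ι ⊕ κ) :
    DifferentiableAt ℝ (fun y => pairVec y (F y) a) x := by
  rcases a with a | a
  · exact (EuclideanSpace.proj a : EuclideanSpace ℝ ι →L[ℝ] ℝ).differentiableAt
  · exact (EuclideanSpace.proj a : EuclideanSpace ℝ κ →L[ℝ] ℝ).differentiableAt.comp x hx

lemma fderiv_pairVec_apply {x : EuclideanSpace ℝ ι} (hx : DifferentiableAt ℝ F x) (a : ι ⊕ κ)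
    (i : ι) : fderiv ℝ (fun y => pairVec y (F y) a) x (EuclideanSpace.single i 1) =
      graphFrame (jacobian F x) a i := by
  rcases a with a | a
  · have : fderiv ℝ (fun y : EuclideanSpace ℝ ι => pairVec y (F y) (Sum.inl a)) x =
        (EuclideanSpace.proj a : EuclideanSpace ℝ ι →L[ℝ] ℝ) :=
      (EuclideanSpace.proj a : EuclideanSpace ℝ ι →L[ℝ] ℝ).hasFDerivAt.fderiv
    rw [this]
    simp [graphFrame, Matrix.one_apply]
  · have : fderiv ℝ (fun y : EuclideanSpace ℝ ι => pairVec y (F y) (Sum.inr a)) x =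
        (EuclideanSpace.proj a : EuclideanSpace ℝ κ →L[ℝ] ℝ).comp (fderiv ℝ F x) :=
      ((EuclideanSpace.proj a : EuclideanSpace ℝ κ →L[ℝ] ℝ).hasFDerivAt.comp x
        hx.hasFDerivAt).fderiv
    rw [this]
    simp [graphFrame, jacobian_apply]

lemma integrableOn_graphDensity (hF : LipschitzWith K F) {s : Set (EuclideanSpace ℝ ι)}
    (hs : volume s ≠ ⊤) : IntegrableOn (fun x => graphDensity (jacobian F x)) s := by
  obtain ⟨M, hM⟩ := exists_abs_comp_jacobian_le hF continuous_graphDensity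
  exact Measure.integrableOn_of_bounded (M := M) hs
    (measurable_comp_jacobian F continuous_graphDensity).aestronglyMeasurable
    (Eventually.of_forall hM)

lemma trace_radial (D : Matrix κ ι ℝ) (v : ι ⊕ κ → ℝ) (s t : ℝ) :
    ((graphMetric D)⁻¹ * (graphFrame D)ᵀ *
      (s • graphFrame D + t • vecMulVec v (v ᵥ* graphFrame D))).trace =
      Fintype.card ι * s + t * (v ⬝ᵥ graphProj D *ᵥ v) := by
  have h1 : ((graphMetric D)⁻¹ * (graphFrame D)ᵀ * graphFrame D).trace = Fintype.card ι := by
    rw [Matrix.mul_assoc, graphFrame_transpose_mul_self,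
      nonsing_inv_mul _ (graphMetric_isUnit_det D), trace_one]
  have h2 : ((graphMetric D)⁻¹ * (graphFrame D)ᵀ * vecMulVec v (v ᵥ* graphFrame D)).trace =
      v ⬝ᵥ graphProj D *ᵥ v := by
    rw [mul_vecMulVec, trace_vecMulVec, dotProduct_comm, ← dotProduct_mulVec, mulVec_mulVec,
      graphProj, Matrix.mul_assoc]
  rw [Matrix.mul_add, Matrix.mul_smul, Matrix.mul_smul, trace_add, trace_smul, trace_smul, h1, h2,
    smul_eq_mul, smul_eq_mul, mul_comm s]

/-- The area of a stationary graph over the unit ball which goes through height zero and whose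
boundary has height `R` is at least a multiple of `(R - 1) ^ dim`. -/
theorem exists_mul_pow_le_integral_graphDensity [Nonempty ι] : ∃ c > (0 : ℝ),
    ∀ (F : EuclideanSpace ℝ ι → EuclideanSpace ℝ κ) (K : ℝ≥0), IsStationaryGraph F →
      LipschitzWith K F → ∀ R ≥ (2 : ℝ), (∀ x ∈ sphere 0 1, ‖F x‖ = R) →
      ∀ x₀ ∈ ball 0 1, F x₀ = 0 →
        c * (R - 1) ^ Fintype.card ι ≤ ∫ x in ball 0 1, graphDensity (jacobian F x) := by
  obtain ⟨C, hC, hprof⟩ := exists_radial_profile (Fintype.card ι)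
  set N := Fintype.card ι with hN
  set ω := volume.real (closedBall (0 : EuclideanSpace ℝ ι) 1)
  have hω : 0 < ω := ENNReal.toReal_pos (measure_closedBall_pos _ _ one_pos).ne'
    measure_closedBall_lt_top.ne
  have hN1 : (1 : ℝ) ≤ N := by exact_mod_cast Fintype.card_pos
  refine ⟨ω / (2 * C ^ 2), by positivity, fun F K hS hF R hR hb x₀ hx₀ hF0 => ?_⟩
  set h := R - 1 with hh
  have hh1 : 1 ≤ h := by linarith
  obtain ⟨x₁, hx₁, hx₁b, hx₁F⟩ : ∃ x₁, (∀ᶠ ε in 𝓝[>] (0 : ℝ), ∃ E ⊆ closedBall x₁ ε,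
      MeasurableSet E ∧ (∀ y ∈ E, ‖y - x₁‖ ^ 2 + ‖F y - F x₁‖ ^ 2 ≤ 4 * ε ^ 2) ∧
      ε ^ N * ω / 2 ≤ ∫ y in E, graphDensity (jacobian F y)) ∧ x₁ ∈ ball 0 1 ∧ ‖F x₁‖ < 1 := by
    obtain ⟨x₁, h1, h2⟩ := (Measure.dense_of_ae
      (ae_eventually_exists_le_integral_graphDensity hF)).exists_mem_open
      (isOpen_ball.inter (isOpen_lt hF.continuous.norm continuous_const :
        IsOpen {x | ‖F x‖ < 1})) ⟨x₀, hx₀, by simp [hF0]⟩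
    exact ⟨x₁, h1, h2⟩
  obtain ⟨r, hr, hrb⟩ := Metric.isOpen_iff.1 isOpen_ball x₁ hx₁b
  obtain ⟨ε, ⟨E, hEε, hEm, hE, hEv⟩, hε0, hεr⟩ := (hx₁.and (Ioo_mem_nhdsGT
    (show (0 : ℝ) < min r (1 / 4) by positivity))).exists
  have hεr1 : ε < r := hεr.trans_le (min_le_left _ _)
  have hε4 : ε < 1 / 4 := hεr.trans_le (min_le_right _ _)
  have hEb : E ⊆ ball 0 1 := hEε.trans ((closedBall_subset_ball hεr1).trans hrb)
  obtain ⟨f, w, hfc, hf0, hw0, hwE, hfw⟩ := hprof h (by linarith) ε hε0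
  set v : EuclideanSpace ℝ ι → ι ⊕ κ → ℝ := fun x => pairVec x (F x) - pairVec x₁ (F x₁) with hv
  have hvp : ∀ x, v x = pairVec (x - x₁) (F x - F x₁) := fun x => by
    ext a
    rcases a with a | a <;> simp [hv, pairVec]
  set q : EuclideanSpace ℝ ι → ℝ := fun x => v x ⬝ᵥ v x with hq
  have hqn : ∀ x, q x = ‖x - x₁‖ ^ 2 + ‖F x - F x₁‖ ^ 2 := fun x => by
    rw [hq]
    simp only [hvp, pairVec_dotProduct_self]
  have hq0 : ∀ x, 0 ≤ q x := fun x => by rw [hqn]; positivity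
  have hΦ : ContDiff ℝ 1 fun p : EuclideanSpace ℝ ι × EuclideanSpace ℝ κ =>
      f ((pairVec p.1 p.2 - pairVec x₁ (F x₁)) ⬝ᵥ (pairVec p.1 p.2 - pairVec x₁ (F x₁))) •
        (pairVec p.1 p.2 - pairVec x₁ (F x₁)) := by
    have h1 : ContDiff ℝ 1 fun p : EuclideanSpace ℝ ι × EuclideanSpace ℝ κ =>
        pairVec p.1 p.2 - pairVec x₁ (F x₁) := (contDiff_pairVec 1).sub contDiff_const
    have h2 : ContDiff ℝ 1 fun p : EuclideanSpace ℝ ι × EuclideanSpace ℝ κ =>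
        (pairVec p.1 p.2 - pairVec x₁ (F x₁)) ⬝ᵥ (pairVec p.1 p.2 - pairVec x₁ (F x₁)) :=
      ContDiff.sum fun a _ => (contDiff_pi.1 h1 a).mul (contDiff_pi.1 h1 a)
    have h3 : ContDiff ℝ 1 fun p : EuclideanSpace ℝ ι × EuclideanSpace ℝ κ =>
        f ((pairVec p.1 p.2 - pairVec x₁ (F x₁)) ⬝ᵥ (pairVec p.1 p.2 - pairVec x₁ (F x₁))) :=
      contDiff_iff_contDiffAt.2 fun p =>
        (hfc _ (Finset.sum_nonneg fun _ _ => mul_self_nonneg _)).comp p h2.contDiffAt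
    exact h3.smul h1
  obtain ⟨C', hC'⟩ := exists_lipschitzOnWith_comp_graph hΦ hF
  obtain ⟨hI, hI0⟩ := hS.integral_trace_eq_zero hF (ψ := fun x => f (q x) • v x) hC' (fun x hx => by
      rw [hf0 _ ?_, zero_smul]
      rw [hqn]
      have h1 : h ≤ ‖F x - F x₁‖ := by
        have := norm_sub_norm_le (F x) (F x₁)
        rw [hb x hx] at this
        linarith
      nlinarith [sq_nonneg ‖x - x₁‖])
    (B := fun x => f (q x) • graphFrame (jacobian F x) +
      (2 * deriv f (q x)) • vecMulVec (v x) (v x ᵥ* graphFrame (jacobian F x)))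
    (fun x hx hd a i => by
      have h1 : ∀ b, HasFDerivAt (fun y => v y b)
          (fderiv ℝ (fun y => pairVec y (F y) b) x) x := fun b =>
        (differentiableAt_pairVec hd b).hasFDerivAt.sub_const _
      have h2 : HasFDerivAt q (∑ b, (v x b • fderiv ℝ (fun y => pairVec y (F y) b) x +
          v x b • fderiv ℝ (fun y => pairVec y (F y) b) x)) x :=
        HasFDerivAt.fun_sum fun b _ => (h1 b).mul (h1 b)
      have h3 := ((((hfc (q x) (hq0 x)).differentiableAt one_ne_zero).hasDerivAt.comp_hasFDerivAt x
        h2).mul (h1 a)).fderiv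
      have h4 : (fun y => (f (q y) • v y) a) = (f ∘ q) * fun y => v y a := rfl
      rw [h4, h3]
      simp only [Function.comp_apply, _root_.add_apply, _root_.smul_apply,
        _root_.sum_apply, fderiv_pairVec_apply hd, Matrix.add_apply, Matrix.smul_apply,
        smul_eq_mul, vecMulVec_apply, vecMul, dotProduct, Finset.sum_add_distrib]
      ring)
  simp only [trace_radial] at hI hI0
  have hvol := integrableOn_graphDensity hF (measure_ball_lt_top (x := (0 : EuclideanSpace ℝ ι))
    (r := 1)).ne
  set V := ∫ x in ball 0 1, graphDensity (jacobian F x) with hV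
  have hpt : ∀ x, graphDensity (jacobian F x) * w (q x) ≤ graphDensity (jacobian F x) *
      (N * f (q x) + 2 * deriv f (q x) * (v x ⬝ᵥ graphProj (jacobian F x) *ᵥ v x)) +
        graphDensity (jacobian F x) * (C / h ^ N) := fun x => by
    rw [← mul_add]
    refine mul_le_mul_of_nonneg_left ?_ (graphDensity_pos _).le
    have := hfw (q x) (hq0 x) _ (dotProduct_mulVec_nonneg_of_idempotent (graphProj_transpose _)
      (graphProj_mul_self (jacobian F x)) (v x)) (dotProduct_mulVec_le_of_idempotent
        (graphProj_transpose _) (graphProj_mul_self (jacobian F x)) (v x))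
    linarith
  have hnn : ∀ x, 0 ≤ graphDensity (jacobian F x) *
      (N * f (q x) + 2 * deriv f (q x) * (v x ⬝ᵥ graphProj (jacobian F x) *ᵥ v x)) +
        graphDensity (jacobian F x) * (C / h ^ N) := fun x =>
    (mul_nonneg (graphDensity_pos _).le (hw0 _ (hq0 x))).trans (hpt x)
  have hint : IntegrableOn (fun x => C * ε ^ N * (graphDensity (jacobian F x) *
      (N * f (q x) + 2 * deriv f (q x) * (v x ⬝ᵥ graphProj (jacobian F x) *ᵥ v x)) +
        graphDensity (jacobian F x) * (C / h ^ N))) (ball 0 1) :=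
    (hI.add (hvol.mul_const (C / h ^ N))).const_mul _
  have h1 : (∫ x in E, graphDensity (jacobian F x)) ≤ C * ε ^ N * (V * (C / h ^ N)) := by
    have h2 : ∫ x in ball 0 1, (graphDensity (jacobian F x) *
      (N * f (q x) + 2 * deriv f (q x) * (v x ⬝ᵥ graphProj (jacobian F x) *ᵥ v x)) +
        graphDensity (jacobian F x) * (C / h ^ N)) = V * (C / h ^ N) := by
      rw [integral_add hI (hvol.mul_const _), hI0, zero_add, integral_mul_const]
    rw [← h2, ← integral_const_mul]
    refine le_trans ?_ (setIntegral_mono_set hint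
      (Eventually.of_forall fun x => mul_nonneg (by positivity) (hnn x)) hEb.eventuallyLE)
    refine setIntegral_mono_on (hvol.mono_set hEb) (hint.mono_set hEb) hEm
      fun x hx => ?_
    refine le_trans ?_ (mul_le_mul_of_nonneg_left (hpt x) (by positivity))
    have := hwE (by nlinarith) (q x) (hq0 x) (by rw [hqn]; exact hE x hx)
    have h3 := mul_le_mul_of_nonneg_left (hN1.trans this) (graphDensity_pos (jacobian F x)).le
    linarith
  have h2 := hEv.trans h1
  have h3 : ε ^ N * (ω / 2) ≤ ε ^ N * (C ^ 2 * V / h ^ N) := by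
    calc _ = ε ^ N * ω / 2 := by ring
      _ ≤ _ := h2
      _ = _ := by ring
  have h4 := le_of_mul_le_mul_left h3 (by positivity)
  rw [le_div_iff₀ (by positivity)] at h4
  rw [div_mul_eq_mul_div, div_le_iff₀ (by positivity)]
  linarith

end Monotonicity

section NormalProjection

open Matrix

variable {ι κ : Type*} [Fintype ι] [DecidableEq ι] [Fintype κ] [DecidableEq κ]

/-- For `D₀ u = 0`, the orthogonal projection of `ℝ^(ι ⊕ κ)` onto the complement of
`{(w, D₀ w) | w ⊥ u}`. -/
noncomputable def normalProj (u : ι → ℝ) (D₀ : Matrix κ ι ℝ) : Matrix (ι ⊕ κ) (ι ⊕ κ) ℝ :=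
  1 - graphProj D₀ + vecMulVec (Sum.elim u 0) (Sum.elim u 0)

variable {u : ι → ℝ} {D₀ : Matrix κ ι ℝ}

lemma normalProj_transpose : (normalProj u D₀)ᵀ = normalProj u D₀ := by
  simp [normalProj, graphProj_transpose, transpose_vecMulVec]

lemma graphFrame_mulVec_eq (hD : D₀ *ᵥ u = 0) : graphFrame D₀ *ᵥ u = Sum.elim u 0 := by
  simp [graphFrame, fromRows_mulVec, hD]

lemma graphProj_mulVec_eq (hD : D₀ *ᵥ u = 0) :
    graphProj D₀ *ᵥ Sum.elim u 0 = Sum.elim u 0 := by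
  rw [← graphFrame_mulVec_eq hD, mulVec_mulVec, graphProj_mul_graphFrame]

lemma sumElim_zero_dotProduct_self (hu : u ⬝ᵥ u = 1) :
    (Sum.elim u 0 : ι ⊕ κ → ℝ) ⬝ᵥ Sum.elim u 0 = 1 := by
  rw [sumElim_dotProduct_sumElim, hu, dotProduct_zero, add_zero]

lemma normalProj_mulVec_eq (hu : u ⬝ᵥ u = 1) (hD : D₀ *ᵥ u = 0) :
    normalProj u D₀ *ᵥ Sum.elim u 0 = Sum.elim u 0 := by
  rw [normalProj, add_mulVec, sub_mulVec, one_mulVec, graphProj_mulVec_eq hD, sub_self, zero_add,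
    vecMulVec_mulVec, sumElim_zero_dotProduct_self hu]
  simp

lemma one_sub_normalProj : 1 - normalProj u D₀ =
    graphProj D₀ - vecMulVec (Sum.elim u 0) (Sum.elim u 0) := by
  rw [normalProj]
  abel

lemma normalProj_mul_self (hu : u ⬝ᵥ u = 1) (hD : D₀ *ᵥ u = 0) :
    normalProj u D₀ * normalProj u D₀ = normalProj u D₀ := by
  have h1 : normalProj u D₀ * vecMulVec (Sum.elim u 0) (Sum.elim u 0) =
      vecMulVec (Sum.elim u 0) (Sum.elim u 0) := by
    rw [mul_vecMulVec, normalProj_mulVec_eq hu hD]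
  have h2 : normalProj u D₀ * graphProj D₀ = vecMulVec (Sum.elim u 0) (Sum.elim u 0) := by
    have h3 : (Sum.elim u 0 : ι ⊕ κ → ℝ) ᵥ* graphProj D₀ = Sum.elim u 0 := by
      rw [← mulVec_transpose, graphProj_transpose, graphProj_mulVec_eq hD]
    rw [normalProj, Matrix.add_mul, Matrix.sub_mul, Matrix.one_mul, graphProj_mul_self, sub_self,
      zero_add, vecMulVec_mul, h3]
  conv_lhs => rw [normalProj.eq_def u D₀, ← normalProj.eq_def u D₀]
  nth_rw 2 [normalProj]
  rw [Matrix.mul_add, Matrix.mul_sub, Matrix.mul_one, h1, h2, sub_add_cancel]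

lemma graphFrame_mul_one_sub (hD : D₀ *ᵥ u = 0) : graphFrame D₀ * (1 - vecMulVec u u) =
    graphFrame D₀ - vecMulVec (Sum.elim u 0) u := by
  rw [Matrix.mul_sub, Matrix.mul_one, mul_vecMulVec, graphFrame_mulVec_eq hD]

lemma normalProj_mul_graphFrame (hu : u ⬝ᵥ u = 1) (hD : D₀ *ᵥ u = 0) :
    normalProj u D₀ * (graphFrame D₀ * (1 - vecMulVec u u)) = 0 := by
  have h1 : (Sum.elim u 0 : ι ⊕ κ → ℝ) ᵥ* graphFrame D₀ = u := by
    ext i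
    simp [graphFrame, vecMul_fromRows]
  rw [graphFrame_mul_one_sub hD, Matrix.mul_sub, mul_vecMulVec, normalProj_mulVec_eq hu hD,
    normalProj, Matrix.add_mul, Matrix.sub_mul, Matrix.one_mul, graphProj_mul_graphFrame, sub_self,
    zero_add, vecMulVec_mul, h1, sub_self]

lemma trace_normalProj_mul_graphProj (hu : u ⬝ᵥ u = 1) (hD : D₀ *ᵥ u = 0) (D : Matrix κ ι ℝ) :
    (normalProj u D₀ * graphProj D).trace =
      1 + ∑ a, ∑ b, ((1 - graphProj D) * (1 - normalProj u D₀)) a b ^ 2 := by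
  rw [← trace_mul_one_sub_of_idempotent (graphProj_transpose D) (graphProj_mul_self D)
    (by simp [normalProj_transpose])
    (by simp [Matrix.mul_sub, Matrix.sub_mul, normalProj_mul_self hu hD])]
  have h1 : (1 - normalProj u D₀).trace = Fintype.card ι - 1 := by
    rw [one_sub_normalProj, trace_sub, graphProj_trace, trace_vecMulVec,
      sumElim_zero_dotProduct_self hu]
  rw [Matrix.mul_sub, Matrix.mul_one, trace_sub, h1, Matrix.sub_mul, Matrix.one_mul, trace_sub,
    graphProj_trace]
  ring

lemma one_le_trace_normalProj_mul (hu : u ⬝ᵥ u = 1) (hD : D₀ *ᵥ u = 0) (D : Matrix κ ι ℝ) :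
    1 ≤ (normalProj u D₀ * graphProj D).trace := by
  rw [trace_normalProj_mul_graphProj hu hD]
  have : 0 ≤ ∑ a, ∑ b, ((1 - graphProj D) * (1 - normalProj u D₀)) a b ^ 2 :=
    Finset.sum_nonneg fun _ _ => Finset.sum_nonneg fun _ _ => sq_nonneg _
  linarith

lemma mul_one_sub_eq_of_trace_eq_one (hu : u ⬝ᵥ u = 1) (hD : D₀ *ᵥ u = 0) {D : Matrix κ ι ℝ}
    (h : (normalProj u D₀ * graphProj D).trace = 1) : D * (1 - vecMulVec u u) = D₀ := by
  have h1 : (1 - graphProj D) * (1 - normalProj u D₀) = 0 := by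
    rw [trace_normalProj_mul_graphProj hu hD, add_eq_left] at h
    have h2 := (Finset.sum_eq_zero_iff_of_nonneg fun _ _ =>
      Finset.sum_nonneg fun _ _ => sq_nonneg _).1 h
    ext a b
    simpa using (Finset.sum_eq_zero_iff_of_nonneg fun _ _ => sq_nonneg _).1
      (h2 a (Finset.mem_univ _)) b (Finset.mem_univ _)
  set W := graphFrame D₀ * (1 - vecMulVec u u) with hW
  have h2 : (1 - normalProj u D₀) * W = W := by
    rw [Matrix.sub_mul, normalProj_mul_graphFrame hu hD, Matrix.one_mul, sub_zero]
  have h3 : graphFrame D * ((graphMetric D)⁻¹ * ((graphFrame D)ᵀ * W)) = W := by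
    have h4 : (1 - graphProj D) * W = 0 := by rw [← h2, ← Matrix.mul_assoc, h1, Matrix.zero_mul]
    rw [Matrix.sub_mul, Matrix.one_mul, sub_eq_zero] at h4
    rw [← Matrix.mul_assoc, ← Matrix.mul_assoc, ← graphProj, ← h4]
  set X := (graphMetric D)⁻¹ * ((graphFrame D)ᵀ * W)
  have h5 : D₀ * (1 - vecMulVec u u) = D₀ := by
    rw [Matrix.mul_sub, Matrix.mul_one, mul_vecMulVec, hD, zero_vecMulVec, sub_zero]
  rw [hW, graphFrame, graphFrame, fromRows_mul, fromRows_mul, h5, Matrix.one_mul,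
    Matrix.one_mul] at h3
  obtain ⟨h6, h7⟩ := fromRows_inj h3
  rw [← h6, h7]

end NormalProjection

section SmoothEntries

open Matrix

variable {V : Type*} [NormedAddCommGroup V] [NormedSpace ℝ V] {x : V} {k : WithTop ℕ∞}
  {ι κ ν : Type*} [Fintype ι] [DecidableEq ι] [Fintype κ] [DecidableEq κ]

lemma contDiffAt_matrix_mul_apply {A : V → Matrix ν κ ℝ} {B : V → Matrix κ ι ℝ}
    (hA : ∀ a b, ContDiffAt ℝ k (fun y => A y a b) x)
    (hB : ∀ a b, ContDiffAt ℝ k (fun y => B y a b) x) (a : ν) (b : ι) :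
    ContDiffAt ℝ k (fun y => (A y * B y) a b) x := by
  simp only [Matrix.mul_apply]
  exact ContDiffAt.sum fun c _ => (hA a c).mul (hB c b)

lemma contDiffAt_matrix_det {A : V → Matrix ι ι ℝ}
    (hA : ∀ a b, ContDiffAt ℝ k (fun y => A y a b) x) :
    ContDiffAt ℝ k (fun y => (A y).det) x := by
  simp only [Matrix.det_apply]
  exact ContDiffAt.sum fun σ _ => (contDiffAt_prod fun i _ => hA _ _).const_smul _

lemma contDiffAt_matrix_inv_apply {A : V → Matrix ι ι ℝ}
    (hA : ∀ a b, ContDiffAt ℝ k (fun y => A y a b) x) (h0 : (A x).det ≠ 0) (a b : ι) :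
    ContDiffAt ℝ k (fun y => (A y)⁻¹ a b) x := by
  simp only [Matrix.inv_def, Ring.inverse_eq_inv', Matrix.smul_apply, smul_eq_mul,
    Matrix.adjugate_apply]
  refine ((contDiffAt_matrix_det hA).inv h0).mul (contDiffAt_matrix_det fun c d => ?_)
  simp only [Matrix.updateRow_apply]
  split_ifs
  · exact contDiffAt_const
  · exact hA c d

lemma contDiffAt_normalProj_apply {A : V → Matrix κ ι ℝ} {u : V → ι → ℝ}
    (hA : ∀ a b, ContDiffAt ℝ k (fun y => A y a b) x)
    (hu : ∀ a, ContDiffAt ℝ k (fun y => u y a) x) (a b : ι ⊕ κ) :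
    ContDiffAt ℝ k (fun y => normalProj (u y) (A y) a b) x := by
  have h1 : ∀ a b, ContDiffAt ℝ k (fun y => graphFrame (A y) a b) x := fun a b => by
    rcases a with a | a
    · exact contDiffAt_const
    · exact hA a b
  have h2 : ∀ a b, ContDiffAt ℝ k (fun y => graphMetric (A y) a b) x := fun a b => by
    simp only [← graphFrame_transpose_mul_self]
    exact contDiffAt_matrix_mul_apply (fun c d => h1 d c) h1 a b
  have h3 : ∀ a b, ContDiffAt ℝ k (fun y => graphProj (A y) a b) x :=
    contDiffAt_matrix_mul_apply (contDiffAt_matrix_mul_apply h1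
      (contDiffAt_matrix_inv_apply h2 (graphMetric_det_pos _).ne')) fun c d => h1 d c
  have h4 : ∀ a : ι ⊕ κ, ContDiffAt ℝ k (fun y => (Sum.elim (u y) 0 : ι ⊕ κ → ℝ) a) x := fun a => by
    rcases a with a | a
    · exact hu a
    · exact contDiffAt_const
  simp only [normalProj, Matrix.add_apply, Matrix.sub_apply, vecMulVec_apply]
  exact (contDiffAt_const.sub (h3 a b)).add ((h4 a).mul (h4 b))

end SmoothEntries

section RadialProjection

open Matrix Metric Filter Topology

variable {ι κ : Type*} [Fintype ι] [DecidableEq ι] [Fintype κ] [DecidableEq κ]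
  {f : EuclideanSpace ℝ ι → EuclideanSpace ℝ κ}

/-- The radial projection onto the unit sphere. -/
noncomputable def unitVec (x : EuclideanSpace ℝ ι) : EuclideanSpace ℝ ι := ‖x‖⁻¹ • x

lemma norm_unitVec {x : EuclideanSpace ℝ ι} (hx : x ≠ 0) : ‖unitVec x‖ = 1 := by
  rw [unitVec, norm_smul, norm_inv, norm_norm, inv_mul_cancel₀ (norm_ne_zero_iff.2 hx)]

lemma unitVec_of_norm_eq_one {x : EuclideanSpace ℝ ι} (hx : ‖x‖ = 1) : unitVec x = x := by
  simp [unitVec, hx]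

lemma dotProduct_ofLp_self (x : EuclideanSpace ℝ ι) : x.ofLp ⬝ᵥ x.ofLp = ‖x‖ ^ 2 := by
  rw [EuclideanSpace.real_norm_sq_eq]
  simp [dotProduct, sq]

lemma unitVec_dotProduct_self {x : EuclideanSpace ℝ ι} (hx : x ≠ 0) :
    (unitVec x).ofLp ⬝ᵥ (unitVec x).ofLp = 1 := by
  rw [dotProduct_ofLp_self, norm_unitVec hx, one_pow]

lemma norm_smul_unitVec {x : EuclideanSpace ℝ ι} (hx : x ≠ 0) : ‖x‖ • unitVec x = x := by
  rw [unitVec, smul_smul, mul_inv_cancel₀ (norm_ne_zero_iff.2 hx), one_smul]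

lemma norm_sub_unitVec {x : EuclideanSpace ℝ ι} (hx : x ≠ 0) (h1 : ‖x‖ ≤ 1) :
    ‖x - unitVec x‖ = 1 - ‖x‖ := by
  have h2 : x - unitVec x = (‖x‖ - 1) • unitVec x := by
    rw [sub_smul, norm_smul_unitVec hx, one_smul]
  rw [h2, norm_smul, norm_unitVec hx, mul_one, Real.norm_eq_abs, abs_of_nonpos (by linarith)]
  ring

lemma contDiffAt_unitVec {k : ℕ∞} {x : EuclideanSpace ℝ ι} (hx : x ≠ 0) :
    ContDiffAt ℝ k unitVec x :=
  ((contDiffAt_norm ℝ hx).inv (norm_ne_zero_iff.2 hx)).smul contDiffAt_id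

lemma jacobian_unitVec {x : EuclideanSpace ℝ ι} (hx : x ≠ 0) :
    jacobian unitVec x = ‖x‖⁻¹ • (1 - vecMulVec (unitVec x).ofLp (unitVec x).ofLp) := by
  have hn : ‖x‖ ≠ 0 := norm_ne_zero_iff.2 hx
  have h1 : HasFDerivAt (fun y : EuclideanSpace ℝ ι => ‖y‖) (‖x‖⁻¹ • innerSL ℝ x) x := by
    have h2 := ((hasStrictFDerivAt_norm_sq x).hasFDerivAt).sqrt (by positivity)
    simp only [Real.sqrt_sq (norm_nonneg _)] at h2
    refine h2.congr_fderiv ?_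
    ext v
    simp
    field_simp
  have h3 := ((hasDerivAt_inv hn).comp_hasFDerivAt x h1).smul (hasFDerivAt_id x)
  ext i j
  have h4 : fderiv ℝ unitVec x = _ := h3.fderiv
  rw [jacobian_apply, h4]
  simp [unitVec, vecMulVec_apply, Matrix.one_apply]
  rw [EuclideanSpace.inner_single_right]
  split_ifs
  all_goals simp
  all_goals field_simp
  all_goals ring

/-- The derivative of `f` along the sphere at `x / ‖x‖`, as a matrix killing `x / ‖x‖`. -/
noncomputable def tanJacobian (f : EuclideanSpace ℝ ι → EuclideanSpace ℝ κ)
    (x : EuclideanSpace ℝ ι) : Matrix κ ι ℝ :=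
  jacobian f (unitVec x) * (1 - vecMulVec (unitVec x).ofLp (unitVec x).ofLp)

lemma tanJacobian_mul_one_sub {x : EuclideanSpace ℝ ι} (hx : x ≠ 0) :
    tanJacobian f x * (1 - vecMulVec (unitVec x).ofLp (unitVec x).ofLp) = tanJacobian f x := by
  have h : (1 - vecMulVec (unitVec x).ofLp (unitVec x).ofLp) *ᵥ (unitVec x).ofLp = 0 := by
    rw [sub_mulVec, one_mulVec, vecMulVec_mulVec, unitVec_dotProduct_self hx]
    simp
  rw [Matrix.mul_sub, Matrix.mul_one, mul_vecMulVec, tanJacobian, ← mulVec_mulVec, h, mulVec_zero,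
    zero_vecMulVec, sub_zero]

lemma tanJacobian_mulVec {x : EuclideanSpace ℝ ι} (hx : x ≠ 0) :
    tanJacobian f x *ᵥ (unitVec x).ofLp = 0 := by
  rw [tanJacobian, ← mulVec_mulVec, sub_mulVec, one_mulVec, vecMulVec_mulVec,
    unitVec_dotProduct_self hx]
  simp

lemma jacobian_comp_unitVec {x : EuclideanSpace ℝ ι} (hx : x ≠ 0)
    (hf : DifferentiableAt ℝ f (unitVec x)) :
    jacobian (f ∘ unitVec) x = ‖x‖⁻¹ • tanJacobian f x := by
  rw [tanJacobian, ← Matrix.mul_smul, ← jacobian_unitVec hx]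
  ext a i
  rw [jacobian_apply, fderiv_comp x hf ((contDiffAt_unitVec (k := 1) hx).differentiableAt
    one_ne_zero), ContinuousLinearMap.comp_apply, fderiv_apply_eq_jacobian_mulVec]
  simp [Matrix.mul_apply, mulVec, dotProduct, jacobian_apply]

/-- The point of the boundary graph of `f` over `x / ‖x‖`. -/
noncomputable def conePoint (f : EuclideanSpace ℝ ι → EuclideanSpace ℝ κ)
    (x : EuclideanSpace ℝ ι) : ι ⊕ κ → ℝ := pairVec (unitVec x) (f (unitVec x))

/-- The projection onto the normal space of the boundary graph of `f` over `x / ‖x‖`. -/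
noncomputable def coneProj (f : EuclideanSpace ℝ ι → EuclideanSpace ℝ κ)
    (x : EuclideanSpace ℝ ι) : Matrix (ι ⊕ κ) (ι ⊕ κ) ℝ :=
  normalProj (unitVec x).ofLp (tanJacobian f x)

lemma contDiffAt_conePoint_apply {k : ℕ∞} {x : EuclideanSpace ℝ ι} (hx : x ≠ 0)
    (hf : ContDiffAt ℝ k f (unitVec x)) (a : ι ⊕ κ) :
    ContDiffAt ℝ k (fun y => conePoint f y a) x := by
  rcases a with a | a
  · exact (EuclideanSpace.proj a : EuclideanSpace ℝ ι →L[ℝ] ℝ).contDiff.contDiffAt.comp x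
      (contDiffAt_unitVec hx)
  · exact (EuclideanSpace.proj a : EuclideanSpace ℝ κ →L[ℝ] ℝ).contDiff.contDiffAt.comp x
      (hf.comp x (contDiffAt_unitVec hx))

lemma contDiffAt_tanJacobian_apply {x : EuclideanSpace ℝ ι} (hx : x ≠ 0)
    (hf : ContDiffAt ℝ 2 f (unitVec x)) (a : κ) (i : ι) :
    ContDiffAt ℝ 1 (fun y => tanJacobian f y a i) x := by
  have hu : ∀ i, ContDiffAt ℝ 1 (fun y : EuclideanSpace ℝ ι => unitVec y i) x := fun i =>
    (EuclideanSpace.proj i : EuclideanSpace ℝ ι →L[ℝ] ℝ).contDiff.contDiffAt.comp x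
      (contDiffAt_unitVec (k := 1) hx)
  refine contDiffAt_matrix_mul_apply (fun a i => ?_) (fun i j => ?_) a i
  · have h1 : ContDiffAt ℝ 1 (fun y => fderiv ℝ f y (EuclideanSpace.single i 1)) (unitVec x) :=
      (hf.fderiv_right (m := 1) (by norm_num)).clm_apply contDiffAt_const
    exact (EuclideanSpace.proj a : EuclideanSpace ℝ κ →L[ℝ] ℝ).contDiff.contDiffAt.comp x
      (h1.comp x (contDiffAt_unitVec (k := 1) hx))
  · exact contDiffAt_const.sub ((hu i).mul (hu j))

lemma contDiffAt_coneProj_apply {x : EuclideanSpace ℝ ι} (hx : x ≠ 0)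
    (hf : ContDiffAt ℝ 2 f (unitVec x)) (a b : ι ⊕ κ) :
    ContDiffAt ℝ 1 (fun y => coneProj f y a b) x :=
  contDiffAt_normalProj_apply (contDiffAt_tanJacobian_apply hx hf) (fun i =>
    (EuclideanSpace.proj i : EuclideanSpace ℝ ι →L[ℝ] ℝ).contDiff.contDiffAt.comp x
      (contDiffAt_unitVec (k := 1) hx)) a b

lemma fderiv_conePoint_apply {x : EuclideanSpace ℝ ι} (hx : x ≠ 0)
    (hf : DifferentiableAt ℝ f (unitVec x)) (a : ι ⊕ κ) (i : ι) :
    fderiv ℝ (fun y => conePoint f y a) x (EuclideanSpace.single i 1) =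
      (‖x‖⁻¹ • (graphFrame (tanJacobian f x) *
        (1 - vecMulVec (unitVec x).ofLp (unitVec x).ofLp)) : Matrix (ι ⊕ κ) ι ℝ) a i := by
  have hu : DifferentiableAt ℝ (unitVec : EuclideanSpace ℝ ι → EuclideanSpace ℝ ι) x :=
    (contDiffAt_unitVec (k := 1) hx).differentiableAt one_ne_zero
  rw [graphFrame, fromRows_mul, tanJacobian_mul_one_sub hx, Matrix.one_mul]
  rcases a with a | a
  · have h : fderiv ℝ (fun y => conePoint f y (Sum.inl a)) x =
        (EuclideanSpace.proj a : EuclideanSpace ℝ ι →L[ℝ] ℝ).comp (fderiv ℝ unitVec x) :=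
      ((EuclideanSpace.proj a : EuclideanSpace ℝ ι →L[ℝ] ℝ).hasFDerivAt.comp x
        hu.hasFDerivAt).fderiv
    rw [h, Matrix.smul_apply, fromRows_apply_inl, ← Matrix.smul_apply, ← jacobian_unitVec hx]
    rfl
  · have h : fderiv ℝ (fun y => conePoint f y (Sum.inr a)) x =
        (EuclideanSpace.proj a : EuclideanSpace ℝ κ →L[ℝ] ℝ).comp (fderiv ℝ (f ∘ unitVec) x) :=
      ((EuclideanSpace.proj a : EuclideanSpace ℝ κ →L[ℝ] ℝ).hasFDerivAt.comp x
        (hf.comp x hu).hasFDerivAt).fderiv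
    rw [h, Matrix.smul_apply, fromRows_apply_inr, ← Matrix.smul_apply,
      ← jacobian_comp_unitVec hx hf]
    rfl

lemma coneProj_mul_frame {x : EuclideanSpace ℝ ι} (hx : x ≠ 0) :
    coneProj f x * (‖x‖⁻¹ • (graphFrame (tanJacobian f x) *
      (1 - vecMulVec (unitVec x).ofLp (unitVec x).ofLp))) = 0 := by
  rw [Matrix.mul_smul, coneProj, normalProj_mul_graphFrame (unitVec_dotProduct_self hx)
    (tanJacobian_mulVec hx), smul_zero]

end RadialProjection

section ConeOffset

open Matrix Metric Filter Topology

open scoped NNReal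

variable {ι κ ν : Type*} [Fintype ι] [DecidableEq ι] [Fintype κ] [DecidableEq κ] [Fintype ν]
  [DecidableEq ν] {f F : EuclideanSpace ℝ ι → EuclideanSpace ℝ κ} {K : ℝ≥0}

lemma abs_trace_mul_le {A : Matrix ι ν ℝ} {X : Matrix ν ι ℝ} {M C : ℝ} (hA : ∀ i a, |A i a| ≤ M)
    (hX : ∀ a i, |X a i| ≤ C) :
    |(A * X).trace| ≤ Fintype.card ι * (Fintype.card ν * (M * C)) := by
  simp only [Matrix.trace, diag_apply, Matrix.mul_apply]
  refine (Finset.abs_sum_le_sum_abs _ _).trans ((Finset.sum_le_sum fun i _ =>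
    (Finset.abs_sum_le_sum_abs _ _).trans (Finset.sum_le_sum (g := fun _ => M * C)
      fun a _ => ?_)).trans_eq ?_)
  · rw [abs_mul]
    exact mul_le_mul (hA i a) (hX a i) (abs_nonneg _) ((abs_nonneg _).trans (hA i a))
  · simp

lemma le_trace_mul_add {A : Matrix ι ν ℝ} {W : Matrix ν ι ℝ} {P : Matrix ν ν ℝ}
    (hTs : (W * A)ᵀ = W * A) (hT : W * A * (W * A) = W * A) (hP : Pᵀ = P) {Y : ν → ℝ}
    (hPY : P *ᵥ Y = Y) (hY : Y ⬝ᵥ Y ≤ 1) {t : ℝ} (ht : 0 ≤ t) (X : Matrix ν ι ℝ) :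
    t * ((P * (W * A)).trace - 1) - |(A * X).trace| ≤
      (A * (t • ((1 - vecMulVec Y Y) * (P * W)) + X)).trace := by
  have h1 : (A * (P * W)).trace = (P * (W * A)).trace := by
    rw [trace_mul_comm, Matrix.mul_assoc]
  have h2 : (A * (vecMulVec Y Y * (P * W))).trace = Y ⬝ᵥ (W * A) *ᵥ Y := by
    have h3 : Y ᵥ* (P * W) = Y ᵥ* W := by
      rw [← vecMul_vecMul, show Y ᵥ* P = Y by rw [← mulVec_transpose, hP, hPY]]
    rw [vecMulVec_mul, h3, mul_vecMulVec, trace_vecMulVec, dotProduct_comm, ← dotProduct_mulVec,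
      mulVec_mulVec]
  have h3 := (dotProduct_mulVec_le_of_idempotent hTs hT Y).trans hY
  rw [Matrix.mul_add, trace_add, Matrix.mul_smul, trace_smul, Matrix.sub_mul, Matrix.one_mul,
    Matrix.mul_sub, trace_sub, h1, h2, smul_eq_mul]
  have h4 := neg_abs_le (A * X).trace
  nlinarith

lemma abs_apply_le_of_dotProduct_self_le {v : ν → ℝ} {r : ℝ} (hr : 0 ≤ r) (h : v ⬝ᵥ v ≤ r ^ 2)
    (a : ν) : |v a| ≤ r := by
  refine abs_le_of_sq_le_sq ?_ hr
  refine le_trans ?_ h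
  rw [sq]
  exact Finset.single_le_sum (f := fun a => v a * v a) (fun _ _ => mul_self_nonneg _)
    (Finset.mem_univ a)

/-- The component of `p - conePoint f p.1` normal to the boundary graph of `f`. -/
noncomputable def coneOffset (f : EuclideanSpace ℝ ι → EuclideanSpace ℝ κ)
    (p : EuclideanSpace ℝ ι × EuclideanSpace ℝ κ) : ι ⊕ κ → ℝ :=
  coneProj f p.1 *ᵥ (pairVec p.1 p.2 - conePoint f p.1)

lemma coneProj_transpose (x : EuclideanSpace ℝ ι) : (coneProj f x)ᵀ = coneProj f x :=
  normalProj_transpose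

lemma coneProj_mul_self {x : EuclideanSpace ℝ ι} (hx : x ≠ 0) :
    coneProj f x * coneProj f x = coneProj f x :=
  normalProj_mul_self (unitVec_dotProduct_self hx) (tanJacobian_mulVec hx)

lemma coneProj_mulVec_coneOffset {p : EuclideanSpace ℝ ι × EuclideanSpace ℝ κ} (hp : p.1 ≠ 0) :
    coneProj f p.1 *ᵥ coneOffset f p = coneOffset f p := by
  rw [coneOffset, mulVec_mulVec, coneProj_mul_self hp]

lemma contDiffAt_coneOffset {p : EuclideanSpace ℝ ι × EuclideanSpace ℝ κ} (hp : p.1 ≠ 0)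
    (hf : ContDiffAt ℝ 2 f (unitVec p.1)) : ContDiffAt ℝ 1 (coneOffset f) p := by
  refine contDiffAt_pi.2 fun a => ContDiffAt.sum fun b _ => ?_
  refine ((contDiffAt_coneProj_apply hp hf a b).comp p contDiffAt_fst).mul ?_
  refine ((contDiff_pi.1 (contDiff_pairVec 1) b).contDiffAt).sub ?_
  exact (contDiffAt_conePoint_apply (k := 1) hp (hf.of_le (by norm_num)) b).comp p contDiffAt_fst

lemma sq_le_coneOffset_dotProduct_self {p : EuclideanSpace ℝ ι × EuclideanSpace ℝ κ}
    (hp : p.1 ≠ 0) : (1 - ‖p.1‖) ^ 2 ≤ coneOffset f p ⬝ᵥ coneOffset f p := by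
  set u : ι ⊕ κ → ℝ := Sum.elim (unitVec p.1).ofLp 0 with hu
  have h1 : coneProj f p.1 *ᵥ u = u :=
    normalProj_mulVec_eq (unitVec_dotProduct_self hp) (tanJacobian_mulVec hp)
  have h2 : u ⬝ᵥ u = 1 := sumElim_zero_dotProduct_self (unitVec_dotProduct_self hp)
  have h3 : u ⬝ᵥ coneOffset f p = ‖p.1‖ - 1 := by
    rw [coneOffset, dotProduct_mulVec, ← mulVec_transpose, coneProj_transpose, h1, dotProduct_sub,
      conePoint, pairVec, pairVec, hu, sumElim_dotProduct_sumElim, sumElim_dotProduct_sumElim,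
      zero_dotProduct, zero_dotProduct, unitVec_dotProduct_self hp]
    have : p.1.ofLp = ‖p.1‖ • (unitVec p.1).ofLp := by
      rw [← WithLp.ofLp_smul, norm_smul_unitVec hp]
    rw [this, dotProduct_smul, unitVec_dotProduct_self hp]
    simp
  have h4 : (u ⬝ᵥ coneOffset f p) ^ 2 ≤ (u ⬝ᵥ u) * (coneOffset f p ⬝ᵥ coneOffset f p) := by
    have := Finset.sum_mul_sq_le_sq_mul_sq Finset.univ u (coneOffset f p)
    simpa only [dotProduct, ← sq] using this
  rw [h2, h3, one_mul] at h4
  linarith [sq_nonneg (1 - ‖p.1‖), sub_sq_comm ‖p.1‖ 1]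

lemma pairVec_sub_conePoint_dotProduct_self_le (hF : LipschitzWith K F)
    (hb : ∀ x ∈ sphere 0 1, F x = f x) {x : EuclideanSpace ℝ ι} (hx : x ≠ 0) (hx1 : ‖x‖ ≤ 1) :
    (pairVec x (F x) - conePoint f x) ⬝ᵥ (pairVec x (F x) - conePoint f x) ≤
      ((1 + K) * (1 - ‖x‖)) ^ 2 := by
  have h1 : pairVec x (F x) - conePoint f x = pairVec (x - unitVec x) (F x - F (unitVec x)) := by
    rw [conePoint, ← hb _ (by simp [norm_unitVec hx])]
    ext a
    rcases a with a | a <;> simp [pairVec]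
  have h2 := hF.norm_sub_le x (unitVec x)
  rw [norm_sub_unitVec hx hx1] at h2
  have h3 := pow_le_pow_left₀ (norm_nonneg _) h2 2
  rw [h1, pairVec_dotProduct_self, norm_sub_unitVec hx hx1]
  nlinarith [mul_nonneg K.2 (sq_nonneg (1 - ‖x‖))]

lemma coneOffset_dotProduct_self_le (hF : LipschitzWith K F)
    (hb : ∀ x ∈ sphere 0 1, F x = f x) {x : EuclideanSpace ℝ ι} (hx : x ≠ 0) (hx1 : ‖x‖ ≤ 1) :
    coneOffset f (x, F x) ⬝ᵥ coneOffset f (x, F x) ≤ ((1 + K) * (1 - ‖x‖)) ^ 2 := by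
  refine le_trans ?_ (pairVec_sub_conePoint_dotProduct_self_le hF hb hx hx1)
  rw [coneOffset, ← dotProduct_mulVec_eq_self_of_idempotent (coneProj_transpose x)
    (coneProj_mul_self hx)]
  exact dotProduct_mulVec_le_of_idempotent (coneProj_transpose x) (coneProj_mul_self hx) _

lemma fderiv_coneOffset_apply {x : EuclideanSpace ℝ ι} (hx : x ≠ 0)
    (hf : ContDiffAt ℝ 2 f (unitVec x)) (hd : DifferentiableAt ℝ F x) (a : ι ⊕ κ) (i : ι) :
    fderiv ℝ (fun y => coneOffset f (y, F y) a) x (EuclideanSpace.single i 1) =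
      (coneProj f x * graphFrame (jacobian F x)) a i + ∑ b,
        fderiv ℝ (fun y => coneProj f y a b) x (EuclideanSpace.single i 1) *
          (pairVec x (F x) - conePoint f x) b := by
  have h1 : ∀ b, HasFDerivAt (fun y => coneProj f y a b) _ x := fun b =>
    ((contDiffAt_coneProj_apply hx hf a b).differentiableAt one_ne_zero).hasFDerivAt
  have h2 : ∀ b, HasFDerivAt (fun y => (pairVec y (F y) - conePoint f y) b) _ x := fun b =>
    (differentiableAt_pairVec hd b).hasFDerivAt.sub
      ((contDiffAt_conePoint_apply (k := 1) hx (hf.of_le (by norm_num)) b).differentiableAt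
        one_ne_zero).hasFDerivAt
  have h3 : HasFDerivAt (fun y => coneOffset f (y, F y) a) _ x :=
    HasFDerivAt.fun_sum fun b _ => (h1 b).mul (h2 b)
  have h4 : (coneProj f x * graphFrame (jacobian F x)) a i = (coneProj f x *
      (graphFrame (jacobian F x) - (‖x‖⁻¹ • (graphFrame (tanJacobian f x) *
        (1 - vecMulVec (unitVec x).ofLp (unitVec x).ofLp)))) : Matrix (ι ⊕ κ) ι ℝ) a i := by
    rw [Matrix.mul_sub, coneProj_mul_frame hx, sub_zero]
  rw [h3.fderiv, h4, Matrix.mul_apply, ← Finset.sum_add_distrib, _root_.sum_apply]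
  refine Finset.sum_congr rfl fun b _ => ?_
  rw [_root_.add_apply, _root_.smul_apply, _root_.smul_apply, _root_.sub_apply,
    fderiv_pairVec_apply hd, fderiv_conePoint_apply hx (hf.differentiableAt two_ne_zero),
    Matrix.sub_apply, smul_eq_mul, smul_eq_mul, mul_comm (fderiv _ _ _ _)]

end ConeOffset

section BoundaryExcess

open Matrix Metric Filter Topology

open scoped NNReal

variable {ι κ ν : Type*} [Fintype ι] [DecidableEq ι] [Fintype κ] [DecidableEq κ] [Fintype ν]
  [DecidableEq ν] {f F : EuclideanSpace ℝ ι → EuclideanSpace ℝ κ} {K : ℝ≥0}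

/-- The area-weighted amount by which the graph of `F` fails to be tangent to the boundary graph
of `f`. -/
noncomputable def coneExcess (f F : EuclideanSpace ℝ ι → EuclideanSpace ℝ κ)
    (x : EuclideanSpace ℝ ι) : ℝ :=
  graphDensity (jacobian F x) * ((coneProj f x * graphProj (jacobian F x)).trace - 1)

lemma coneExcess_nonneg {x : EuclideanSpace ℝ ι} (hx : x ≠ 0) : 0 ≤ coneExcess f F x :=
  mul_nonneg (graphDensity_pos _).le (sub_nonneg.2
    (one_le_trace_normalProj_mul (unitVec_dotProduct_self hx) (tanJacobian_mulVec hx) _))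

/-- A smooth cutoff which vanishes for `‖x‖ ≤ 1 / 2` and equals one for `1 / 2 ≤ ‖x‖ ^ 2`. -/
noncomputable def innerCutoff (x : EuclideanSpace ℝ ι) : ℝ :=
  Real.smoothTransition (4 * ‖x‖ ^ 2 - 1)

lemma contDiff_innerCutoff {k : ℕ∞} : ContDiff ℝ k (innerCutoff : EuclideanSpace ℝ ι → ℝ) :=
  Real.smoothTransition.contDiff.comp ((contDiff_const.mul (contDiff_norm_sq ℝ)).sub contDiff_const)

lemma innerCutoff_eventuallyEq_zero {x : EuclideanSpace ℝ ι} (hx : ‖x‖ < 1 / 2) :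
    (innerCutoff : EuclideanSpace ℝ ι → ℝ) =ᶠ[𝓝 x] 0 := by
  filter_upwards [(isOpen_lt continuous_norm continuous_const).mem_nhds hx] with y hy
  refine Real.smoothTransition.zero_of_nonpos ?_
  have : ‖y‖ < 1 / 2 := hy
  nlinarith [norm_nonneg y]

lemma innerCutoff_eq_one {x : EuclideanSpace ℝ ι} (hx : 1 / 2 ≤ ‖x‖ ^ 2) : innerCutoff x = 1 :=
  Real.smoothTransition.one_of_one_le (by linarith)

/-- The normal offset, normalised up to `ε` and cut off near the origin. -/
noncomputable def unitOffset (f : EuclideanSpace ℝ ι → EuclideanSpace ℝ κ) (ε : ℝ)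
    (p : EuclideanSpace ℝ ι × EuclideanSpace ℝ κ) : ι ⊕ κ → ℝ :=
  (innerCutoff p.1 * (√(coneOffset f p ⬝ᵥ coneOffset f p + ε ^ 2))⁻¹) • coneOffset f p

lemma dotProduct_self_add_sq_pos (v : ν → ℝ) {ε : ℝ} (hε : 0 < ε) : 0 < v ⬝ᵥ v + ε ^ 2 :=
  add_pos_of_nonneg_of_pos (Finset.sum_nonneg fun _ _ => mul_self_nonneg _) (by positivity)

lemma contDiff_unitOffset (hf : ∀ x ∈ sphere 0 1, ContDiffAt ℝ 2 f x) {ε : ℝ} (hε : 0 < ε) :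
    ContDiff ℝ 1 (unitOffset f ε) := by
  refine contDiff_iff_contDiffAt.2 fun p => ?_
  by_cases hp : p.1 = 0
  · have h1 : unitOffset f ε =ᶠ[𝓝 p] fun _ => 0 := by
      filter_upwards [continuous_fst.continuousAt.eventually
        (innerCutoff_eventuallyEq_zero (x := p.1) (by simp [hp]))] with q hq
      have hq' : innerCutoff q.1 = 0 := hq
      simp [unitOffset, hq']
    exact contDiffAt_const.congr_of_eventuallyEq h1
  · have h1 := contDiffAt_coneOffset hp (hf _ (by simp [norm_unitVec hp]))
    have h2 : ContDiffAt ℝ 1 (fun p => coneOffset f p ⬝ᵥ coneOffset f p + ε ^ 2) p :=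
      (ContDiffAt.sum fun a _ => (contDiffAt_pi.1 h1 a).mul (contDiffAt_pi.1 h1 a)).add
        contDiffAt_const
    have h3 := dotProduct_self_add_sq_pos (coneOffset f p) hε
    have h4 : ContDiffAt ℝ 1 (fun p => (√(coneOffset f p ⬝ᵥ coneOffset f p + ε ^ 2))⁻¹) p :=
      (h2.sqrt h3.ne').inv (Real.sqrt_pos.2 h3).ne'
    have h5 : ContDiffAt ℝ 1 (fun p : EuclideanSpace ℝ ι × EuclideanSpace ℝ κ =>
        innerCutoff p.1) p := (contDiff_innerCutoff (k := 1)).contDiffAt.comp p contDiffAt_fst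
    exact (h5.mul h4).smul h1

lemma fderiv_normalized_apply {V : Type*} [NormedAddCommGroup V] [NormedSpace ℝ V] {x v : V}
    {χ : V → ℝ} {Z : V → ν → ℝ} (hχ : DifferentiableAt ℝ χ x)
    (hZ : ∀ a, DifferentiableAt ℝ (fun y => Z y a) x) {ε : ℝ} (hε : 0 < ε) (a : ν) :
    fderiv ℝ (fun y => ((χ y * (√(Z y ⬝ᵥ Z y + ε ^ 2))⁻¹) • Z y) a) x v =
      χ x * (√(Z x ⬝ᵥ Z x + ε ^ 2))⁻¹ * (fderiv ℝ (fun y => Z y a) x v -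
        ((√(Z x ⬝ᵥ Z x + ε ^ 2))⁻¹ * Z x a) *
          ∑ b, ((√(Z x ⬝ᵥ Z x + ε ^ 2))⁻¹ * Z x b) * fderiv ℝ (fun y => Z y b) x v) +
      ((√(Z x ⬝ᵥ Z x + ε ^ 2))⁻¹ * Z x a) * fderiv ℝ χ x v := by
  have h0 := dotProduct_self_add_sq_pos (Z x) hε
  have h1 : HasFDerivAt (fun y => Z y ⬝ᵥ Z y + ε ^ 2) (∑ b, (Z x b • fderiv ℝ (fun y => Z y b) x +
      Z x b • fderiv ℝ (fun y => Z y b) x)) x :=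
    (HasFDerivAt.fun_sum fun b _ => (hZ b).hasFDerivAt.mul (hZ b).hasFDerivAt).add_const _
  have h2 := ((Real.hasDerivAt_sqrt h0.ne').inv (Real.sqrt_pos.2 h0).ne').comp_hasFDerivAt x h1
  have h3 := (hχ.hasFDerivAt.mul h2).mul (hZ a).hasFDerivAt
  have h4 : HasFDerivAt (fun y => ((χ y * (√(Z y ⬝ᵥ Z y + ε ^ 2))⁻¹) • Z y) a) _ x := h3
  rw [h4.fderiv]
  set s := √(Z x ⬝ᵥ Z x + ε ^ 2) with hs
  have hs0 : 0 < s := Real.sqrt_pos.2 h0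
  have h5 : ∑ b, (s⁻¹ * Z x b) * fderiv ℝ (fun y => Z y b) x v =
      s⁻¹ * ∑ b, Z x b * fderiv ℝ (fun y => Z y b) x v := by
    rw [Finset.mul_sum]
    exact Finset.sum_congr rfl fun b _ => by ring
  rw [h5]
  simp only [Pi.mul_apply, Pi.inv_apply, Function.comp_apply, _root_.add_apply, _root_.smul_apply,
    _root_.sum_apply, smul_eq_mul, Finset.sum_add_distrib, ← hs]
  field_simp
  ring

end BoundaryExcess

section ExcessIntegrability

open Matrix Metric Filter Topology

open scoped NNReal ENNReal

variable {ι κ ν : Type*} [Fintype ι] [DecidableEq ι] [Fintype κ] [DecidableEq κ] [Fintype ν]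
  [DecidableEq ν] {f F : EuclideanSpace ℝ ι → EuclideanSpace ℝ κ} {K : ℝ≥0}

lemma exists_abs_fderiv_coneProj_le (hf : ∀ x ∈ sphere 0 1, ContDiffAt ℝ 2 f x) :
    ∃ C : ℝ, 0 ≤ C ∧ ∀ x : EuclideanSpace ℝ ι, 1 / 2 ≤ ‖x‖ → ‖x‖ ≤ 1 → ∀ a b i,
      |fderiv ℝ (fun y => coneProj f y a b) x (EuclideanSpace.single i 1)| ≤ C := by
  have hcomp : IsCompact {x : EuclideanSpace ℝ ι | 1 / 2 ≤ ‖x‖ ∧ ‖x‖ ≤ 1} := by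
    refine (isCompact_closedBall 0 1).of_isClosed_subset ((isClosed_le continuous_const
      continuous_norm).inter (isClosed_le continuous_norm continuous_const)) fun x hx => ?_
    simpa using hx.2
  have h1 : ∀ a b, ∃ C, ∀ x ∈ {x : EuclideanSpace ℝ ι | 1 / 2 ≤ ‖x‖ ∧ ‖x‖ ≤ 1},
      ‖fderiv ℝ (fun y => coneProj f y a b) x‖ ≤ C := fun a b => by
    refine hcomp.exists_bound_of_continuousOn fun x hx => ContinuousAt.continuousWithinAt ?_
    have hx0 : x ≠ 0 := norm_pos_iff.1 (by linarith [hx.1])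
    exact ((contDiffAt_coneProj_apply hx0 (hf _ (by simp [norm_unitVec hx0])) a b).fderiv_right
      (m := 0) (by norm_num)).continuousAt
  choose C hC using h1
  refine ⟨∑ a, ∑ b, |C a b|, Finset.sum_nonneg fun _ _ => Finset.sum_nonneg fun _ _ => abs_nonneg _,
    fun x h1 h2 a b i => ?_⟩
  calc _ ≤ ‖fderiv ℝ (fun y => coneProj f y a b) x‖ := by
        rw [← Real.norm_eq_abs]
        refine (ContinuousLinearMap.le_opNorm _ _).trans_eq ?_
        simp
    _ ≤ |C a b| := (hC a b x ⟨h1, h2⟩).trans (le_abs_self _)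
    _ ≤ ∑ b, |C a b| := Finset.single_le_sum (f := fun b => |C a b|) (fun _ _ => abs_nonneg _)
        (Finset.mem_univ b)
    _ ≤ _ := Finset.single_le_sum (f := fun a => ∑ b, |C a b|)
        (fun _ _ => Finset.sum_nonneg fun _ _ => abs_nonneg _) (Finset.mem_univ a)

lemma exists_abs_graphDensity_mul_le (hF : LipschitzWith K F) : ∃ M : ℝ, 0 ≤ M ∧ ∀ x i a,
    |(graphDensity (jacobian F x) •
      ((graphMetric (jacobian F x))⁻¹ * (graphFrame (jacobian F x))ᵀ)) i a| ≤ M := by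
  have h1 : ∀ i a, ∃ M, ∀ x, |(graphDensity (jacobian F x) •
      ((graphMetric (jacobian F x))⁻¹ * (graphFrame (jacobian F x))ᵀ)) i a| ≤ M := fun i a =>
    exists_abs_comp_jacobian_le (f := fun D => (graphDensity D •
      ((graphMetric D)⁻¹ * (graphFrame D)ᵀ)) i a) hF ((continuous_graphDensity.smul
        (continuous_graphMetric_inv.matrix_mul continuous_graphFrame.matrix_transpose)).matrix_elem
          i a)
  choose M hM using h1
  refine ⟨∑ i, ∑ a, |M i a|, Finset.sum_nonneg fun _ _ => Finset.sum_nonneg fun _ _ => abs_nonneg _,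
    fun x i a => ?_⟩
  calc _ ≤ |M i a| := (hM i a x).trans (le_abs_self _)
    _ ≤ ∑ a, |M i a| := Finset.single_le_sum (f := fun a => |M i a|) (fun _ _ => abs_nonneg _)
        (Finset.mem_univ a)
    _ ≤ _ := Finset.single_le_sum (f := fun i => ∑ a, |M i a|)
        (fun _ _ => Finset.sum_nonneg fun _ _ => abs_nonneg _) (Finset.mem_univ i)

lemma exists_abs_fderiv_innerCutoff_le : ∃ C : ℝ, 0 ≤ C ∧ ∀ x : EuclideanSpace ℝ ι, ‖x‖ ≤ 1 →
    ∀ i, |fderiv ℝ (innerCutoff : EuclideanSpace ℝ ι → ℝ) x (EuclideanSpace.single i 1)| ≤ C := by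
  obtain ⟨C, hC⟩ := (isCompact_closedBall (0 : EuclideanSpace ℝ ι) 1).exists_bound_of_continuousOn
    ((contDiff_innerCutoff (ι := ι) (k := 1)).continuous_fderiv one_ne_zero).continuousOn
  refine ⟨C, (norm_nonneg _).trans (hC 0 (by simp)), fun x hx i => ?_⟩
  rw [← Real.norm_eq_abs]
  refine (ContinuousLinearMap.le_opNorm _ _).trans ?_
  simpa using hC x (by simpa using hx)

lemma abs_one_sub_vecMulVec_mul_apply_le {Y : ν → ℝ} (hY : ∀ a, |Y a| ≤ 1) {A : Matrix ν ι ℝ}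
    {C : ℝ} (hA : ∀ a i, |A a i| ≤ C) (a : ν) (i : ι) :
    |((1 - vecMulVec Y Y) * A : Matrix ν ι ℝ) a i| ≤ C + Fintype.card ν * C := by
  have h1 : ((1 - vecMulVec Y Y) * A : Matrix ν ι ℝ) a i = A a i - Y a * ∑ b, Y b * A b i := by
    rw [Matrix.sub_mul, Matrix.one_mul, vecMulVec_mul, Matrix.sub_apply, vecMulVec_apply]
    rfl
  rw [h1]
  refine (abs_sub _ _).trans (add_le_add (hA a i) ?_)
  rw [abs_mul]
  have h2 : |∑ b, Y b * A b i| ≤ Fintype.card ν * C := by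
    refine (Finset.abs_sum_le_sum_abs _ _).trans ((Finset.sum_le_sum (g := fun _ => C)
      fun b _ => ?_).trans_eq (by simp))
    rw [abs_mul]
    exact (mul_le_of_le_one_left (abs_nonneg _) (hY b)).trans (hA b i)
  exact (mul_le_of_le_one_left (abs_nonneg _) (hY a)).trans h2

/-- The derivative of the normalised offset field along the graph of `F`. -/
noncomputable def unitOffsetDeriv (f F : EuclideanSpace ℝ ι → EuclideanSpace ℝ κ) (ε : ℝ)
    (x : EuclideanSpace ℝ ι) : Matrix (ι ⊕ κ) ι ℝ :=
  of fun a i => fderiv ℝ (fun y => unitOffset f ε (y, F y) a) x (EuclideanSpace.single i 1)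

/-- The error terms in the first variation of the normalised offset field are bounded uniformly in
the normalisation parameter. -/
lemma exists_coneExcess_le_trace (hF : LipschitzWith K F)
    (hf : ∀ x ∈ sphere 0 1, ContDiffAt ℝ 2 f x) (hb : ∀ x ∈ sphere 0 1, F x = f x) :
    ∃ C : ℝ, 0 ≤ C ∧ ∀ ε > 0, ∀ x ∈ ball (0 : EuclideanSpace ℝ ι) 1, DifferentiableAt ℝ F x →
      innerCutoff x * (√(((1 + K) * (1 - ‖x‖)) ^ 2 + ε ^ 2))⁻¹ * coneExcess f F x - C ≤
        graphDensity (jacobian F x) * ((graphMetric (jacobian F x))⁻¹ *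
          (graphFrame (jacobian F x))ᵀ * unitOffsetDeriv f F ε x).trace := by
  obtain ⟨CP, hCP0, hCP⟩ := exists_abs_fderiv_coneProj_le hf
  obtain ⟨M, hM0, hM⟩ := exists_abs_graphDensity_mul_le hF
  obtain ⟨Cχ, hCχ0, hCχ⟩ := exists_abs_fderiv_innerCutoff_le (ι := ι)
  set C1 := Fintype.card (ι ⊕ κ) * (CP * (1 + K)) with hC1
  have hC10 : 0 ≤ C1 := by positivity
  set C3 := C1 + Fintype.card (ι ⊕ κ) * C1 + Cχ with hC3
  have hC30 : 0 ≤ C3 := by positivity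
  refine ⟨Fintype.card ι * (Fintype.card (ι ⊕ κ) * (M * C3)), by positivity,
    fun ε hε x hx hd => ?_⟩
  have hx1 : ‖x‖ < 1 := by simpa using hx
  rcases lt_or_ge ‖x‖ (1 / 2) with hx2 | hx2
  · have h1 := innerCutoff_eventuallyEq_zero hx2
    have h2 : innerCutoff x = 0 := h1.self_of_nhds
    have h3 : unitOffsetDeriv f F ε x = 0 := by
      ext a i
      have h4 : (fun y => unitOffset f ε (y, F y) a) =ᶠ[𝓝 x] fun _ => 0 := by
        filter_upwards [h1] with y hy
        have hy' : innerCutoff y = 0 := hy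
        simp [unitOffset, hy']
      simp [unitOffsetDeriv, h4.fderiv_eq]
    rw [h2, h3, Matrix.mul_zero, trace_zero]
    have : 0 ≤ Fintype.card ι * (Fintype.card (ι ⊕ κ) * (M * C3)) := by positivity
    linarith
  have hx0 : x ≠ 0 := norm_pos_iff.1 (by linarith)
  have hfx := hf (unitVec x) (by simp [norm_unitVec hx0])
  set Z : EuclideanSpace ℝ ι → ι ⊕ κ → ℝ := fun y => coneOffset f (y, F y) with hZ
  have hZd : ∀ a, DifferentiableAt ℝ (fun y => Z y a) x := fun a =>
    differentiableAt_pi.1 (((contDiffAt_coneOffset (p := (x, F x)) hx0 hfx).differentiableAt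
      one_ne_zero).comp x (differentiableAt_id.prodMk hd)) a
  set q := Z x ⬝ᵥ Z x + ε ^ 2 with hq
  have hq0 : 0 < q := dotProduct_self_add_sq_pos _ hε
  set s := (√q)⁻¹ with hs
  have hs0 : 0 < s := inv_pos.2 (Real.sqrt_pos.2 hq0)
  have hsq : s ^ 2 * q = 1 := by
    rw [hs, inv_pow, Real.sq_sqrt hq0.le, inv_mul_cancel₀ hq0.ne']
  have hsρ : s * (1 - ‖x‖) ≤ 1 := by
    have h1 : (1 - ‖x‖) ^ 2 ≤ Z x ⬝ᵥ Z x := sq_le_coneOffset_dotProduct_self (p := (x, F x)) hx0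
    have h2 : (1 - ‖x‖) ^ 2 ≤ q := by nlinarith
    rw [hs, inv_mul_le_one₀ (Real.sqrt_pos.2 hq0)]
    exact Real.le_sqrt_of_sq_le h2
  have hsL : (√(((1 + K) * (1 - ‖x‖)) ^ 2 + ε ^ 2))⁻¹ ≤ s := by
    rw [hs]
    refine inv_anti₀ (Real.sqrt_pos.2 hq0) (Real.sqrt_le_sqrt ?_)
    have := coneOffset_dotProduct_self_le hF hb hx0 hx1.le
    rw [hq]
    linarith
  set Y := s • Z x with hYdef
  have hYY : Y ⬝ᵥ Y ≤ 1 ^ 2 := by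
    rw [hYdef, smul_dotProduct, dotProduct_smul, smul_eq_mul, smul_eq_mul]
    nlinarith [sq_nonneg (s * ε)]
  have hY1 : ∀ a, |Y a| ≤ 1 := abs_apply_le_of_dotProduct_self_le zero_le_one hYY
  have hPY : coneProj f x *ᵥ Y = Y := by
    rw [hYdef, mulVec_smul]
    exact congrArg _ (coneProj_mulVec_coneOffset (p := (x, F x)) hx0)
  have hχ0 : 0 ≤ innerCutoff x := Real.smoothTransition.nonneg _
  have hχ1 : innerCutoff x ≤ 1 := Real.smoothTransition.le_one _
  set W := graphFrame (jacobian F x) with hW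
  set G := (graphMetric (jacobian F x))⁻¹ with hG
  have hWG : W * (G * Wᵀ) = graphProj (jacobian F x) := by rw [graphProj, Matrix.mul_assoc]
  set Err : Matrix (ι ⊕ κ) ι ℝ := of fun a i => ∑ b,
    fderiv ℝ (fun y => coneProj f y a b) x (EuclideanSpace.single i 1) *
      (pairVec x (F x) - conePoint f x) b with hErr
  have hsErr : ∀ a i, |(innerCutoff x * s) * Err a i| ≤ C1 := fun a i => by
    have h1 : |Err a i| ≤ C1 * (1 - ‖x‖) := by
      rw [hErr, of_apply]
      refine (Finset.abs_sum_le_sum_abs _ _).trans ((Finset.sum_le_sum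
        (g := fun _ => CP * ((1 + K) * (1 - ‖x‖))) fun b _ => ?_).trans_eq ?_)
      · rw [abs_mul]
        exact mul_le_mul (hCP x hx2 hx1.le a b i) (abs_apply_le_of_dotProduct_self_le
          (mul_nonneg (by positivity) (by linarith))
          (pairVec_sub_conePoint_dotProduct_self_le hF hb hx0 hx1.le) b) (abs_nonneg _) hCP0
      · rw [Finset.sum_const, Finset.card_univ, nsmul_eq_mul, hC1]
        ring
    rw [abs_mul, abs_of_nonneg (by positivity)]
    calc innerCutoff x * s * |Err a i| ≤ 1 * s * (C1 * (1 - ‖x‖)) := by gcongr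
      _ = C1 * (s * (1 - ‖x‖)) := by ring
      _ ≤ C1 := mul_le_of_le_one_right hC10 hsρ
  set w : ι → ℝ := fun i => fderiv ℝ innerCutoff x (EuclideanSpace.single i 1) with hw
  set X : Matrix (ι ⊕ κ) ι ℝ := (1 - vecMulVec Y Y) * ((innerCutoff x * s) • Err) + vecMulVec Y w
    with hX
  have hXle : ∀ a i, |X a i| ≤ C3 := fun a i => by
    rw [hX, Matrix.add_apply, vecMulVec_apply]
    refine (abs_add_le _ _).trans (add_le_add (abs_one_sub_vecMulVec_mul_apply_le hY1 hsErr a i) ?_)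
    rw [abs_mul]
    exact (mul_le_of_le_one_left (abs_nonneg _) (hY1 a)).trans (hCχ x hx1.le i)
  have hB : unitOffsetDeriv f F ε x =
      (innerCutoff x * s) • ((1 - vecMulVec Y Y) * (coneProj f x * W)) + X := by
    have h1 : (innerCutoff x * s) • ((1 - vecMulVec Y Y) * (coneProj f x * W)) + X =
        (innerCutoff x * s) • ((1 - vecMulVec Y Y) * (coneProj f x * W + Err)) + vecMulVec Y w := by
      rw [hX, Matrix.mul_smul, Matrix.mul_add, smul_add, add_assoc]
    have h2 : ∀ a i, fderiv ℝ (fun y => Z y a) x (EuclideanSpace.single i 1) =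
        (coneProj f x * W + Err) a i := fderiv_coneOffset_apply hx0 hfx hd
    rw [h1]
    ext a i
    have h3 := fderiv_normalized_apply (v := EuclideanSpace.single i 1)
      ((contDiff_innerCutoff (k := 1)).differentiable one_ne_zero x) hZd hε a
    refine Eq.trans h3 ?_
    simp only [h2]
    generalize coneProj f x * W + Err = DZ
    have h4 : ((innerCutoff x * s) • ((1 - vecMulVec Y Y) * DZ) + vecMulVec Y w :
        Matrix (ι ⊕ κ) ι ℝ) a i =
        innerCutoff x * s * (DZ a i - Y a * ∑ b, Y b * DZ b i) + Y a * w i := by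
      rw [Matrix.sub_mul, Matrix.one_mul, vecMulVec_mul, Matrix.add_apply, Matrix.smul_apply,
        Matrix.sub_apply, vecMulVec_apply, vecMulVec_apply]
      rfl
    rw [h4]
    rfl
  have hmain := le_trace_mul_add (A := G * Wᵀ) (W := W) (P := coneProj f x)
    (by rw [hWG, graphProj_transpose]) (by rw [hWG, graphProj_mul_self]) (coneProj_transpose x)
    hPY (by simpa using hYY) (t := innerCutoff x * s) (by positivity) X
  rw [← hB, hWG] at hmain
  have hX2 := abs_trace_mul_le (hM x) hXle
  rw [Matrix.smul_mul, trace_smul, smul_eq_mul, abs_mul,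
    abs_of_pos (graphDensity_pos (jacobian F x))] at hX2
  have h5 := mul_le_mul_of_nonneg_left hmain (graphDensity_pos (jacobian F x)).le
  have h6 : innerCutoff x * (√(((1 + K) * (1 - ‖x‖)) ^ 2 + ε ^ 2))⁻¹ * coneExcess f F x ≤
      innerCutoff x * s * coneExcess f F x :=
    mul_le_mul_of_nonneg_right (mul_le_mul_of_nonneg_left hsL hχ0) (coneExcess_nonneg hx0)
  have h7 : innerCutoff x * s * coneExcess f F x = graphDensity (jacobian F x) *
      (innerCutoff x * s * ((coneProj f x * graphProj (jacobian F x)).trace - 1)) := by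
    rw [coneExcess]
    ring
  rw [mul_sub] at h5
  linarith

end ExcessIntegrability

section ExcessDivDistance

open Matrix Metric Filter Topology

open scoped NNReal ENNReal

variable {ι κ : Type*} [Fintype ι] [DecidableEq ι] [Fintype κ] [DecidableEq κ]
  {f F : EuclideanSpace ℝ ι → EuclideanSpace ℝ κ} {K : ℝ≥0}

lemma integrable_of_tendsto_of_lintegral_enorm_le {α : Type*} [MeasurableSpace α] {μ : Measure α}
    {G : ℕ → α → ℝ} {g : α → ℝ} (hG : ∀ n, AEStronglyMeasurable (G n) μ)
    (hlim : ∀ᵐ x ∂μ, Tendsto (fun n => G n x) atTop (𝓝 (g x))) {C : ℝ≥0∞} (hC : C ≠ ⊤)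
    (hle : ∀ n, ∫⁻ x, ‖G n x‖ₑ ∂μ ≤ C) : Integrable g μ := by
  refine ⟨aestronglyMeasurable_of_tendsto_ae _ hG hlim, lt_of_le_of_lt ?_ hC.lt_top⟩
  calc ∫⁻ x, ‖g x‖ₑ ∂μ = ∫⁻ x, liminf (fun n => ‖G n x‖ₑ) atTop ∂μ :=
        lintegral_congr_ae (by filter_upwards [hlim] with x hx using hx.enorm.liminf_eq.symm)
    _ ≤ liminf (fun n => ∫⁻ x, ‖G n x‖ₑ ∂μ) atTop :=
        lintegral_liminf_le' fun n => (hG n).aemeasurable.enorm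
    _ ≤ C := liminf_le_of_le (by isBoundedDefault) fun b hb => by
        obtain ⟨n, hn⟩ := hb.exists
        exact hn.trans (hle n)

/-- The part of the unit ball on which `1 / 2 ≤ ‖x‖ ^ 2`. -/
def outerShell (ι : Type*) [Fintype ι] : Set (EuclideanSpace ℝ ι) :=
  {x ∈ ball 0 1 | 1 / 2 ≤ ‖x‖ ^ 2}

lemma measurableSet_outerShell : MeasurableSet (outerShell ι) :=
  measurableSet_ball.inter (measurableSet_le measurable_const (measurable_norm.pow_const 2))

lemma outerShell_subset_ball : outerShell ι ⊆ ball 0 1 := fun _ hx => hx.1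

lemma ne_zero_of_mem_outerShell {x : EuclideanSpace ℝ ι} (hx : x ∈ outerShell ι) : x ≠ 0 := by
  rintro rfl
  have := hx.2
  norm_num at this

lemma aestronglyMeasurable_coneExcess (hf : ∀ x ∈ sphere 0 1, ContDiffAt ℝ 2 f x) :
    AEStronglyMeasurable (coneExcess f F) (volume.restrict (outerShell ι)) := by
  have h1 : ∀ a b, AEStronglyMeasurable (fun x => coneProj f x a b)
      (volume.restrict (outerShell ι)) := fun a b => by
    refine ContinuousOn.aestronglyMeasurable (fun x hx => ContinuousAt.continuousWithinAt ?_)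
      measurableSet_outerShell
    have hx0 := ne_zero_of_mem_outerShell hx
    exact (contDiffAt_coneProj_apply hx0 (hf _ (by simp [norm_unitVec hx0])) a b).continuousAt
  have h2 : ∀ a b, Measurable fun x => graphProj (jacobian F x) a b := fun a b =>
    measurable_comp_jacobian F (continuous_graphProj.matrix_elem a b)
  have h3 : coneExcess f F = fun x => graphDensity (jacobian F x) *
      ((∑ a, ∑ b, coneProj f x a b * graphProj (jacobian F x) b a) - 1) := rfl
  rw [h3]
  refine (measurable_comp_jacobian F continuous_graphDensity).aestronglyMeasurable.mul
    (AEStronglyMeasurable.sub ?_ aestronglyMeasurable_const)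
  exact Finset.aestronglyMeasurable_fun_sum _ fun a _ =>
    Finset.aestronglyMeasurable_fun_sum _ fun b _ =>
    (h1 a b).mul (h2 b a).aestronglyMeasurable

lemma unitOffset_eq_zero {x : EuclideanSpace ℝ ι} (hx : ‖x‖ = 1) (hb : F x = f x) (ε : ℝ) :
    unitOffset f ε (x, F x) = 0 := by
  have h : coneOffset f (x, F x) = 0 := by
    rw [coneOffset, conePoint, unitVec_of_norm_eq_one hx, hb, sub_self, mulVec_zero]
  rw [unitOffset, h, smul_zero]

lemma IsStationaryGraph.exists_lintegral_coneExcess_le [Nonempty ι] (hS : IsStationaryGraph F)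
    (hF : LipschitzWith K F) (hf : ∀ x ∈ sphere 0 1, ContDiffAt ℝ 2 f x)
    (hb : ∀ x ∈ sphere 0 1, F x = f x) : ∃ C : ℝ≥0∞, C ≠ ⊤ ∧ ∀ ε > 0,
      ∫⁻ x in outerShell ι,
        ‖(√(((1 + K) * (1 - ‖x‖)) ^ 2 + ε ^ 2))⁻¹ * coneExcess f F x‖ₑ ≤ C := by
  obtain ⟨C, hC0, hC⟩ := exists_coneExcess_le_trace hF hf hb
  set B := ball (0 : EuclideanSpace ℝ ι) 1 with hBdef
  refine ⟨ENNReal.ofReal (C * volume.real B), ENNReal.ofReal_ne_top, fun ε hε => ?_⟩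
  obtain ⟨C', hC'⟩ := exists_lipschitzOnWith_comp_graph (contDiff_unitOffset hf hε) hF
  set T := fun x => graphDensity (jacobian F x) * ((graphMetric (jacobian F x))⁻¹ *
    (graphFrame (jacobian F x))ᵀ * unitOffsetDeriv f F ε x).trace with hT
  obtain ⟨hi, h0⟩ : IntegrableOn T B ∧ ∫ x in B, T x = 0 :=
    hS.integral_trace_eq_zero (B := unitOffsetDeriv f F ε) hF hC' (fun x hx =>
      unitOffset_eq_zero (by simpa using hx) (hb x hx) ε) fun _ _ _ _ _ => rfl
  have hCi : IntegrableOn (fun _ => C) B :=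
    integrableOn_const measure_ball_lt_top.ne
  have hae : ∀ᵐ x ∂volume.restrict B,
      innerCutoff x * (√(((1 + K) * (1 - ‖x‖)) ^ 2 + ε ^ 2))⁻¹ * coneExcess f F x ≤ T x + C ∧
        0 ≤ T x + C := by
    filter_upwards [ae_restrict_mem measurableSet_ball, ae_restrict_of_ae hF.ae_differentiableAt]
      with x hx hd
    have h1 := hC ε hε x hx hd
    refine ⟨by linarith, ?_⟩
    have h2 : 0 ≤ innerCutoff x * (√(((1 + K) * (1 - ‖x‖)) ^ 2 + ε ^ 2))⁻¹ * coneExcess f F x := by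
      rcases eq_or_ne x 0 with rfl | hx0
      · have : innerCutoff (0 : EuclideanSpace ℝ ι) = 0 :=
          (innerCutoff_eventuallyEq_zero (by simp)).self_of_nhds
        rw [this, zero_mul, zero_mul]
      · exact mul_nonneg (mul_nonneg (Real.smoothTransition.nonneg _) (by positivity))
          (coneExcess_nonneg hx0)
    linarith
  calc _ ≤ ∫⁻ x in outerShell ι, ENNReal.ofReal (T x + C) := by
        refine lintegral_mono_ae ?_
        filter_upwards [ae_restrict_mem measurableSet_outerShell,
          ae_restrict_of_ae_restrict_of_subset outerShell_subset_ball hae] with x hx h1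
        have h2 := h1.1
        rw [innerCutoff_eq_one hx.2, one_mul] at h2
        rw [Real.enorm_of_nonneg (mul_nonneg (by positivity)
          (coneExcess_nonneg (ne_zero_of_mem_outerShell hx)))]
        exact ENNReal.ofReal_le_ofReal h2
    _ ≤ ∫⁻ x in B, ENNReal.ofReal (T x + C) := lintegral_mono_set outerShell_subset_ball
    _ = ENNReal.ofReal (∫ x in B, (T x + C)) :=
        (ofReal_integral_eq_lintegral_ofReal (hi.add hCi) (hae.mono fun x hx => hx.2)).symm
    _ = ENNReal.ofReal (C * volume.real B) := by
        rw [integral_add hi hCi, h0, setIntegral_const, zero_add, smul_eq_mul, mul_comm]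

theorem IsStationaryGraph.integrableOn_coneExcess_div [Nonempty ι] (hS : IsStationaryGraph F)
    (hF : LipschitzWith K F) (hf : ∀ x ∈ sphere 0 1, ContDiffAt ℝ 2 f x)
    (hb : ∀ x ∈ sphere 0 1, F x = f x) :
    IntegrableOn (fun x => coneExcess f F x / (1 - ‖x‖)) (outerShell ι) := by
  obtain ⟨C, hC, hle⟩ := hS.exists_lintegral_coneExcess_le hF hf hb
  have hm := aestronglyMeasurable_coneExcess (F := F) hf
  have h1 : IntegrableOn (fun x => ((1 + K) * (1 - ‖x‖))⁻¹ * coneExcess f F x)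
      (outerShell ι) := by
    refine integrable_of_tendsto_of_lintegral_enorm_le (G := fun n x =>
      (√(((1 + K) * (1 - ‖x‖)) ^ 2 + (1 / ((n : ℝ) + 1)) ^ 2))⁻¹ * coneExcess f F x)
      (fun n => ?_) ?_ hC fun n => hle _ (by positivity)
    · refine AEStronglyMeasurable.mul (Measurable.aestronglyMeasurable ?_) hm
      fun_prop
    · filter_upwards [ae_restrict_mem measurableSet_outerShell] with x hx
      have h2 : 0 < (1 + K) * (1 - ‖x‖) := by
        have : ‖x‖ < 1 := by simpa using hx.1
        have := sub_pos.2 this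
        positivity
      have h3 : Tendsto (fun n : ℕ => ((1 + K) * (1 - ‖x‖)) ^ 2 + (1 / ((n : ℝ) + 1)) ^ 2) atTop
          (𝓝 (((1 + K) * (1 - ‖x‖)) ^ 2 + 0 ^ 2)) :=
        (tendsto_one_div_add_atTop_nhds_zero_nat.pow 2).const_add _
      have h4 := h3.sqrt
      rw [zero_pow two_ne_zero, add_zero, Real.sqrt_sq h2.le] at h4
      exact (h4.inv₀ h2.ne').mul_const _
  refine (h1.const_mul (1 + K : ℝ)).congr (Eventually.of_forall fun x => ?_)
  have h2 : (1 + K : ℝ) ≠ 0 := by positivity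
  simp only [mul_inv]
  rw [div_eq_mul_inv]
  field_simp

end ExcessDivDistance

section FluxIdentity

open Matrix Metric Filter Topology

open scoped NNReal

variable {ι κ : Type*} [Fintype ι] [DecidableEq ι] [Fintype κ] [DecidableEq κ]
  {F : EuclideanSpace ℝ ι → EuclideanSpace ℝ κ} {K : ℝ≥0}

/-- A smooth approximation of the sign function at scale `δ`. -/
noncomputable def smoothSign (δ t : ℝ) : ℝ := t * (√(t ^ 2 + δ ^ 2))⁻¹

/-- The derivative of `smoothSign δ`. -/
noncomputable def smoothSignDeriv (δ t : ℝ) : ℝ := δ ^ 2 * ((√(t ^ 2 + δ ^ 2)) ^ 3)⁻¹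

section Kernel

variable {δ t : ℝ}

lemma hasDerivAt_smoothSign (hδ : 0 < δ) (t : ℝ) :
    HasDerivAt (smoothSign δ) (smoothSignDeriv δ t) t := by
  have h0 : 0 < t ^ 2 + δ ^ 2 := by positivity
  have h1 : HasDerivAt (fun t : ℝ => t ^ 2 + δ ^ 2) (2 * t) t := by
    simpa using (hasDerivAt_pow 2 t).add_const (δ ^ 2)
  have h2 := (hasDerivAt_id t).mul ((h1.sqrt h0.ne').inv (Real.sqrt_pos.2 h0).ne')
  refine HasDerivAt.congr_deriv h2 ?_
  have h3 : 0 < √(t ^ 2 + δ ^ 2) := Real.sqrt_pos.2 h0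
  have h4 : √(t ^ 2 + δ ^ 2) ^ 2 = t ^ 2 + δ ^ 2 := Real.sq_sqrt h0.le
  simp only [smoothSignDeriv, id, Pi.inv_apply]
  field_simp
  rw [h4]
  ring

lemma contDiff_smoothSign (hδ : 0 < δ) : ContDiff ℝ 1 (smoothSign δ) := by
  have h0 : ∀ t : ℝ, t ^ 2 + δ ^ 2 ≠ 0 := fun t => by positivity
  exact contDiff_id.mul ((((contDiff_id.pow 2).add contDiff_const).sqrt h0).inv fun t => by
    have := h0 t
    have : 0 < t ^ 2 + δ ^ 2 := by positivity
    exact (Real.sqrt_pos.2 this).ne')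

lemma smoothSignDeriv_nonneg : 0 ≤ smoothSignDeriv δ t := by
  unfold smoothSignDeriv
  positivity

lemma continuous_smoothSignDeriv (hδ : 0 < δ) : Continuous (smoothSignDeriv δ) := by
  unfold smoothSignDeriv
  refine continuous_const.mul (Continuous.inv₀ (by fun_prop) fun t => ?_)
  have : 0 < t ^ 2 + δ ^ 2 := by positivity
  exact (pow_pos (Real.sqrt_pos.2 this) 3).ne'

lemma smoothSign_le_one (hδ : 0 < δ) : smoothSign δ t ≤ 1 := by
  have h0 : 0 < t ^ 2 + δ ^ 2 := by positivity
  rw [smoothSign, ← div_eq_mul_inv, div_le_one (Real.sqrt_pos.2 h0)]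
  exact Real.le_sqrt_of_sq_le (by nlinarith)

lemma smoothSign_nonneg (ht : 0 ≤ t) : 0 ≤ smoothSign δ t := by
  unfold smoothSign
  positivity

lemma mul_smoothSignDeriv_le_one (hδ : 0 < δ) : t * smoothSignDeriv δ t ≤ 1 := by
  have h0 : 0 < t ^ 2 + δ ^ 2 := by positivity
  have h1 : 0 < √(t ^ 2 + δ ^ 2) := Real.sqrt_pos.2 h0
  have h2 : √(t ^ 2 + δ ^ 2) ^ 2 = t ^ 2 + δ ^ 2 := Real.sq_sqrt h0.le
  have h3 : t ≤ √(t ^ 2 + δ ^ 2) := Real.le_sqrt_of_sq_le (by nlinarith)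
  rw [smoothSignDeriv, ← mul_assoc, ← div_eq_mul_inv, div_le_one (by positivity)]
  calc t * δ ^ 2 ≤ √(t ^ 2 + δ ^ 2) * √(t ^ 2 + δ ^ 2) ^ 2 :=
        mul_le_mul h3 (by nlinarith) (by positivity) h1.le
    _ = √(t ^ 2 + δ ^ 2) ^ 3 := by ring

lemma smoothSignDeriv_le (ht : 1 / 2 ≤ t) : smoothSignDeriv δ t ≤ 8 * δ ^ 2 := by
  have h3 : 1 / 2 ≤ √(t ^ 2 + δ ^ 2) := Real.le_sqrt_of_sq_le (by nlinarith [sq_nonneg δ])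
  have h4 : (1 / 2) ^ 3 ≤ √(t ^ 2 + δ ^ 2) ^ 3 := pow_le_pow_left₀ (by norm_num) h3 3
  have h5 : (√(t ^ 2 + δ ^ 2) ^ 3)⁻¹ ≤ 8 := by
    refine (inv_anti₀ (by norm_num) h4).trans (by norm_num)
  rw [smoothSignDeriv, mul_comm]
  exact mul_le_mul_of_nonneg_right h5 (sq_nonneg δ)

lemma tendsto_smoothSign (ht : 0 < t) :
    Tendsto (fun n : ℕ => smoothSign (1 / ((n : ℝ) + 1)) t) atTop (𝓝 1) := by
  have h3 : Tendsto (fun n : ℕ => t ^ 2 + (1 / ((n : ℝ) + 1)) ^ 2) atTop (𝓝 (t ^ 2 + 0 ^ 2)) :=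
    (tendsto_one_div_add_atTop_nhds_zero_nat.pow 2).const_add _
  have h4 := h3.sqrt
  rw [zero_pow two_ne_zero, add_zero, Real.sqrt_sq ht.le] at h4
  simpa [smoothSign, ht.ne'] using (h4.inv₀ ht.ne').const_mul t

lemma tendsto_smoothSignDeriv (ht : 0 < t) :
    Tendsto (fun n : ℕ => smoothSignDeriv (1 / ((n : ℝ) + 1)) t) atTop (𝓝 0) := by
  have h2 : Tendsto (fun n : ℕ => (1 / ((n : ℝ) + 1)) ^ 2) atTop (𝓝 (0 ^ 2)) :=
    tendsto_one_div_add_atTop_nhds_zero_nat.pow 2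
  have h4 := (h2.const_add (t ^ 2)).sqrt
  rw [zero_pow two_ne_zero, add_zero, Real.sqrt_sq ht.le] at h4
  rw [zero_pow two_ne_zero] at h2
  simpa [smoothSignDeriv] using h2.mul ((h4.pow 3).inv₀ (by positivity))

end Kernel

lemma trace_graphMetric_inv_mul_fromRows (D : Matrix κ ι ℝ) (a b : ℝ) (x : ι → ℝ) :
    ((graphMetric D)⁻¹ * (graphFrame D)ᵀ * 
      fromRows (a • (1 : Matrix ι ι ℝ) - b • vecMulVec x x) (0 : Matrix κ ι ℝ)).trace =
      a * ((graphMetric D)⁻¹).trace - b * (x ⬝ᵥ (graphMetric D)⁻¹ *ᵥ x) := by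
  rw [Matrix.mul_assoc, graphFrame, transpose_fromRows, fromCols_mul_fromRows, Matrix.mul_zero,
    add_zero, transpose_one, Matrix.one_mul, Matrix.mul_sub, trace_sub, Matrix.mul_smul,
    Matrix.mul_smul, trace_smul, trace_smul, Matrix.mul_one, mul_vecMulVec, trace_vecMulVec,
    dotProduct_comm]
  rfl

lemma IsStationaryGraph.integral_smoothSign [Nonempty ι] (hS : IsStationaryGraph F)
    (hF : LipschitzWith K F) {δ : ℝ} (hδ : 0 < δ) :
    IntegrableOn (fun x => graphDensity (jacobian F x) *
      (smoothSign δ (1 - ‖x‖ ^ 2) * ((graphMetric (jacobian F x))⁻¹).trace -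
        2 * smoothSignDeriv δ (1 - ‖x‖ ^ 2) *
          (x.ofLp ⬝ᵥ (graphMetric (jacobian F x))⁻¹ *ᵥ x.ofLp))) (ball 0 1) ∧
    ∫ x in ball 0 1, graphDensity (jacobian F x) *
      (smoothSign δ (1 - ‖x‖ ^ 2) * ((graphMetric (jacobian F x))⁻¹).trace -
        2 * smoothSignDeriv δ (1 - ‖x‖ ^ 2) *
          (x.ofLp ⬝ᵥ (graphMetric (jacobian F x))⁻¹ *ᵥ x.ofLp)) = 0 := by
  have h1 : ContDiff ℝ 1 fun p : EuclideanSpace ℝ ι × EuclideanSpace ℝ κ =>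
      pairVec (smoothSign δ (1 - ‖p.1‖ ^ 2) • p.1) (0 : EuclideanSpace ℝ κ) :=
    (contDiff_pairVec 1).comp ((((contDiff_smoothSign hδ).comp (contDiff_const.sub
      (contDiff_fst.norm_sq ℝ))).smul contDiff_fst).prodMk contDiff_const)
  obtain ⟨C, hC⟩ := exists_lipschitzOnWith_comp_graph h1 hF
  have h2 := hS.integral_trace_eq_zero hF hC (fun x hx => ?_) (B := fun x =>
    fromRows (smoothSign δ (1 - ‖x‖ ^ 2) • (1 : Matrix ι ι ℝ) -
      (2 * smoothSignDeriv δ (1 - ‖x‖ ^ 2)) • vecMulVec x.ofLp x.ofLp) (0 : Matrix κ ι ℝ))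
    fun x hx hd a i => ?_
  · simpa only [trace_graphMetric_inv_mul_fromRows] using h2
  · have hx1 : ‖x‖ = 1 := by simpa using hx
    ext a
    rcases a with a | a <;> simp [pairVec, hx1, smoothSign]
  · rcases a with a | a
    · have h3 : HasFDerivAt (fun y : EuclideanSpace ℝ ι => 1 - ‖y‖ ^ 2) _ x :=
        ((hasStrictFDerivAt_norm_sq x).hasFDerivAt.const_sub 1)
      have h4 := ((hasDerivAt_smoothSign hδ _).comp_hasFDerivAt x h3).mul
        (EuclideanSpace.proj a : EuclideanSpace ℝ ι →L[ℝ] ℝ).hasFDerivAt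
      have h5 : HasFDerivAt (fun y => pairVec (smoothSign δ (1 - ‖y‖ ^ 2) • y)
        (0 : EuclideanSpace ℝ κ) (Sum.inl a)) _ x := h4
      rw [h5.fderiv]
      simp [Matrix.one_apply, vecMulVec_apply, EuclideanSpace.inner_single_right]
      split_ifs <;> ring
    · have h5 : (fun y : EuclideanSpace ℝ ι => pairVec (smoothSign δ (1 - ‖y‖ ^ 2) • y)
        (0 : EuclideanSpace ℝ κ) (Sum.inr a)) = fun _ => 0 := rfl
      rw [h5]
      simp

lemma isStationaryGraph_zero :
    IsStationaryGraph (0 : EuclideanSpace ℝ ι → EuclideanSpace ℝ κ) := by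
  intro φ hφ hc ht a
  have h1 : ∀ x, jacobian (0 : EuclideanSpace ℝ ι → EuclideanSpace ℝ κ) x = 0 := fun x => by
    ext a i
    simp [jacobian_apply]
  have h2 : graphMetric (0 : Matrix κ ι ℝ) = 1 := by simp [graphMetric]
  have h3 : graphDensity (0 : Matrix κ ι ℝ) = 1 := by simp [graphDensity, h2]
  simp only [h1, h2, h3, inv_one, Matrix.mul_one, one_mul]
  rcases a with a | a
  · have h4 : ∀ i, graphFrame (0 : Matrix κ ι ℝ) (Sum.inl a) i = if a = i then 1 else 0 :=
      fun i => Matrix.one_apply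
    simp only [h4, ite_mul, one_mul, zero_mul, Finset.sum_ite_eq, Finset.mem_univ, if_true]
    have h5 : Integrable fun x => fderiv ℝ φ x (EuclideanSpace.single a 1) :=
      ((hφ.continuous_fderiv (by simp)).clm_apply continuous_const).integrable_of_hasCompactSupport
        (hc.fderiv_apply ℝ _)
    rw [setIntegral_eq_integral_of_forall_compl_eq_zero fun x hx => ?_]
    · have h6 := integral_smul_fderiv_eq_neg_fderiv_smul_of_integrable (𝕜 := ℝ) (μ := volume)
        (f := fun _ : EuclideanSpace ℝ ι => (1 : ℝ)) (g := φ) (v := EuclideanSpace.single a 1)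
        (by simp) (by simpa using h5)
        (by simpa using hφ.continuous.integrable_of_hasCompactSupport hc)
        (by simp) (fun x _ => hφ.differentiable (by simp) x)
      simpa using h6
    · have h7 : x ∉ tsupport φ := fun h => hx (ht h)
      have h8 : φ =ᶠ[𝓝 x] fun _ => 0 := notMem_tsupport_iff_eventuallyEq.1 h7
      simp [h8.fderiv_eq]
  · have h4 : ∀ i, graphFrame (0 : Matrix κ ι ℝ) (Sum.inr a) i = 0 := fun i => rfl
    simp [h4]

end FluxIdentity

section AreaUpperBound

open Matrix Metric Filter Topology

open scoped NNReal

variable {ι κ : Type*} [Fintype ι] [DecidableEq ι] [Fintype κ] [DecidableEq κ]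
  {f F : EuclideanSpace ℝ ι → EuclideanSpace ℝ κ} {K : ℝ≥0}

lemma IsCompact.exists_le_add_mul {X : Type*} [TopologicalSpace X] {s : Set X} (hs : IsCompact s)
    {q e : X → ℝ} (hq : ContinuousOn q s) (he : ContinuousOn e s) (he0 : ∀ x ∈ s, 0 ≤ e x)
    {J : ℝ} (h : ∀ x ∈ s, e x = 0 → q x ≤ J) :
    ∃ C : ℝ, 0 ≤ C ∧ ∀ x ∈ s, q x ≤ J + 1 + C * e x := by
  have hT : IsCompact (s ∩ q ⁻¹' Set.Ici (J + 1)) := by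
    obtain ⟨t, ht, hst⟩ := (continuousOn_iff_isClosed.1 hq) _ (isClosed_Ici (a := J + 1))
    rw [Set.inter_comm, hst, Set.inter_comm]
    exact hs.inter_right ht
  rcases (s ∩ q ⁻¹' Set.Ici (J + 1)).eq_empty_or_nonempty with hempty | hne
  · refine ⟨0, le_rfl, fun x hx => ?_⟩
    by_contra! hlt
    have : x ∈ s ∩ q ⁻¹' Set.Ici (J + 1) := ⟨hx, by
      have : J + 1 < q x := by linarith
      exact this.le⟩
    rw [hempty] at this
    exact this
  · obtain ⟨x₀, hx₀, hmin⟩ := hT.exists_isMinOn hne (he.mono Set.inter_subset_left)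
    obtain ⟨M, hM⟩ := hT.exists_bound_of_continuousOn (hq.mono Set.inter_subset_left)
    have he₀ : 0 < e x₀ := lt_of_le_of_ne (he0 _ hx₀.1) fun h0 => by
      have h1 : J + 1 ≤ q x₀ := hx₀.2
      linarith [h _ hx₀.1 h0.symm]
    have hM0 : 0 ≤ M := (norm_nonneg _).trans (hM _ hx₀)
    have hC : 0 ≤ (M + |J + 1|) / e x₀ := by positivity
    refine ⟨(M + |J + 1|) / e x₀, hC, fun x hx => ?_⟩
    rcases le_total (q x) (J + 1) with hle | hge
    · have := mul_nonneg hC (he0 x hx)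
      linarith
    · have hxT : x ∈ s ∩ q ⁻¹' Set.Ici (J + 1) := ⟨hx, hge⟩
      have h1 : e x₀ ≤ e x := hmin hxT
      have h2 : q x ≤ M := (le_abs_self _).trans (hM x hxT)
      have h3 : M + |J + 1| ≤ (M + |J + 1|) / e x₀ * e x := by
        rw [div_mul_eq_mul_div, le_div_iff₀ he₀]
        exact mul_le_mul_of_nonneg_left h1 (by positivity)
      linarith [neg_abs_le (J + 1)]

lemma unitVec_unitVec {x : EuclideanSpace ℝ ι} (hx : x ≠ 0) : unitVec (unitVec x) = unitVec x :=
  unitVec_of_norm_eq_one (norm_unitVec hx)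

/-- Where the graph of `F` is nearly tangent to the boundary graph of `f`, the radial flux is at
most the area density of that boundary graph. -/
lemma exists_radial_flux_le (f : EuclideanSpace ℝ ι → EuclideanSpace ℝ κ)
    (hf : ∀ x ∈ sphere 0 1, ContDiffAt ℝ 2 f x) (L : ℝ) {J : ℝ}
    (hJ : ∀ x ∈ sphere 0 1, √(1 + tanJacobian f x * (tanJacobian f x)ᵀ).det ≤ J) :
    ∃ C : ℝ, 0 ≤ C ∧ ∀ x ∈ sphere (0 : EuclideanSpace ℝ ι) 1, ∀ D : Matrix κ ι ℝ,
      (∀ a i, |D a i| ≤ L) → graphDensity D * (x.ofLp ⬝ᵥ (graphMetric D)⁻¹ *ᵥ x.ofLp) ≤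
        J + 1 + C * (graphDensity D * ((coneProj f x * graphProj D).trace - 1)) := by
  have hcomp := (isCompact_sphere (0 : EuclideanSpace ℝ ι) 1).prod
    (isCompact_setOf_abs_apply_le (κ := κ) (ι := ι) L)
  have hcone : ∀ a b, ContinuousOn (fun p : EuclideanSpace ℝ ι × Matrix κ ι ℝ =>
      coneProj f p.1 a b) (sphere (0 : EuclideanSpace ℝ ι) 1 ×ˢ
        {D : Matrix κ ι ℝ | ∀ a i, |D a i| ≤ L}) := fun a b p hp => by
    have h1 : ‖p.1‖ = 1 := by simpa using hp.1
    have h0 : p.1 ≠ 0 := norm_ne_zero_iff.1 (by rw [h1]; exact one_ne_zero)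
    have h2 : ContinuousAt (fun x => coneProj f x a b) p.1 :=
      (contDiffAt_coneProj_apply h0 (hf _ (by simp [norm_unitVec h0])) a b).continuousAt
    exact (h2.comp (f := Prod.fst) continuous_fst.continuousAt).continuousWithinAt
  have hmain := hcomp.exists_le_add_mul (J := J)
    (q := fun p => graphDensity p.2 * (p.1.ofLp ⬝ᵥ (graphMetric p.2)⁻¹ *ᵥ p.1.ofLp))
    (e := fun p => graphDensity p.2 * ((coneProj f p.1 * graphProj p.2).trace - 1)) ?_ ?_ ?_ ?_
  · obtain ⟨C, hC0, hC⟩ := hmain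
    exact ⟨C, hC0, fun x hx D hD => hC (x, D) ⟨hx, hD⟩⟩
  · refine Continuous.continuousOn ((continuous_graphDensity.comp continuous_snd).mul ?_)
    have h1 : Continuous fun p : EuclideanSpace ℝ ι × Matrix κ ι ℝ => p.1.ofLp :=
      (PiLp.continuous_ofLp 2 _).comp continuous_fst
    exact h1.dotProduct ((continuous_graphMetric_inv.comp continuous_snd).matrix_mulVec h1)
  · refine (continuous_graphDensity.comp continuous_snd).continuousOn.mul
      (ContinuousOn.sub ?_ continuousOn_const)
    exact continuousOn_finsetSum _ fun a _ => continuousOn_finsetSum _ fun b _ =>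
      (hcone a b).mul ((continuous_graphProj.matrix_elem b a).comp continuous_snd).continuousOn
  · intro p hp
    have h1 : ‖p.1‖ = 1 := by simpa using hp.1
    have h0 : p.1 ≠ 0 := norm_ne_zero_iff.1 (by rw [h1]; exact one_ne_zero)
    exact mul_nonneg (graphDensity_pos _).le (sub_nonneg.2
      (one_le_trace_normalProj_mul (unitVec_dotProduct_self h0) (tanJacobian_mulVec h0) _))
  · intro p hp he
    have h1 : ‖p.1‖ = 1 := by simpa using hp.1
    have h0 : p.1 ≠ 0 := norm_ne_zero_iff.1 (by rw [h1]; exact one_ne_zero)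
    have h2 : (coneProj f p.1 * graphProj p.2).trace = 1 :=
      sub_eq_zero.1 ((mul_eq_zero.1 he).resolve_left (graphDensity_pos _).ne')
    have h3 := mul_one_sub_eq_of_trace_eq_one (unitVec_dotProduct_self h0)
      (tanJacobian_mulVec h0) h2
    have h4 := graphDensity_mul_quadratic_le (unitVec_dotProduct_self h0) h3
    rw [unitVec_of_norm_eq_one h1] at h4
    exact h4.trans (hJ _ hp.1)

lemma exists_radial_flux_le_of_lipschitz (hF : LipschitzWith K F)
    (hf : ∀ x ∈ sphere 0 1, ContDiffAt ℝ 2 f x) {J : ℝ}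
    (hJ : ∀ x ∈ sphere 0 1, √(1 + tanJacobian f x * (tanJacobian f x)ᵀ).det ≤ J) :
    ∃ C : ℝ, 0 ≤ C ∧ ∀ x ∈ ball (0 : EuclideanSpace ℝ ι) 1, x ≠ 0 →
      graphDensity (jacobian F x) *
        (x.ofLp ⬝ᵥ (graphMetric (jacobian F x))⁻¹ *ᵥ x.ofLp) ≤
        (J + 1) * ‖x‖ ^ 2 + C * coneExcess f F x := by
  obtain ⟨C, hC0, hC⟩ := exists_radial_flux_le f hf K hJ
  refine ⟨C, hC0, fun x hx hx0 => ?_⟩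
  have h1 := hC (unitVec x) (by simp [norm_unitVec hx0]) _ (abs_jacobian_le hF x)
  have h2 : coneProj f (unitVec x) = coneProj f x := by
    rw [coneProj, coneProj, tanJacobian, tanJacobian, unitVec_unitVec hx0]
  rw [h2] at h1
  have h3 : x.ofLp = ‖x‖ • (unitVec x).ofLp := by
    conv_lhs => rw [← norm_smul_unitVec hx0]
    rfl
  have h4 : x.ofLp ⬝ᵥ (graphMetric (jacobian F x))⁻¹ *ᵥ x.ofLp = ‖x‖ ^ 2 *
      ((unitVec x).ofLp ⬝ᵥ (graphMetric (jacobian F x))⁻¹ *ᵥ (unitVec x).ofLp) := by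
    conv_lhs => rw [h3]
    rw [mulVec_smul, smul_dotProduct, dotProduct_smul, smul_eq_mul, smul_eq_mul]
    ring
  have h5 : ‖x‖ ^ 2 ≤ 1 := pow_le_one₀ (norm_nonneg _) (by simpa using (mem_ball.1 hx).le)
  have h6 := mul_nonneg hC0 (coneExcess_nonneg (f := f) (F := F) hx0)
  rw [h4]
  have h7 := mul_le_mul_of_nonneg_left h1 (sq_nonneg ‖x‖)
  have h8 : ‖x‖ ^ 2 * (C * coneExcess f F x) ≤ C * coneExcess f F x := mul_le_of_le_one_left h6 h5
  have h9 : coneExcess f F x = graphDensity (jacobian F x) *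
      ((coneProj f x * graphProj (jacobian F x)).trace - 1) := rfl
  rw [← h9] at h7
  linarith

end AreaUpperBound

section AreaLimit

open Matrix Metric Filter Topology

open scoped NNReal

variable {ι κ : Type*} [Fintype ι] [DecidableEq ι] [Fintype κ] [DecidableEq κ]
  {f F : EuclideanSpace ℝ ι → EuclideanSpace ℝ κ} {K : ℝ≥0}

lemma integrableOn_ball_of_continuous {φ : EuclideanSpace ℝ ι → ℝ} (hφ : Continuous φ) :
    IntegrableOn φ (ball 0 1) :=
  (hφ.continuousOn.integrableOn_compact (isCompact_closedBall 0 1)).mono_set ball_subset_closedBall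

lemma continuous_smoothSign_one_sub {δ : ℝ} (hδ : 0 < δ) :
    Continuous fun x : EuclideanSpace ℝ ι => smoothSign δ (1 - ‖x‖ ^ 2) :=
  (contDiff_smoothSign hδ).continuous.comp (continuous_const.sub (continuous_norm.pow 2))

lemma continuous_smoothSignDeriv_one_sub {δ : ℝ} (hδ : 0 < δ) :
    Continuous fun x : EuclideanSpace ℝ ι => smoothSignDeriv δ (1 - ‖x‖ ^ 2) :=
  (continuous_smoothSignDeriv hδ).comp (continuous_const.sub (continuous_norm.pow 2))

lemma integral_smoothSignDeriv_mul_le [Nonempty ι] {δ : ℝ} (hδ : 0 < δ) :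
    ∫ x in ball (0 : EuclideanSpace ℝ ι) 1, 2 * smoothSignDeriv δ (1 - ‖x‖ ^ 2) * ‖x‖ ^ 2 ≤
      Fintype.card ι * volume.real (ball (0 : EuclideanSpace ℝ ι) 1) := by
  have h1 : ∀ x, jacobian (0 : EuclideanSpace ℝ ι → EuclideanSpace ℝ ι) x = 0 := fun x => by
    ext a i
    simp [jacobian_apply]
  have h2 : graphMetric (0 : Matrix ι ι ℝ) = 1 := by simp [graphMetric]
  have h3 : graphDensity (0 : Matrix ι ι ℝ) = 1 := by simp [graphDensity, h2]
  have h4 := ((isStationaryGraph_zero (ι := ι) (κ := ι)).integral_smoothSign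
    (LipschitzWith.const 0) hδ).2
  simp only [h1, h2, h3, inv_one, one_mul, one_mulVec, trace_one, dotProduct_ofLp_self] at h4
  have hc1 := continuous_smoothSign_one_sub (ι := ι) hδ
  have hc2 := continuous_smoothSignDeriv_one_sub (ι := ι) hδ
  have hi1 : IntegrableOn (fun x : EuclideanSpace ℝ ι =>
      smoothSign δ (1 - ‖x‖ ^ 2) * (Fintype.card ι : ℝ)) (ball 0 1) :=
    integrableOn_ball_of_continuous (hc1.mul continuous_const)
  have hi2 : IntegrableOn (fun x : EuclideanSpace ℝ ι =>
      2 * smoothSignDeriv δ (1 - ‖x‖ ^ 2) * ‖x‖ ^ 2) (ball 0 1) :=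
    integrableOn_ball_of_continuous (by fun_prop)
  rw [integral_sub hi1 hi2, sub_eq_zero] at h4
  rw [← h4]
  calc _ ≤ ∫ _x in ball (0 : EuclideanSpace ℝ ι) 1, (Fintype.card ι : ℝ) :=
        setIntegral_mono hi1
          (integrableOn_const measure_ball_lt_top.ne) fun x =>
            mul_le_of_le_one_left (Nat.cast_nonneg _) (smoothSign_le_one hδ)
    _ = _ := by rw [setIntegral_const, smul_eq_mul, mul_comm]

lemma exists_abs_radial_flux_le (hF : LipschitzWith K F) :
    ∃ M : ℝ, 0 ≤ M ∧ ∀ x ∈ ball (0 : EuclideanSpace ℝ ι) 1, graphDensity (jacobian F x) *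
      (x.ofLp ⬝ᵥ (graphMetric (jacobian F x))⁻¹ *ᵥ x.ofLp) ≤ M := by
  have h1 : Continuous fun p : EuclideanSpace ℝ ι × Matrix κ ι ℝ => p.1.ofLp :=
    (PiLp.continuous_ofLp 2 _).comp continuous_fst
  have h2 : Continuous fun p : EuclideanSpace ℝ ι × Matrix κ ι ℝ =>
      graphDensity p.2 * (p.1.ofLp ⬝ᵥ (graphMetric p.2)⁻¹ *ᵥ p.1.ofLp) :=
    (continuous_graphDensity.comp continuous_snd).mul
      (h1.dotProduct ((continuous_graphMetric_inv.comp continuous_snd).matrix_mulVec h1))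
  obtain ⟨M, hM⟩ := ((isCompact_closedBall (0 : EuclideanSpace ℝ ι) 1).prod
    (isCompact_setOf_abs_apply_le (κ := κ) (ι := ι) K)).exists_bound_of_continuousOn h2.continuousOn
  refine ⟨|M|, abs_nonneg M, fun x hx => ?_⟩
  exact (le_abs_self _).trans ((hM (x, jacobian F x)
    ⟨ball_subset_closedBall hx, abs_jacobian_le hF x⟩).trans (le_abs_self M))

/-- As the scale tends to zero, the tilt of the graph near the boundary does not contribute to the
radial flux. -/
lemma IsStationaryGraph.tendsto_integral_coneExcess [Nonempty ι] (hS : IsStationaryGraph F)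
    (hF : LipschitzWith K F) (hf : ∀ x ∈ sphere 0 1, ContDiffAt ℝ 2 f x)
    (hb : ∀ x ∈ sphere 0 1, F x = f x) :
    (∀ n : ℕ, IntegrableOn (fun x => (1 - ‖x‖ ^ 2) *
      smoothSignDeriv (1 / ((n : ℝ) + 1)) (1 - ‖x‖ ^ 2) * (coneExcess f F x / (1 - ‖x‖)))
        (outerShell ι)) ∧
    Tendsto (fun n : ℕ => ∫ x in outerShell ι, (1 - ‖x‖ ^ 2) *
      smoothSignDeriv (1 / ((n : ℝ) + 1)) (1 - ‖x‖ ^ 2) * (coneExcess f F x / (1 - ‖x‖)))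
        atTop (𝓝 0) := by
  have hi := hS.integrableOn_coneExcess_div hF hf hb
  have hm : ∀ n : ℕ, AEStronglyMeasurable (fun x => (1 - ‖x‖ ^ 2) *
      smoothSignDeriv (1 / ((n : ℝ) + 1)) (1 - ‖x‖ ^ 2) * (coneExcess f F x / (1 - ‖x‖)))
        (volume.restrict (outerShell ι)) := fun n => by
    have h1 := continuous_smoothSignDeriv_one_sub (ι := ι) (δ := 1 / ((n : ℝ) + 1)) (by positivity)
    exact ((continuous_const.sub (continuous_norm.pow 2)).mul h1).aestronglyMeasurable.mul
      hi.aestronglyMeasurable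
  have ht : ∀ x ∈ outerShell ι, 0 < 1 - ‖x‖ ^ 2 ∧ 0 < 1 - ‖x‖ := fun x hx => by
    have h1 : ‖x‖ < 1 := by simpa using hx.1
    exact ⟨by nlinarith [norm_nonneg x], by linarith⟩
  have hle : ∀ n : ℕ, ∀ᵐ x ∂volume.restrict (outerShell ι), ‖(1 - ‖x‖ ^ 2) *
      smoothSignDeriv (1 / ((n : ℝ) + 1)) (1 - ‖x‖ ^ 2) * (coneExcess f F x / (1 - ‖x‖))‖ ≤
        coneExcess f F x / (1 - ‖x‖) := fun n => by
    filter_upwards [ae_restrict_mem measurableSet_outerShell] with x hx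
    have h1 : 0 ≤ coneExcess f F x / (1 - ‖x‖) :=
      div_nonneg (coneExcess_nonneg (ne_zero_of_mem_outerShell hx)) (ht x hx).2.le
    rw [Real.norm_of_nonneg (mul_nonneg (mul_nonneg (ht x hx).1.le smoothSignDeriv_nonneg) h1)]
    exact mul_le_of_le_one_left h1 (mul_smoothSignDeriv_le_one (by positivity))
  refine ⟨fun n => hi.mono' (hm n) (hle n), ?_⟩
  have h1 := tendsto_integral_of_dominated_convergence (f := fun _ => (0 : ℝ)) _ hm hi hle ?_
  · simpa using h1
  · filter_upwards [ae_restrict_mem measurableSet_outerShell] with x hx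
    simpa using ((tendsto_smoothSignDeriv (ht x hx).1).const_mul (1 - ‖x‖ ^ 2)).mul_const
      (coneExcess f F x / (1 - ‖x‖))

theorem IsStationaryGraph.integral_graphDensity_le [Nonempty ι]
    (hcard : Fintype.card κ < Fintype.card ι) (hS : IsStationaryGraph F)
    (hF : LipschitzWith K F) (hf : ∀ x ∈ sphere 0 1, ContDiffAt ℝ 2 f x)
    (hb : ∀ x ∈ sphere 0 1, F x = f x) {J : ℝ} (hJ0 : 0 ≤ J)
    (hJ : ∀ x ∈ sphere 0 1, √(1 + tanJacobian f x * (tanJacobian f x)ᵀ).det ≤ J) :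
    ∫ x in ball 0 1, graphDensity (jacobian F x) ≤
      (J + 1) * (Fintype.card ι * volume.real (ball (0 : EuclideanSpace ℝ ι) 1)) := by
  set B := ball (0 : EuclideanSpace ℝ ι) 1 with hB
  obtain ⟨C, hC0, hC⟩ := exists_radial_flux_le_of_lipschitz hF hf hJ
  obtain ⟨M, hM0, hM⟩ := exists_abs_radial_flux_le hF
  obtain ⟨hEi, hEt⟩ := hS.tendsto_integral_coneExcess hF hf hb
  set τ : EuclideanSpace ℝ ι → ℝ := fun x =>
    graphDensity (jacobian F x) * ((graphMetric (jacobian F x))⁻¹).trace with hτ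
  set fl : EuclideanSpace ℝ ι → ℝ := fun x => graphDensity (jacobian F x) *
    (x.ofLp ⬝ᵥ (graphMetric (jacobian F x))⁻¹ *ᵥ x.ofLp) with hfl
  have hτc : Continuous fun D : Matrix κ ι ℝ => graphDensity D * ((graphMetric D)⁻¹).trace :=
    continuous_graphDensity.mul continuous_graphMetric_inv.matrix_trace
  have hτm : Measurable τ := measurable_comp_jacobian F hτc
  obtain ⟨Mτ, hMτ⟩ := exists_abs_comp_jacobian_le hF hτc
  have hτi : IntegrableOn τ B := Measure.integrableOn_of_bounded (M := Mτ) measure_ball_lt_top.ne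
    hτm.aestronglyMeasurable (Eventually.of_forall hMτ)
  set δ : ℕ → ℝ := fun n => 1 / ((n : ℝ) + 1) with hδ
  have hδ0 : ∀ n, 0 < δ n := fun n => by rw [hδ]; positivity
  set θ : ℕ → EuclideanSpace ℝ ι → ℝ := fun n x => smoothSign (δ n) (1 - ‖x‖ ^ 2) with hθ
  set θ' : ℕ → EuclideanSpace ℝ ι → ℝ := fun n x => smoothSignDeriv (δ n) (1 - ‖x‖ ^ 2) with hθ'
  set e : ℕ → EuclideanSpace ℝ ι → ℝ := fun n x =>
    (1 - ‖x‖ ^ 2) * θ' n x * (coneExcess f F x / (1 - ‖x‖)) with he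
  have ht0 : ∀ x ∈ B, 0 < 1 - ‖x‖ ^ 2 := fun x hx => by
    have h1 : ‖x‖ < 1 := by simpa [hB] using hx
    nlinarith [norm_nonneg x]
  have hθ1 : ∀ n, ∀ x ∈ B, 0 ≤ θ n x ∧ θ n x ≤ 1 := fun n x hx =>
    ⟨smoothSign_nonneg (ht0 x hx).le, smoothSign_le_one (hδ0 n)⟩
  have hθle : ∀ n, ∀ᵐ x ∂volume.restrict B, ‖θ n x * τ x‖ ≤ Mτ := fun n => by
    filter_upwards [ae_restrict_mem measurableSet_ball] with x hx
    rw [norm_mul, Real.norm_of_nonneg (hθ1 n x hx).1]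
    exact (mul_le_of_le_one_left (norm_nonneg _) (hθ1 n x hx).2).trans (hMτ x)
  have hθm : ∀ n, AEStronglyMeasurable (fun x => θ n x * τ x) (volume.restrict B) := fun n =>
    (continuous_smoothSign_one_sub (hδ0 n)).aestronglyMeasurable.mul hτm.aestronglyMeasurable
  have hMi : IntegrableOn (fun _ => Mτ) B := integrableOn_const measure_ball_lt_top.ne
  have hθi : ∀ n, IntegrableOn (fun x => θ n x * τ x) B := fun n => hMi.mono' (hθm n) (hθle n)
  have hid : ∀ n, IntegrableOn (fun x => 2 * θ' n x * fl x) B ∧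
      ∫ x in B, θ n x * τ x = ∫ x in B, 2 * θ' n x * fl x := fun n => by
    obtain ⟨h1, h2⟩ := hS.integral_smoothSign hF (hδ0 n)
    have h3 : (fun x => graphDensity (jacobian F x) *
      (smoothSign (δ n) (1 - ‖x‖ ^ 2) * ((graphMetric (jacobian F x))⁻¹).trace -
        2 * smoothSignDeriv (δ n) (1 - ‖x‖ ^ 2) *
          (x.ofLp ⬝ᵥ (graphMetric (jacobian F x))⁻¹ *ᵥ x.ofLp))) =
        fun x => θ n x * τ x - 2 * θ' n x * fl x := by
      funext x
      simp only [hθ, hθ', hτ, hfl]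
      ring
    rw [h3] at h1 h2
    have h4 : IntegrableOn (fun x => 2 * θ' n x * fl x) B := by
      refine ((hθi n).sub h1).congr (Eventually.of_forall fun x => ?_)
      simp
    rw [integral_sub (hθi n) h4, sub_eq_zero] at h2
    exact ⟨h4, h2⟩
  have hθ'i : ∀ n, IntegrableOn (fun x => 2 * θ' n x * ‖x‖ ^ 2) B := fun n =>
    integrableOn_ball_of_continuous
      ((continuous_const.mul (continuous_smoothSignDeriv_one_sub (hδ0 n))).mul
        (continuous_norm.pow 2))
  have heB : ∀ n, IntegrableOn ((outerShell ι).indicator (e n)) B := fun n =>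
    ((integrable_indicator_iff measurableSet_outerShell).2 (hEi n)).integrableOn
  have hle : ∀ n, ∫ x in B, θ n x * τ x ≤
      (J + 1) * (Fintype.card ι * volume.real B) + 2 * C * (∫ x in outerShell ι, e n x) +
        16 * M * volume.real B * δ n ^ 2 := fun n => by
    have hi1 := (hθ'i n).const_mul (J + 1)
    have hi2 := (heB n).const_mul (2 * C)
    have hi3 : IntegrableOn (fun _ => 16 * M * δ n ^ 2) B :=
      integrableOn_const measure_ball_lt_top.ne
    have hi12 : IntegrableOn (fun x => (J + 1) * (2 * θ' n x * ‖x‖ ^ 2) +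
        2 * C * (outerShell ι).indicator (e n) x) B := hi1.add hi2
    have h1 : ∫ x in B, 2 * θ' n x * fl x ≤ ∫ x in B, ((J + 1) * (2 * θ' n x * ‖x‖ ^ 2) +
        2 * C * (outerShell ι).indicator (e n) x + 16 * M * δ n ^ 2) := by
      refine setIntegral_mono_on (hid n).1 (hi12.add hi3) measurableSet_ball
        fun x hx => ?_
      have h2 : 0 ≤ θ' n x := smoothSignDeriv_nonneg
      have h3 : 0 ≤ 16 * M * δ n ^ 2 := by positivity
      have h4 : 0 ≤ (J + 1) * (2 * θ' n x * ‖x‖ ^ 2) := by positivity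
      by_cases hxS : x ∈ outerShell ι
      · rw [Set.indicator_of_mem hxS]
        have hx0 := ne_zero_of_mem_outerShell hxS
        have h5 : 0 < 1 - ‖x‖ := by
          have : ‖x‖ < 1 := by simpa [hB] using hx
          linarith
        have h6 := coneExcess_nonneg (f := f) (F := F) hx0
        have h7 : coneExcess f F x ≤ (1 - ‖x‖ ^ 2) * (coneExcess f F x / (1 - ‖x‖)) := by
          rw [← mul_div_assoc, le_div_iff₀ h5]
          nlinarith [mul_nonneg h6 (mul_nonneg (norm_nonneg x) h5.le)]
        have h8 : θ' n x * coneExcess f F x ≤ e n x := by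
          rw [he]
          calc _ ≤ θ' n x * ((1 - ‖x‖ ^ 2) * (coneExcess f F x / (1 - ‖x‖))) :=
                mul_le_mul_of_nonneg_left h7 h2
            _ = _ := by ring
        have h9 := mul_le_mul_of_nonneg_left (hC x hx hx0) h2
        have h10 := mul_le_mul_of_nonneg_left h8 hC0
        simp only [hfl]
        linarith
      · rw [Set.indicator_of_notMem hxS, mul_zero, add_zero]
        have h5 : ‖x‖ ^ 2 < 1 / 2 := by
          by_contra! h
          exact hxS ⟨hx, h⟩
        have h6 : θ' n x ≤ 8 * δ n ^ 2 := smoothSignDeriv_le (by linarith)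
        have h7 : 2 * θ' n x * fl x ≤ 2 * θ' n x * M :=
          mul_le_mul_of_nonneg_left (hM x hx) (by positivity)
        have h8 := mul_le_mul_of_nonneg_right h6 hM0
        linarith
    rw [(hid n).2]
    refine h1.trans ?_
    rw [integral_add hi12 hi3, integral_add hi1 hi2, integral_const_mul,
      integral_const_mul, setIntegral_const, setIntegral_indicator measurableSet_outerShell,
      Set.inter_eq_right.2 outerShell_subset_ball, smul_eq_mul]
    have h2 := mul_le_mul_of_nonneg_left (integral_smoothSignDeriv_mul_le (ι := ι) (hδ0 n))
      (by linarith : 0 ≤ J + 1)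
    linarith
  have hlim1 : Tendsto (fun n => ∫ x in B, θ n x * τ x) atTop (𝓝 (∫ x in B, τ x)) := by
    refine tendsto_integral_of_dominated_convergence _ hθm hMi hθle ?_
    filter_upwards [ae_restrict_mem measurableSet_ball] with x hx
    have h := (tendsto_smoothSign (ht0 x hx)).mul_const (τ x)
    rw [one_mul] at h
    exact h
  have hlim2 : Tendsto (fun n => (J + 1) * (Fintype.card ι * volume.real B) +
      2 * C * (∫ x in outerShell ι, e n x) + 16 * M * volume.real B * δ n ^ 2) atTop
      (𝓝 ((J + 1) * (Fintype.card ι * volume.real B) + 2 * C * 0 +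
        16 * M * volume.real B * 0 ^ 2)) :=
    ((hEt.const_mul (2 * C)).const_add _).add
      ((tendsto_one_div_add_atTop_nhds_zero_nat.pow 2).const_mul _)
  have h1 := le_of_tendsto_of_tendsto' hlim1 hlim2 hle
  have h2 : ∫ x in B, graphDensity (jacobian F x) ≤ ∫ x in B, τ x :=
    setIntegral_mono (integrableOn_graphDensity hF measure_ball_lt_top.ne) hτi fun x =>
      le_mul_of_one_le_right (graphDensity_pos _).le (one_le_trace_graphMetric_inv hcard _)
  simp only [mul_zero, zero_pow two_ne_zero, add_zero] at h1
  exact h2.trans h1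

end AreaLimit

section SphereValued

open Matrix Metric Filter Topology

variable {ι κ : Type*} [Fintype ι] [DecidableEq ι] [Fintype κ] [DecidableEq κ]
  {η : EuclideanSpace ℝ ι → EuclideanSpace ℝ κ}

lemma tanJacobian_smul {x : EuclideanSpace ℝ ι} (hη : DifferentiableAt ℝ η (unitVec x)) (R : ℝ) :
    tanJacobian (fun y => R • η y) x = R • tanJacobian η x := by
  have h : jacobian (fun y => R • η y) (unitVec x) = R • jacobian η (unitVec x) := by
    ext a i
    rw [jacobian_apply, fderiv_fun_const_smul hη]
    simp [jacobian_apply]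
  rw [tanJacobian, h, Matrix.smul_mul, tanJacobian]

lemma tanJacobian_transpose_mulVec (hunit : ∀ x ∈ sphere 0 1, ‖η x‖ = 1)
    {x : EuclideanSpace ℝ ι} (hx : x ∈ sphere 0 1) (hη : DifferentiableAt ℝ η x) :
    (tanJacobian η x)ᵀ *ᵥ (η x).ofLp = 0 := by
  have hx1 : ‖x‖ = 1 := by simpa using hx
  have hx0 : x ≠ 0 := norm_ne_zero_iff.1 (by rw [hx1]; exact one_ne_zero)
  have hu : unitVec x = x := unitVec_of_norm_eq_one hx1
  have hη' : DifferentiableAt ℝ η (unitVec x) := by rwa [hu]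
  have hd : DifferentiableAt ℝ (η ∘ unitVec) x :=
    hη'.comp x ((contDiffAt_unitVec (k := 1) hx0).differentiableAt one_ne_zero)
  have h1 := hd.hasFDerivAt.norm_sq
  have h2 : (fun y => ‖(η ∘ unitVec) y‖ ^ 2) =ᶠ[𝓝 x] fun _ => 1 := by
    filter_upwards [isOpen_ne.mem_nhds hx0] with y hy
    rw [Function.comp_apply, hunit _ (by simpa using norm_unitVec hy), one_pow]
  have h3 := h1.unique ((hasFDerivAt_const (1 : ℝ) x).congr_of_eventuallyEq h2)
  ext i
  have h4 := DFunLike.congr_fun h3 (EuclideanSpace.single i 1)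
  have h5 : jacobian (η ∘ unitVec) x = tanJacobian η x := by
    rw [jacobian_comp_unitVec hx0 hη', hx1, inv_one, one_smul]
  have h6 : ∀ a, fderiv ℝ (η ∘ unitVec) x (EuclideanSpace.single i 1) a = tanJacobian η x a i :=
    fun a => by rw [← h5, jacobian_apply]
  simp [PiLp.inner_apply, hu, h6] at h4
  simpa [mulVec, dotProduct] using h4

/-- The area density of the boundary graph `R • η` has order at most `R ^ m` when `η` is
sphere-valued. -/
theorem exists_boundary_density_le {m : ℕ} (hcard : Fintype.card κ = m + 1)
    (hη : ∀ x ∈ sphere 0 1, ContDiffAt ℝ 2 η x) (hunit : ∀ x ∈ sphere 0 1, ‖η x‖ = 1) :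
    ∃ A : ℝ, 0 ≤ A ∧ ∀ R : ℝ, 1 ≤ R → ∀ x ∈ sphere 0 1,
      √(1 + tanJacobian (fun y => R • η y) x * (tanJacobian (fun y => R • η y) x)ᵀ).det ≤
        A * R ^ m := by
  have hx1 : ∀ x ∈ sphere (0 : EuclideanSpace ℝ ι) 1, x ≠ 0 ∧ unitVec x = x := fun x hx => by
    have h1 : ‖x‖ = 1 := by simpa using hx
    exact ⟨norm_ne_zero_iff.1 (by rw [h1]; exact one_ne_zero), unitVec_of_norm_eq_one h1⟩
  have hS : ∀ a b, ContinuousOn (fun x => (tanJacobian η x * (tanJacobian η x)ᵀ) a b)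
      (sphere 0 1) := fun a b x hx => by
    have h1 : ∀ a i, ContDiffAt ℝ 1 (fun y => tanJacobian η y a i) x :=
      contDiffAt_tanJacobian_apply (hx1 x hx).1 (by rw [(hx1 x hx).2]; exact hη x hx)
    exact (contDiffAt_matrix_mul_apply h1 (fun i a => h1 a i) a b).continuousAt.continuousWithinAt
  choose s hs using fun a b =>
    (isCompact_sphere (0 : EuclideanSpace ℝ ι) 1).exists_bound_of_continuousOn (hS a b)
  set t : ℝ := ∑ a, ∑ b, |s a b| with ht
  have hst : ∀ a b, s a b ≤ t := fun a b => by
    calc s a b ≤ |s a b| := le_abs_self _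
      _ ≤ ∑ b, |s a b| := Finset.single_le_sum (f := fun b => |s a b|)
        (fun b _ => abs_nonneg _) (Finset.mem_univ b)
      _ ≤ t := Finset.single_le_sum (f := fun a => ∑ b, |s a b|)
        (fun a _ => Finset.sum_nonneg fun b _ => abs_nonneg _) (Finset.mem_univ a)
  have ht0 : 0 ≤ t := Finset.sum_nonneg fun a _ => Finset.sum_nonneg fun b _ => abs_nonneg _
  refine ⟨√((m + 1).factorial * (t + 2) ^ (m + 1)), Real.sqrt_nonneg _, fun R hR x hx => ?_⟩
  have hd : DifferentiableAt ℝ η x := (hη x hx).differentiableAt two_ne_zero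
  have h1 := det_one_add_smul_le_of_mulVec_eq_zero hcard (z := (η x).ofLp)
    (S := tanJacobian η x * (tanJacobian η x)ᵀ) (by rw [dotProduct_ofLp_self, hunit x hx, one_pow])
    (by rw [← mulVec_mulVec, tanJacobian_transpose_mulVec hunit hx hd, mulVec_zero])
    (fun a b => (hs a b x hx).trans (hst a b)) hR
  rw [tanJacobian_smul (by rwa [(hx1 x hx).2]), transpose_smul, Matrix.smul_mul, Matrix.mul_smul,
    smul_smul, ← sq]
  refine (Real.sqrt_le_sqrt h1).trans_eq ?_
  rw [Real.sqrt_mul (by positivity), mul_comm 2 m, pow_mul, Real.sqrt_sq (by positivity)]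

end SphereValued

section Nonexistence

open Matrix Metric Filter Topology

open scoped NNReal

variable {ι κ : Type*} [Fintype ι] [DecidableEq ι] [Fintype κ] [DecidableEq κ]

/-- A stationary graph over the ball which extends a large multiple of a sphere-valued map into a
sphere of lower dimension does not meet the zero section. -/
theorem exists_forall_isStationaryGraph_ne_zero {m : ℕ} (hκ : Fintype.card κ = m + 1)
    (hι : m + 1 < Fintype.card ι) {η : EuclideanSpace ℝ ι → EuclideanSpace ℝ κ}
    (hη : ∀ x ∈ sphere 0 1, ContDiffAt ℝ 2 η x) (hunit : ∀ x ∈ sphere 0 1, ‖η x‖ = 1) :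
    ∃ R₀ > (0 : ℝ), ∀ R ≥ R₀, ∀ (F : EuclideanSpace ℝ ι → EuclideanSpace ℝ κ) (K : ℝ≥0),
      IsStationaryGraph F → LipschitzWith K F → (∀ x ∈ sphere 0 1, F x = R • η x) →
        ∀ x ∈ ball 0 1, F x ≠ 0 := by
  have : Nonempty ι := Fintype.card_pos_iff.1 (by lia)
  obtain ⟨c, hc, hlow⟩ := exists_mul_pow_le_integral_graphDensity (ι := ι) (κ := κ)
  obtain ⟨A, hA, hup⟩ := exists_boundary_density_le hκ hη hunit
  set W : ℝ := Fintype.card ι * volume.real (ball (0 : EuclideanSpace ℝ ι) 1) with hW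
  have hW0 : 0 ≤ W := by positivity
  refine ⟨2 + (A * 2 ^ m + 1) * W / c, by positivity, fun R hR F K hS hF hb x₀ hx₀ h0 => ?_⟩
  have hR2 : 2 ≤ R := le_trans (le_add_of_nonneg_right (by positivity)) hR
  have h1 := hlow F K hS hF R hR2 (fun x hx => by
    rw [hb x hx, norm_smul, hunit x hx, mul_one, Real.norm_of_nonneg (by linarith)]) x₀ hx₀ h0
  have h2 := hS.integral_graphDensity_le (by lia) hF
    (fun x hx => (hη x hx).const_smul R) hb (J := A * R ^ m) (by positivity)
    (hup R (by linarith))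
  have h3 : c * (R - 1) ^ Fintype.card ι ≤ (A * R ^ m + 1) * W := h1.trans h2
  have hR1 : 1 ≤ R - 1 := by linarith
  have h4 : R ^ m ≤ 2 ^ m * (R - 1) ^ m := by
    rw [← mul_pow]
    exact pow_le_pow_left₀ (by linarith) (by linarith) m
  have h5 : 1 ≤ (R - 1) ^ m := one_le_pow₀ hR1
  have h6 : (R - 1) ^ (m + 1) ≤ (R - 1) ^ Fintype.card ι := pow_le_pow_right₀ hR1 hι.le
  have h7 : A * R ^ m + 1 ≤ (A * 2 ^ m + 1) * (R - 1) ^ m := by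
    have := mul_le_mul_of_nonneg_left h4 hA
    linarith
  have h8 : c * (R - 1) * (R - 1) ^ m ≤ (A * 2 ^ m + 1) * W * (R - 1) ^ m := by
    have h9 := mul_le_mul_of_nonneg_left h6 hc.le
    have h10 := mul_le_mul_of_nonneg_right h7 hW0
    rw [pow_succ] at h9
    linarith
  have h11 : c * (R - 1) ≤ (A * 2 ^ m + 1) * W := le_of_mul_le_mul_right h8 (by positivity)
  have h12 : (A * 2 ^ m + 1) * W ≤ c * (R - 2) := by
    rw [mul_comm c, ← div_le_iff₀ hc]
    linarith
  linarith

/-- A sphere-valued map is null-homotopic if a multiple of it extends to the ball without zeros. -/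
lemma homotopic_const_of_ne_zero {E E' : Type*} [NormedAddCommGroup E] [NormedSpace ℝ E]
    [NormedAddCommGroup E'] [NormedSpace ℝ E'] {F : E → E'} (hF : ContinuousOn F (closedBall 0 1))
    (h0 : ∀ x ∈ closedBall 0 1, F x ≠ 0) (g : C(sphere (0 : E) 1, sphere (0 : E') 1)) {R : ℝ}
    (hR : 0 < R) (hg : ∀ x : sphere (0 : E) 1, F x = R • (g x : E')) :
    ∃ y, g.Homotopic (ContinuousMap.const _ y) := by
  have hmem : ∀ p : unitInterval × sphere (0 : E) 1,
      ((1 - p.1 : ℝ)) • (p.2 : E) ∈ closedBall (0 : E) 1 := fun p => by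
    have h1 : ‖(p.2 : E)‖ = 1 := by simp
    rw [mem_closedBall_zero_iff, norm_smul, h1, mul_one, Real.norm_eq_abs,
      abs_of_nonneg (by linarith [p.1.2.2])]
    linarith [p.1.2.1]
  have hc : Continuous fun p : unitInterval × sphere (0 : E) 1 => F ((1 - p.1 : ℝ) • (p.2 : E)) :=
    hF.comp_continuous (by fun_prop) hmem
  have hn : ∀ {v : E'}, v ≠ 0 → ‖v‖⁻¹ • v ∈ sphere (0 : E') 1 := fun {v} hv => by
    rw [mem_sphere_zero_iff_norm, norm_smul, norm_inv, norm_norm,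
      inv_mul_cancel₀ (norm_ne_zero_iff.2 hv)]
  have h0' : F 0 ≠ 0 := h0 0 (mem_closedBall_self zero_le_one)
  refine ⟨⟨‖F 0‖⁻¹ • F 0, hn h0'⟩, ⟨⟨⟨fun p =>
    ⟨‖F ((1 - p.1 : ℝ) • (p.2 : E))‖⁻¹ • F ((1 - p.1 : ℝ) • (p.2 : E)), hn (h0 _ (hmem p))⟩, ?_⟩,
    fun x => ?_, fun x => ?_⟩⟩⟩
  · exact ((hc.norm.inv₀ fun p => norm_ne_zero_iff.2 (h0 _ (hmem p))).smul hc).subtype_mk _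
  · have h1 : ‖(g x : E')‖ = 1 := by simp
    ext
    simp [hg, norm_smul, h1, abs_of_pos hR, smul_smul, hR.ne']
  · ext
    simp

lemma mssMetric_eq_graphMetric {n m : ℕ}
    (F : EuclideanSpace ℝ (Fin (n + 1)) → EuclideanSpace ℝ (Fin (m + 1)))
    (x : EuclideanSpace ℝ (Fin (n + 1))) : mssMetric F x = graphMetric (jacobian F x) := by
  ext i j
  simp [mssMetric, graphMetric, Matrix.mul_apply, Matrix.one_apply, jacobian_apply]

lemma IsMSSolution.exists_isStationaryGraph {n m : ℕ}
    {f F : EuclideanSpace ℝ (Fin (n + 1)) → EuclideanSpace ℝ (Fin (m + 1))}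
    (h : IsMSSolution n m (ball 0 1) f F) :
    ∃ (G : EuclideanSpace ℝ (Fin (n + 1)) → EuclideanSpace ℝ (Fin (m + 1))) (K : ℝ≥0),
      IsStationaryGraph G ∧ LipschitzWith K G ∧ ∀ x ∈ sphere 0 1, G x = f x := by
  obtain ⟨hc, ⟨K, hK⟩, hb, hw⟩ := h
  obtain ⟨G, hG, hFG⟩ := (hK.closure hc).extend_finite_dimension
  have hJ : ∀ x ∈ ball (0 : EuclideanSpace ℝ (Fin (n + 1))) 1, fderiv ℝ F x = fderiv ℝ G x :=
    fun x hx => Filter.EventuallyEq.fderiv_eq (by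
      filter_upwards [isOpen_ball.mem_nhds hx] with y hy using hFG (subset_closure hy))
  refine ⟨G, _, fun φ hφ hφc hφs a => ?_, hG, fun x hx => ?_⟩
  · have hsymm : ∀ x i j, (graphMetric (jacobian G x))⁻¹ i j = (graphMetric (jacobian G x))⁻¹ j i :=
      fun x i j => by
        conv_lhs => rw [← Matrix.transpose_apply (graphMetric (jacobian G x))⁻¹,
          Matrix.transpose_nonsing_inv]
        simp [graphMetric]
    rcases a with j | α
    · rw [← (hw φ hφ hφc hφs).1 j]
      refine setIntegral_congr_fun measurableSet_ball fun x hx => Finset.sum_congr rfl fun i _ => ?_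
      have h1 : jacobian F x = jacobian G x := by
        ext a i
        rw [jacobian_apply, jacobian_apply, hJ x hx]
      rw [mssMetric_eq_graphMetric, h1, graphDensity, hsymm x i j]
      simp [graphFrame, fromRows_mul]
    · rw [← (hw φ hφ hφc hφs).2 α]
      refine setIntegral_congr_fun measurableSet_ball fun x hx => Finset.sum_congr rfl fun i _ => ?_
      have h1 : jacobian F x = jacobian G x := by
        ext a i
        rw [jacobian_apply, jacobian_apply, hJ x hx]
      rw [← Finset.sum_mul, mssMetric_eq_graphMetric, h1, graphDensity, graphFrame, fromRows_mul,
        fromRows_apply_inr, Matrix.mul_apply, Finset.mul_sum]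
      congr 1
      refine Finset.sum_congr rfl fun j _ => ?_
      rw [hsymm x i j, ← jacobian_apply, h1]
      ring
  · rw [← hFG (closure_ball (0 : EuclideanSpace ℝ (Fin (n + 1))) one_ne_zero ▸
      sphere_subset_closedBall hx)]
    exact hb x (by rwa [frontier_ball _ one_ne_zero])

end Nonexistence
/-- (Lawson–Osserman) If `n > m ≥ 1` and `η : Sⁿ → Sᵐ` is a C² map which is not
null-homotopic, then for all sufficiently large `R` the Dirichlet problem for the
minimal surface system on the unit ball with boundary data `R·η` has no solution. -/
theorem lawson_osserman_nonexistence (n m : ℕ) (hm : 1 ≤ m) (hnm : m < n)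
    (η : EuclideanSpace ℝ (Fin (n+1)) → EuclideanSpace ℝ (Fin (m+1)))
    (V : Set (EuclideanSpace ℝ (Fin (n+1)))) (hVopen : IsOpen V)
    (hSV : Metric.sphere (0 : EuclideanSpace ℝ (Fin (n+1))) 1 ⊆ V)
    (hηC2 : ContDiffOn ℝ 2 η V)
    (hunit : ∀ x ∈ Metric.sphere (0 : EuclideanSpace ℝ (Fin (n+1))) 1, ‖η x‖ = 1)
    -- η|_{Sⁿ} : Sⁿ → Sᵐ is not null-homotopic
    (hnotnull : ∀ g : C(↥(Metric.sphere (0 : EuclideanSpace ℝ (Fin (n+1))) 1),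
        ↥(Metric.sphere (0 : EuclideanSpace ℝ (Fin (m+1))) 1)),
      (∀ x, (g x : EuclideanSpace ℝ (Fin (m+1))) = η x) →
      ∀ y, ¬ g.Homotopic (ContinuousMap.const _ y)) :
    ∃ Rη > (0:ℝ), ∀ R ≥ Rη,
      ¬ ∃ F, IsMSSolution n m (Metric.ball (0 : EuclideanSpace ℝ (Fin (n+1))) 1)
        (fun x => R • η x) F := by
  have hη : ∀ x ∈ Metric.sphere (0 : EuclideanSpace ℝ (Fin (n + 1))) 1, ContDiffAt ℝ 2 η x :=
    fun x hx => hηC2.contDiffAt (hVopen.mem_nhds (hSV hx))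
  obtain ⟨R₀, hR₀, hne⟩ := exists_forall_isStationaryGraph_ne_zero (m := m) (by simp)
    (by simpa using hnm) hη hunit
  refine ⟨R₀, hR₀, fun R hR ⟨F, hF⟩ => ?_⟩
  obtain ⟨G, K, hS, hG, hb⟩ := hF.exists_isStationaryGraph
  have hR0 : 0 < R := hR₀.trans_le hR
  have hG0 : ∀ x ∈ Metric.closedBall (0 : EuclideanSpace ℝ (Fin (n + 1))) 1, G x ≠ 0 := by
    intro x hx
    rw [← Metric.ball_union_sphere] at hx
    rcases hx with hx | hx
    · exact hne R hR G K hS hG hb x hx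
    · rw [hb x hx]
      refine smul_ne_zero hR0.ne' (norm_ne_zero_iff.1 ?_)
      rw [hunit x hx]
      exact one_ne_zero
  have hc : Continuous fun x : Metric.sphere (0 : EuclideanSpace ℝ (Fin (n + 1))) 1 => η x :=
    continuous_iff_continuousAt.2 fun x =>
      (hη x x.2).continuousAt.comp continuous_subtype_val.continuousAt
  have hmem : ∀ x : Metric.sphere (0 : EuclideanSpace ℝ (Fin (n + 1))) 1,
      η x ∈ Metric.sphere (0 : EuclideanSpace ℝ (Fin (m + 1))) 1 := fun x => by
    simpa using hunit x x.2
  let g : C(↥(Metric.sphere (0 : EuclideanSpace ℝ (Fin (n + 1))) 1),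
      ↥(Metric.sphere (0 : EuclideanSpace ℝ (Fin (m + 1))) 1)) :=
    ⟨fun x => ⟨η x, hmem x⟩, hc.subtype_mk hmem⟩
  obtain ⟨y, hy⟩ := homotopic_const_of_ne_zero hG.continuous.continuousOn hG0 g hR0
    fun x => hb x x.2
  exact hnotnull g (fun _ => rfl) y hy
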